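/- Every rate pair (R_1,R_2) in the region ℛ_{I,A} is achievable under the strong individual secrecy constraint by adaptive codes; that is, for every (R_1,R_2) in the closure of the convex hull of the union, over all finite sets 𝒱1, 𝒱2 and all input distributions P_{V1,V2,X1,X2} from the class 𝒬, of the regions ℛ_{I,A}(P) := { (R_1,R_2) ∈ ℝ_{≥0}² : R_1 ≤ I(Y_2;V_1|X_2), R_2 ≤ I(Y_1;V_2|X_1), max{R_1,R_2} ≤ I(Y_2;V_1|X_2) + I(Y_1;V_2|X_1) − I(V_1,V_2;Z), R_1+R_2 ≤ min{ I(Y_2;V_1|X_2) − I(Z;V_1), I(Y_2;V_1|X_2) + I(Y_1;V_2|X_1) − I(V_1,V_2;Z) } + min{ I(Y_1;V_2|X_1) − I(Z;V_2), I(Y_2;V_1|X_2) + I(Y_1;V_2|X_1) − I(V_1,V_2;Z) } }, there exists a sequence of (L_{1,n}, L_{2,n}, n) adaptive codes with (log L_{i,n})/n → R_i for i = 1,2, P_e^{(n)} → 0, I(M_1;Z^n) → 0 and I(M_2;Z^n) → 0 as n → ∞. -/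

import Mathlib

open Finset

noncomputable section

variable {V1 V2 X1 X2 Y1 Y2 Z : Type*}
  [Fintype V1] [Fintype V2] [Fintype X1] [Fintype X2] [Fintype Y1] [Fintype Y2] [Fintype Z]

/-- Single-letter joint law of `(V1,V2,X1,X2,Y1,Y2,Z)` induced by an input distribution
from the class `𝒬` and the two-way wiretap channel `W`. -/
def slJoint (PV1 : V1 → ℝ) (PX1 : V1 → X1 → ℝ) (PV2 : V2 → ℝ) (PX2 : V2 → X2 → ℝ)
    (W : X1 → X2 → Y1 × Y2 × Z → ℝ) :
    V1 × V2 × X1 × X2 × Y1 × Y2 × Z → ℝ :=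
  fun p => PV1 p.1 * PX1 p.1 p.2.2.1 * PV2 p.2.1 * PX2 p.2.1 p.2.2.2.1 *
    W p.2.2.1 p.2.2.2.1 (p.2.2.2.2.1, p.2.2.2.2.2.1, p.2.2.2.2.2.2)

/-- Single-letter marginal of `(Y2, V1, X2)`. -/
def pY2V1X2 (PV1 : V1 → ℝ) (PX1 : V1 → X1 → ℝ) (PV2 : V2 → ℝ) (PX2 : V2 → X2 → ℝ)
    (W : X1 → X2 → Y1 × Y2 × Z → ℝ) : Y2 × V1 × X2 → ℝ :=
  fun p => ∑ v2, ∑ x1, ∑ y1, ∑ z,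
    slJoint PV1 PX1 PV2 PX2 W (p.2.1, v2, x1, p.2.2, y1, p.1, z)

/-- Single-letter marginal of `(Y1, V2, X1)`. -/
def pY1V2X1 (PV1 : V1 → ℝ) (PX1 : V1 → X1 → ℝ) (PV2 : V2 → ℝ) (PX2 : V2 → X2 → ℝ)
    (W : X1 → X2 → Y1 × Y2 × Z → ℝ) : Y1 × V2 × X1 → ℝ :=
  fun p => ∑ v1, ∑ x2, ∑ y2, ∑ z,
    slJoint PV1 PX1 PV2 PX2 W (v1, p.2.1, p.2.2, x2, p.1, y2, z)

/-- Single-letter marginal of `((V1, V2), Z)`. -/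
def pV12Z (PV1 : V1 → ℝ) (PX1 : V1 → X1 → ℝ) (PV2 : V2 → ℝ) (PX2 : V2 → X2 → ℝ)
    (W : X1 → X2 → Y1 × Y2 × Z → ℝ) : (V1 × V2) × Z → ℝ :=
  fun p => ∑ x1, ∑ x2, ∑ y1, ∑ y2,
    slJoint PV1 PX1 PV2 PX2 W (p.1.1, p.1.2, x1, x2, y1, y2, p.2)

/-- Single-letter marginal of `(Z, V1)`. -/
def pZV1 (PV1 : V1 → ℝ) (PX1 : V1 → X1 → ℝ) (PV2 : V2 → ℝ) (PX2 : V2 → X2 → ℝ)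
    (W : X1 → X2 → Y1 × Y2 × Z → ℝ) : Z × V1 → ℝ :=
  fun p => ∑ v2, ∑ x1, ∑ x2, ∑ y1, ∑ y2,
    slJoint PV1 PX1 PV2 PX2 W (p.2, v2, x1, x2, y1, y2, p.1)

/-- Single-letter marginal of `(Z, V2)`. -/
def pZV2 (PV1 : V1 → ℝ) (PX1 : V1 → X1 → ℝ) (PV2 : V2 → ℝ) (PX2 : V2 → X2 → ℝ)
    (W : X1 → X2 → Y1 × Y2 × Z → ℝ) : Z × V2 → ℝ :=
  fun p => ∑ v1, ∑ x1, ∑ x2, ∑ y1, ∑ y2,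
    slJoint PV1 PX1 PV2 PX2 W (v1, p.2, x1, x2, y1, y2, p.1)

/-- Shannon mutual information `I(A;B)` of a joint PMF on `A × B` (natural log). -/
def miDist {A B : Type*} [Fintype A] [Fintype B] (P : A × B → ℝ) : ℝ :=
  ∑ a, ∑ b, P (a, b) * Real.log (P (a, b) / ((∑ b', P (a, b')) * (∑ a', P (a', b))))

/-- Shannon conditional mutual information `I(A;B|C)` of a joint PMF on `A × B × C`
(natural log). -/
def cmiDist {A B C : Type*} [Fintype A] [Fintype B] [Fintype C] (P : A × B × C → ℝ) : ℝ :=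
  ∑ a, ∑ b, ∑ c, P (a, b, c) *
    Real.log ((P (a, b, c) * ∑ a', ∑ b', P (a', b', c)) /
      ((∑ b', P (a, b', c)) * (∑ a', P (a', b, c))))

/-- Causality of an adaptive stochastic encoder: the conditional distribution of the
input at time `k` depends on the past inputs and outputs only. -/
def Causal {XI YI : Type*} (N L : ℕ)
    (φ : Fin N → Fin L → (Fin N → XI) → (Fin N → YI) → XI → ℝ) : Prop :=
  ∀ (k : Fin N) (m : Fin L) (x x' : Fin N → XI) (y y' : Fin N → YI),
    (∀ j : Fin N, (j : ℕ) < (k : ℕ) → x j = x' j ∧ y j = y' j) →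
    φ k m x y = φ k m x' y'

/-- Joint law of messages, inputs, outputs and eavesdropper observations induced by an
`(L1, L2, N)` adaptive code (with uniform independent messages) over `N` memoryless uses
of the channel `W`. -/
def PfullA (N L1 L2 : ℕ) (W : X1 → X2 → Y1 × Y2 × Z → ℝ)
    (φ1 : Fin N → Fin L1 → (Fin N → X1) → (Fin N → Y1) → X1 → ℝ)
    (φ2 : Fin N → Fin L2 → (Fin N → X2) → (Fin N → Y2) → X2 → ℝ) :
    (Fin L1 × Fin L2) × (Fin N → X1) × (Fin N → X2) × (Fin N → Y1) × (Fin N → Y2) ×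
      (Fin N → Z) → ℝ :=
  fun p => (1 / ((L1 : ℝ) * (L2 : ℝ))) *
    (∏ k, φ1 k p.1.1 p.2.1 p.2.2.2.1 (p.2.1 k)) *
    (∏ k, φ2 k p.1.2 p.2.2.1 p.2.2.2.2.1 (p.2.2.1 k)) *
    ∏ k, W (p.2.1 k) (p.2.2.1 k) (p.2.2.2.1 k, p.2.2.2.2.1 k, p.2.2.2.2.2 k)

/-- Average decoding error probability of an adaptive code. -/
def PeA (N L1 L2 : ℕ) (W : X1 → X2 → Y1 × Y2 × Z → ℝ)
    (φ1 : Fin N → Fin L1 → (Fin N → X1) → (Fin N → Y1) → X1 → ℝ)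
    (φ2 : Fin N → Fin L2 → (Fin N → X2) → (Fin N → Y2) → X2 → ℝ)
    (ψ1 : Fin L1 → (Fin N → X1) → (Fin N → Y1) → Fin L2)
    (ψ2 : Fin L2 → (Fin N → X2) → (Fin N → Y2) → Fin L1) : ℝ :=
  ∑ m1, ∑ m2, ∑ x1s, ∑ x2s, ∑ y1s, ∑ y2s, ∑ zs,
    PfullA N L1 L2 W φ1 φ2 ((m1, m2), x1s, x2s, y1s, y2s, zs) *
      (if ψ1 m1 x1s y1s ≠ m2 ∨ ψ2 m2 x2s y2s ≠ m1 then 1 else 0)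

/-- Joint leakage `I(M1,M2;Z^N)` of an adaptive code. -/
def leakJointA (N L1 L2 : ℕ) (W : X1 → X2 → Y1 × Y2 × Z → ℝ)
    (φ1 : Fin N → Fin L1 → (Fin N → X1) → (Fin N → Y1) → X1 → ℝ)
    (φ2 : Fin N → Fin L2 → (Fin N → X2) → (Fin N → Y2) → X2 → ℝ) : ℝ :=
  miDist (fun p : (Fin L1 × Fin L2) × (Fin N → Z) =>
    ∑ x1s, ∑ x2s, ∑ y1s, ∑ y2s, PfullA N L1 L2 W φ1 φ2 (p.1, x1s, x2s, y1s, y2s, p.2))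

/-- Individual leakage `I(M1;Z^N)` of an adaptive code. -/
def leakM1A (N L1 L2 : ℕ) (W : X1 → X2 → Y1 × Y2 × Z → ℝ)
    (φ1 : Fin N → Fin L1 → (Fin N → X1) → (Fin N → Y1) → X1 → ℝ)
    (φ2 : Fin N → Fin L2 → (Fin N → X2) → (Fin N → Y2) → X2 → ℝ) : ℝ :=
  miDist (fun p : Fin L1 × (Fin N → Z) =>
    ∑ m2, ∑ x1s, ∑ x2s, ∑ y1s, ∑ y2s,
      PfullA N L1 L2 W φ1 φ2 ((p.1, m2), x1s, x2s, y1s, y2s, p.2))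

/-- Individual leakage `I(M2;Z^N)` of an adaptive code. -/
def leakM2A (N L1 L2 : ℕ) (W : X1 → X2 → Y1 × Y2 × Z → ℝ)
    (φ1 : Fin N → Fin L1 → (Fin N → X1) → (Fin N → Y1) → X1 → ℝ)
    (φ2 : Fin N → Fin L2 → (Fin N → X2) → (Fin N → Y2) → X2 → ℝ) : ℝ :=
  miDist (fun p : Fin L2 × (Fin N → Z) =>
    ∑ m1, ∑ x1s, ∑ x2s, ∑ y1s, ∑ y2s,
      PfullA N L1 L2 W φ1 φ2 ((m1, p.1), x1s, x2s, y1s, y2s, p.2))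

/-- An input distribution from the class `𝒬`: independent auxiliary variables `V1, V2`
over arbitrary finite alphabets together with the prefixing kernels `P_{X1|V1}`,
`P_{X2|V2}`. -/
structure InputDist (X1 X2 : Type*) [Fintype X1] [Fintype X2] where
  V1 : Type
  V2 : Type
  [fV1 : Fintype V1]
  [fV2 : Fintype V2]
  PV1 : V1 → ℝ
  PX1 : V1 → X1 → ℝ
  PV2 : V2 → ℝ
  PX2 : V2 → X2 → ℝ
  PV1_nonneg : ∀ v, 0 ≤ PV1 v
  PV1_sum : ∑ v, PV1 v = 1
  PX1_nonneg : ∀ v x, 0 ≤ PX1 v x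
  PX1_sum : ∀ v, ∑ x, PX1 v x = 1
  PV2_nonneg : ∀ v, 0 ≤ PV2 v
  PV2_sum : ∑ v, PV2 v = 1
  PX2_nonneg : ∀ v x, 0 ≤ PX2 v x
  PX2_sum : ∀ v, ∑ x, PX2 v x = 1

attribute [instance] InputDist.fV1 InputDist.fV2


open scoped BigOperators


/-- Expectation of a functional of a random codebook whose entries are i.i.d. with law `P`. -/
def codebookMean {I V : Type*} [Fintype I] [Fintype V] [DecidableEq I] (P : V → ℝ)
    (F : (I → V) → ℝ) : ℝ :=
  ∑ f : I → V, (∏ i, P (f i)) * F f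

section Codebook

variable {I V J : Type*} [Fintype I] [Fintype V] [DecidableEq I] [Fintype J]
  {P : V → ℝ}

lemma codebookMean_prod (P : V → ℝ) (G : I → V → ℝ) :
    codebookMean P (fun f => ∏ i, G i (f i)) = ∏ i, ∑ v, P v * G i v := by
  unfold codebookMean
  rw [Finset.prod_univ_sum]
  simp [Finset.prod_mul_distrib]

lemma codebookMean_sum {α : Type*} (s : Finset α) (F : α → (I → V) → ℝ) :
    codebookMean P (fun f => ∑ a ∈ s, F a f) = ∑ a ∈ s, codebookMean P (F a) := by
  unfold codebookMean
  simp_rw [Finset.mul_sum]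
  rw [Finset.sum_comm]

lemma codebookMean_mul (c : ℝ) (F : (I → V) → ℝ) :
    codebookMean P (fun f => c * F f) = c * codebookMean P F := by
  unfold codebookMean
  rw [Finset.mul_sum]
  exact Finset.sum_congr rfl fun _ _ => by ring

lemma codebookMean_add (F G : (I → V) → ℝ) :
    codebookMean P (fun f => F f + G f) = codebookMean P F + codebookMean P G := by
  unfold codebookMean
  rw [← Finset.sum_add_distrib]
  exact Finset.sum_congr rfl fun _ _ => by ring

lemma codebookMean_mono (hP : ∀ v, 0 ≤ P v) {F G : (I → V) → ℝ} (h : ∀ f, F f ≤ G f) :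
    codebookMean P F ≤ codebookMean P G :=
  Finset.sum_le_sum fun f _ =>
    mul_le_mul_of_nonneg_left (h f) (Finset.prod_nonneg fun _ _ => hP _)

lemma codebookMean_const (hP1 : ∑ v, P v = 1) (c : ℝ) :
    codebookMean P (fun _ : I → V => c) = c := by
  have := codebookMean_prod (I := I) P (fun _ _ => 1)
  simp only [Finset.prod_const_one, mul_one, hP1] at this
  have h2 := codebookMean_mul (I := I) (P := P) c (fun _ => 1)
  simpa [this] using h2

lemma codebookMean_eval (hP1 : ∑ v, P v = 1) (i : I) (F : V → ℝ) :
    codebookMean P (fun f : I → V => F (f i)) = ∑ v, P v * F v := by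
  have h := codebookMean_prod (I := I) P (fun k v => if k = i then F v else 1)
  have h1 : ∀ f : I → V, (∏ k, if k = i then F (f k) else 1) = F (f i) := fun f => by
    rw [Finset.prod_ite_eq' Finset.univ i (fun k => F (f k))]; simp
  simp_rw [h1] at h
  rw [h]
  rw [Finset.prod_eq_single i]
  · simp
  · intro k _ hk; simp [hk, hP1]
  · simp

lemma codebookMean_eval₂ (hP1 : ∑ v, P v = 1) {i j : I} (hij : i ≠ j) (F : V → V → ℝ) :
    codebookMean P (fun f : I → V => F (f i) (f j)) = ∑ v, ∑ v', P v * P v' * F v v' := by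
  classical
  have key : ∀ v v', codebookMean P (fun f : I → V =>
      if f i = v ∧ f j = v' then 1 else 0) = P v * P v' := by
    intro v v'
    have h := codebookMean_prod (I := I) P (fun k u =>
      (if k = i then (if u = v then 1 else 0) else 1) *
        (if k = j then (if u = v' then 1 else 0) else 1))
    have h1 : ∀ f : I → V, (∏ k, (if k = i then (if f k = v then (1 : ℝ) else 0) else 1) *
        (if k = j then (if f k = v' then 1 else 0) else 1)) =
          if f i = v ∧ f j = v' then 1 else 0 := by
      intro f
      rw [Finset.prod_mul_distrib,
        Finset.prod_ite_eq' Finset.univ i (fun k => if f k = v then (1 : ℝ) else 0),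
        Finset.prod_ite_eq' Finset.univ j (fun k => if f k = v' then (1 : ℝ) else 0)]
      by_cases h1 : f i = v <;> by_cases h2 : f j = v' <;> simp [h1, h2]
    simp_rw [h1] at h
    rw [h]
    have h2 : ∀ k, (∑ u, P u * ((if k = i then (if u = v then (1 : ℝ) else 0) else 1) *
        (if k = j then (if u = v' then 1 else 0) else 1))) =
        (if k = i then P v else 1) * (if k = j then P v' else 1) := by
      intro k
      by_cases hi : k = i
      · have hj : k ≠ j := fun h => hij (hi ▸ h)
        simp [hi, hij]
      · by_cases hj : k = j
        · simp [hj, hij.symm]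
        · simp [hi, hj, hP1]
    simp_rw [h2]
    rw [Finset.prod_mul_distrib]
    simp
  have h3 : ∀ f : I → V, F (f i) (f j) =
      ∑ v, ∑ v', F v v' * (if f i = v ∧ f j = v' then 1 else 0) := by
    intro f
    rw [Finset.sum_eq_single (f i), Finset.sum_eq_single (f j)]
    · simp
    · intro b _ hb; simp [hb.symm]
    · simp
    · intro b _ hb; simp [hb.symm]
    · simp
  calc codebookMean P (fun f : I → V => F (f i) (f j))
      = codebookMean P (fun f : I → V =>
          ∑ v, ∑ v', F v v' * (if f i = v ∧ f j = v' then 1 else 0)) := by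
        congr 1; funext f; exact h3 f
    _ = _ := by
        rw [codebookMean_sum]
        refine Finset.sum_congr rfl fun v _ => ?_
        rw [codebookMean_sum]
        refine Finset.sum_congr rfl fun v' _ => ?_
        rw [codebookMean_mul, key]; ring

lemma sum_codebookMean_eval₂_le (hP : ∀ v, 0 ≤ P v) (hP1 : ∑ v, P v = 1) {e : J → I}
    (he : Function.Injective e) (j : J) {F : V → V → ℝ} (hF : ∀ v v', 0 ≤ F v v') :
    ∑ j', codebookMean P (fun f : I → V => F (f (e j)) (f (e j'))) ≤
      ∑ v, P v * F v v + Fintype.card J * ∑ v, ∑ v', P v * P v' * F v v' := by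
  classical
  have h0 : (0 : ℝ) ≤ ∑ v, ∑ v', P v * P v' * F v v' :=
    Finset.sum_nonneg fun v _ => Finset.sum_nonneg fun v' _ =>
      mul_nonneg (mul_nonneg (hP v) (hP v')) (hF v v')
  rw [← Finset.add_sum_erase _ _ (Finset.mem_univ j)]
  refine add_le_add ?_ ?_
  · exact (codebookMean_eval hP1 (e j) (fun v => F v v)).le
  · calc ∑ j' ∈ Finset.univ.erase j, codebookMean P (fun f : I → V => F (f (e j)) (f (e j')))
        = ∑ j' ∈ Finset.univ.erase j, ∑ v, ∑ v', P v * P v' * F v v' :=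
          Finset.sum_congr rfl fun j' hj' => codebookMean_eval₂ hP1
            (fun h => (Finset.ne_of_mem_erase hj') (he h).symm) F
      _ ≤ ∑ j' : J, ∑ v, ∑ v', P v * P v' * F v v' :=
          Finset.sum_le_sum_of_subset_of_nonneg (Finset.erase_subset _ _) fun _ _ _ => h0
      _ = _ := by simp

lemma sum_erase_codebookMean_eval₂ (hP1 : ∑ v, P v = 1) (j : I) (F : V → V → ℝ) :
    ∑ j' ∈ Finset.univ.erase j, codebookMean P (fun f : I → V => F (f j) (f j')) =
      (Fintype.card I - 1) * ∑ v, ∑ v', P v * P v' * F v v' := by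
  rw [Finset.sum_congr rfl fun j' hj' => codebookMean_eval₂ hP1
            (fun h => (Finset.ne_of_mem_erase hj') h.symm) F]
  rw [Finset.sum_const, Finset.card_erase_of_mem (Finset.mem_univ j), nsmul_eq_mul,
    Finset.card_univ, Nat.cast_sub (Fintype.card_pos_iff.2 ⟨j⟩)]
  simp

lemma exists_le_codebookMean (hP : ∀ v, 0 ≤ P v) (hP1 : ∑ v, P v = 1) (F : (I → V) → ℝ) :
    ∃ f, F f ≤ codebookMean P F := by
  by_contra! h
  have h1 : codebookMean P (fun f => F f - codebookMean P F) = 0 := by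
    have := codebookMean_add (P := P) F (fun _ => - codebookMean P F)
    rw [codebookMean_const hP1] at this
    simpa [sub_eq_add_neg] using this
  have h2 : ∀ f : I → V, 0 ≤ (∏ i, P (f i)) * (F f - codebookMean P F) := fun f =>
    mul_nonneg (Finset.prod_nonneg fun _ _ => hP _) (sub_nonneg.2 (h f).le)
  have h3 := (Finset.sum_eq_zero_iff_of_nonneg (fun f _ => h2 f)).1 h1
  have h4 : ∀ f : I → V, (∏ i, P (f i)) = 0 := fun f => by
    rcases mul_eq_zero.1 (h3 f (Finset.mem_univ f)) with h | h'
    · exact h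
    · exact absurd h' (sub_pos.2 (h f)).ne'
  have h5 := codebookMean_const (I := I) hP1 1
  simp [codebookMean, h4] at h5

end Codebook

section Affinity

lemma abs_sub_le_affinity {q p l : ℝ} (hq : 0 ≤ q) (hp : 0 ≤ p) (hl : 0 < l) :
    |q - p| ≤ l / 2 * (q + p) + 1 / l * ((q + p) / 2 - 2 * (q * p / (q + p))) := by
  rcases eq_or_lt_of_le (add_nonneg hq hp) with h | h
  · obtain rfl : q = 0 := by linarith
    obtain rfl : p = 0 := by linarith
    simp
  · have e : (q + p) / 2 - 2 * (q * p / (q + p)) = |q - p| ^ 2 / (2 * (q + p)) := by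
      rw [sq_abs]; field_simp; ring
    rw [e]
    have h2 : l / 2 * (q + p) + 1 / l * (|q - p| ^ 2 / (2 * (q + p))) - |q - p| =
        (l * (q + p) - |q - p|) ^ 2 / (2 * l * (q + p)) := by
      field_simp; ring
    have h3 : 0 ≤ (l * (q + p) - |q - p|) ^ 2 / (2 * l * (q + p)) := by positivity
    linarith

/-- The `ℓ¹` distance of two distributions is controlled by their harmonic affinity. -/
lemma l1_le_affinity {A : Type*} [Fintype A] {q p : A → ℝ} (hq : ∀ a, 0 ≤ q a)
    (hp : ∀ a, 0 ≤ p a) (hq1 : ∑ a, q a = 1) (hp1 : ∑ a, p a = 1) {l : ℝ} (hl : 0 < l) :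
    ∑ a, |q a - p a| ≤ l + 1 / l * (1 - 2 * ∑ a, q a * p a / (q a + p a)) := by
  refine (Finset.sum_le_sum fun a _ => abs_sub_le_affinity (hq a) (hp a) hl).trans (le_of_eq ?_)
  rw [Finset.sum_add_distrib, ← Finset.mul_sum, ← Finset.mul_sum, Finset.sum_sub_distrib,
    ← Finset.sum_div, Finset.sum_add_distrib, hq1, hp1, ← Finset.mul_sum]
  ring

lemma div_tangent {c u h : ℝ} (hc : 0 ≤ c) (hu : 0 ≤ u) (h0 : u = 0 → c = 0) :
    c * (2 / h - u / h ^ 2) ≤ c / u := by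
  rcases eq_or_lt_of_le hu with h1 | h1
  · simp [h0 h1.symm]
  · rcases eq_or_ne h 0 with rfl | hh
    · simp; positivity
    · rw [show c / u = c * u⁻¹ from div_eq_mul_inv c u]
      refine mul_le_mul_of_nonneg_left ?_ hc
      have : u⁻¹ - (2 / h - u / h ^ 2) = (h - u) ^ 2 / (u * h ^ 2) := by field_simp; ring
      have h3 : 0 ≤ (h - u) ^ 2 / (u * h ^ 2) := by positivity
      linarith

end Affinity


/-- The tilted information functional `E[(U(D|A) / Ū(D))^t]`. -/
def tilted {A D : Type*} [Fintype A] [Fintype D] (P : A → ℝ) (U : A → D → ℝ) (t : ℝ) : ℝ :=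
  ∑ a, P a * ∑ d, U a d * (U a d / ∑ a', P a' * U a' d) ^ t

section Covering

lemma div_one_add_le_rpow {y s : ℝ} (hy : 0 ≤ y) (hs : 0 < s) (hs1 : s ≤ 1) :
    y / (1 + y) ≤ y ^ s := by
  rcases le_total y 1 with h | h
  · rcases eq_or_lt_of_le hy with rfl | h0
    · simp [Real.zero_rpow hs.ne']
    · calc y / (1 + y) ≤ y := div_le_self hy (by linarith)
        _ = y ^ (1 : ℝ) := (Real.rpow_one y).symm
        _ ≤ y ^ s := Real.rpow_le_rpow_of_exponent_ge h0 h hs1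
  · calc y / (1 + y) ≤ 1 := by rw [div_le_one (by linarith)]; linarith
      _ ≤ y ^ s := Real.one_le_rpow h hs.le

lemma div_add_le_rpow {t p T s : ℝ} (ht : 0 ≤ t) (hp : 0 < p) (htT : t ≤ T) (hs : 0 < s)
    (hs1 : s ≤ 1) : t / (2 * p + T) ≤ (t / p) ^ s := by
  refine le_trans ?_ (div_one_add_le_rpow (div_nonneg ht hp.le) hs hs1)
  have : t / p / (1 + t / p) = t / (p + t) := by field_simp
  rw [this]
  exact div_le_div_of_nonneg_left ht (by linarith) (by linarith)

lemma expected_l1_le {A Ω D : Type*} [Fintype A] [Nonempty A] [Fintype Ω] [Fintype D]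
    {μ : Ω → ℝ} (hμ : ∀ ω, 0 ≤ μ ω) (hμ1 : ∑ ω, μ ω = 1) {w : A → Ω → D → ℝ}
    (hw : ∀ a ω z, 0 ≤ w a ω z) (hw1 : ∀ a ω, ∑ z, w a ω z = 1) {p : D → ℝ}
    (hp : ∀ z, 0 ≤ p z) (hp1 : ∑ z, p z = 1) (h : A → Ω → D → ℝ)
    (hh : ∀ a z, ∑ ω, μ ω * (w a ω z * p z / h a ω z ^ 2 * ((𝔼 b, w b ω z) + p z)) ≤
      ∑ ω, μ ω * (w a ω z * p z / h a ω z)) {l : ℝ} (hl : 0 < l) :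
    ∑ ω, μ ω * ∑ z, |(𝔼 a, w a ω z) - p z| ≤
      l + 1 / l * 𝔼 a, ∑ ω, μ ω * ∑ z, w a ω z * (1 - 2 * (p z / h a ω z)) := by
  have hq : ∀ ω z, 0 ≤ 𝔼 b, w b ω z := fun ω z => Finset.expect_nonneg fun a _ => hw a ω z
  have hq1 : ∀ ω, ∑ z, 𝔼 b, w b ω z = 1 := fun ω => by
    rw [← Finset.expect_sum_comm]
    simp [hw1]
  have h1 : ∀ ω, ∑ z, |(𝔼 a, w a ω z) - p z| ≤ l + 1 / l * (1 - 2 * ∑ z,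
      (𝔼 a, w a ω z) * p z / ((𝔼 a, w a ω z) + p z)) := fun ω =>
    l1_le_affinity (hq ω) hp (hq1 ω) hp1 hl
  have h2 : ∀ a, ∑ ω, μ ω * ∑ z, w a ω z * (p z / h a ω z) ≤
      ∑ ω, μ ω * ∑ z, w a ω z * p z / ((𝔼 b, w b ω z) + p z) := by
    intro a
    simp_rw [Finset.mul_sum]
    refine Finset.sum_comm.trans_le (le_trans ?_ Finset.sum_comm.le)
    refine Finset.sum_le_sum fun z _ => ?_
    have e : ∑ ω, μ ω * (w a ω z * (p z / h a ω z)) ≤ ∑ ω, μ ω * (w a ω z * p z *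
        (2 / h a ω z - ((𝔼 b, w b ω z) + p z) / h a ω z ^ 2)) := by
      have e1 : ∑ ω, μ ω * (w a ω z * p z *
        (2 / h a ω z - ((𝔼 b, w b ω z) + p z) / h a ω z ^ 2)) =
          2 * ∑ ω, μ ω * (w a ω z * p z / h a ω z) -
          ∑ ω, μ ω * (w a ω z * p z / h a ω z ^ 2 * ((𝔼 b, w b ω z) + p z)) := by
        rw [Finset.mul_sum, ← Finset.sum_sub_distrib]
        exact Finset.sum_congr rfl fun ω _ => by ring
      have e2 := hh a z
      have e3 : ∑ ω, μ ω * (w a ω z * (p z / h a ω z)) =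
        ∑ ω, μ ω * (w a ω z * p z / h a ω z) :=
        Finset.sum_congr rfl fun ω _ => by ring
      linarith
    refine e.trans (Finset.sum_le_sum fun ω _ => mul_le_mul_of_nonneg_left ?_ (hμ ω))
    refine div_tangent (mul_nonneg (hw a ω z) (hp z)) (add_nonneg (hq ω z) (hp z)) fun h0 => ?_
    have := hq ω z
    have := hp z
    have : p z = 0 := by linarith
    simp [this]
  have h3 : 𝔼 a, ∑ ω, μ ω * ∑ z, w a ω z * (p z / h a ω z) ≤
      ∑ ω, μ ω * ∑ z, (𝔼 a, w a ω z) * p z / ((𝔼 a, w a ω z) + p z) := by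
    refine (Finset.expect_le_expect fun a _ => h2 a).trans (le_of_eq ?_)
    rw [Finset.expect_sum_comm]
    refine Finset.sum_congr rfl fun ω _ => ?_
    rw [← Finset.mul_expect, Finset.expect_sum_comm]
    congr 1
    refine Finset.sum_congr rfl fun z _ => ?_
    rw [← Finset.expect_div, ← Finset.expect_mul]
  have h4 : 𝔼 a, ∑ ω, μ ω * ∑ z, w a ω z * (1 - 2 * (p z / h a ω z)) =
      1 - 2 * 𝔼 a, ∑ ω, μ ω * ∑ z, w a ω z * (p z / h a ω z) := by
    have h5 : ∀ a, ∑ ω, μ ω * ∑ z, w a ω z * (1 - 2 * (p z / h a ω z)) =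
        1 - 2 * ∑ ω, μ ω * ∑ z, w a ω z * (p z / h a ω z) := by
      intro a
      conv_rhs => rw [← hμ1, Finset.mul_sum, ← Finset.sum_sub_distrib]
      refine Finset.sum_congr rfl fun ω _ => ?_
      have : ∑ z, w a ω z * (1 - 2 * (p z / h a ω z)) =
          1 - 2 * ∑ z, w a ω z * (p z / h a ω z) := by
        conv_rhs => rw [← hw1 a ω, Finset.mul_sum, ← Finset.sum_sub_distrib]
        exact Finset.sum_congr rfl fun z _ => by ring
      rw [this]; ring
    simp_rw [h5]
    rw [Finset.expect_sub_distrib, ← Finset.mul_expect, Fintype.expect_const]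
  calc _ ≤ ∑ ω, μ ω * (l + 1 / l * (1 - 2 * ∑ z,
      (𝔼 a, w a ω z) * p z / ((𝔼 a, w a ω z) + p z))) :=
        Finset.sum_le_sum fun ω _ => mul_le_mul_of_nonneg_left (h1 ω) (hμ ω)
    _ = l + 1 / l * (1 - 2 * ∑ ω, μ ω * ∑ z,
      (𝔼 a, w a ω z) * p z / ((𝔼 a, w a ω z) + p z)) := by
        have : ∀ ω, μ ω * (l + 1 / l * (1 - 2 * ∑ z,
          (𝔼 a, w a ω z) * p z / ((𝔼 a, w a ω z) + p z))) = (l + 1 / l) * μ ω - 2 / l * (μ ω * ∑ z,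
          (𝔼 a, w a ω z) * p z / ((𝔼 a, w a ω z) + p z)) := fun ω => by ring
        simp_rw [this, Finset.sum_sub_distrib, ← Finset.mul_sum, hμ1]
        ring
    _ ≤ _ := by
        rw [h4]
        gcongr

lemma codebook_weights_sum {I V : Type*} [Fintype I] [Fintype V] [DecidableEq I] {P : V → ℝ}
    (hP1 : ∑ v, P v = 1) : ∑ f : I → V, ∏ i, P (f i) = 1 := by
  have := codebookMean_const (I := I) hP1 1
  simpa [codebookMean] using this

variable {I J V D : Type*} [Fintype I] [DecidableEq I] [Fintype J] [Nonempty J] [Fintype V]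
  [Fintype D]

/-- Soft covering for a single random codebook. -/
lemma codebookMean_l1_le {P : V → ℝ} (hP : ∀ v, 0 ≤ P v) (hP1 : ∑ v, P v = 1)
    {w : V → D → ℝ} (hw : ∀ v z, 0 ≤ w v z) (hw1 : ∀ v, ∑ z, w v z = 1)
    {e : J → I} (he : Function.Injective e) {l s : ℝ} (hl : 0 < l) (hs : 0 < s) (hs1 : s ≤ 1) :
    codebookMean P (fun f : I → V => ∑ z, |(𝔼 j, w (f (e j)) z) - ∑ v, P v * w v z|) ≤
      l + 1 / l * ((Fintype.card J : ℝ) ^ (-s) * tilted P w s) := by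
  set p : D → ℝ := fun z => ∑ v, P v * w v z with hpdef
  set M : ℝ := (Fintype.card J : ℝ) with hM
  have hMpos : 0 < M := by rw [hM]; exact_mod_cast Fintype.card_pos
  have hp : ∀ z, 0 ≤ p z := fun z => Finset.sum_nonneg fun v _ => mul_nonneg (hP v) (hw v z)
  have hp1 : ∑ z, p z = 1 := by
    simp only [hpdef]; rw [Finset.sum_comm]; simp_rw [← Finset.mul_sum, hw1, mul_one, hP1]
  set H : V → D → ℝ := fun v z => 2 * p z + w v z / M with hH
  have hH0 : ∀ v z, 0 ≤ H v z := fun v z =>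
    add_nonneg (mul_nonneg zero_le_two (hp z)) (div_nonneg (hw v z) hMpos.le)
  have key := expected_l1_le (A := J) (Ω := I → V) (μ := fun f => ∏ i, P (f i))
    (fun f => Finset.prod_nonneg fun _ _ => hP _) (codebook_weights_sum hP1)
    (w := fun j f z => w (f (e j)) z) (fun _ _ _ => hw _ _) (fun _ _ => hw1 _) hp hp1
    (fun j f z => H (f (e j)) z) ?_ hl
  · refine key.trans ?_
    have h1 : ∀ j, ∑ f : I → V, (∏ i, P (f i)) * ∑ z, w (f (e j)) z * (1 - 2 *
        (p z / H (f (e j)) z)) ≤ M ^ (-s) * tilted P w s := by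
      intro j
      have := codebookMean_eval (I := I) hP1 (e j)
        (fun v => ∑ z, w v z * (1 - 2 * (p z / H v z)))
      unfold codebookMean at this
      rw [this]
      unfold tilted
      rw [Finset.mul_sum]
      refine Finset.sum_le_sum fun v _ => ?_
      rcases eq_or_lt_of_le (hP v) with h0 | h0
      · simp [← h0]
      · rw [mul_left_comm]
        refine mul_le_mul_of_nonneg_left ?_ h0.le
        rw [Finset.mul_sum]
        refine Finset.sum_le_sum fun z _ => ?_
        rw [mul_left_comm]
        rcases eq_or_ne (w v z) 0 with hz | hz
        · simp [hz]
        · refine mul_le_mul_of_nonneg_left ?_ (hw v z)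
          · have hpz : 0 < p z := lt_of_lt_of_le (mul_pos h0 (lt_of_le_of_ne (hw v z) (Ne.symm hz)))
              (Finset.single_le_sum (f := fun v => P v * w v z)
                (fun v _ => mul_nonneg (hP v) (hw v z)) (Finset.mem_univ v))
            have e1 : 1 - 2 * (p z / H v z) = (w v z / M) / (2 * p z + w v z / M) := by
              have : 0 < 2 * p z + w v z / M :=
                add_pos_of_pos_of_nonneg (by linarith) (div_nonneg (hw v z) hMpos.le)
              have h3 : H v z = 2 * p z + w v z / M := rfl
              rw [← h3] at this ⊢
              rw [eq_div_iff this.ne', sub_mul, mul_assoc, div_mul_cancel₀ _ this.ne', h3]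
              ring
            rw [e1]
            refine (div_add_le_rpow (div_nonneg (hw v z) hMpos.le) hpz le_rfl hs hs1).trans ?_
            rw [show w v z / M / p z = M⁻¹ * (w v z / p z) by field_simp,
              Real.mul_rpow (inv_nonneg.2 hMpos.le) (div_nonneg (hw v z) (hp z)),
              Real.inv_rpow hMpos.le, ← Real.rpow_neg hMpos.le]
    have h2 : 𝔼 j, ∑ f : I → V, (∏ i, P (f i)) * ∑ z, w (f (e j)) z * (1 - 2 *
        (p z / H (f (e j)) z)) ≤ M ^ (-s) * tilted P w s :=
      (Finset.expect_le_expect fun j _ => h1 j).trans_eq (Fintype.expect_const _)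
    gcongr
  · intro j z
    have e1 : ∀ f : I → V, w (f (e j)) z * p z / H (f (e j)) z ^ 2 *
        ((𝔼 b, w (f (e b)) z) + p z) =
        (∑ j', (fun v v' => M⁻¹ * (w v z * p z / H v z ^ 2 * w v' z)) (f (e j)) (f (e j'))) +
          w (f (e j)) z * p z / H (f (e j)) z ^ 2 * p z := by
      intro f
      rw [mul_add, Fintype.expect_eq_sum_div_card, ← hM]
      congr 1
      simp_rw [← Finset.mul_sum]
      ring
    have e2 := sum_codebookMean_eval₂_le hP hP1 he j
      (F := fun v v' => M⁻¹ * (w v z * p z / H v z ^ 2 * w v' z)) (fun v v' => by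
        have := hw v z; have := hw v' z; have := hp z; positivity)
    have e3 := codebookMean_eval (I := I) hP1 (e j) (fun v => w v z * p z / H v z ^ 2 * p z)
    have e4 := codebookMean_eval (I := I) hP1 (e j) (fun v => w v z * p z / H v z)
    have e5 := codebookMean_add (P := P) (fun f : I → V =>
      (∑ j', (fun v v' => M⁻¹ * (w v z * p z / H v z ^ 2 * w v' z)) (f (e j)) (f (e j'))))
      (fun f => w (f (e j)) z * p z / H (f (e j)) z ^ 2 * p z)
    rw [codebookMean_sum, e3] at e5
    unfold codebookMean at e4 e5 e2
    simp_rw [e1]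
    rw [e5, e4]
    refine (add_le_add_left e2 _).trans ?_
    have e6 : ∑ v, ∑ v', P v * P v' * (M⁻¹ * (w v z * p z / H v z ^ 2 * w v' z)) =
        ∑ v, M⁻¹ * (P v * (w v z * p z / H v z ^ 2 * p z)) := by
      refine Finset.sum_congr rfl fun v _ => ?_
      change _ = M⁻¹ * (P v * (w v z * p z / H v z ^ 2 * ∑ v', P v' * w v' z))
      generalize w v z * p z / H v z ^ 2 = c
      rw [Finset.mul_sum, Finset.mul_sum, Finset.mul_sum]
      exact Finset.sum_congr rfl fun v' _ => by ring
    rw [e6, ← Finset.mul_sum, ← mul_assoc, ← hM, mul_inv_cancel₀ hMpos.ne', one_mul,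
      ← Finset.sum_add_distrib, ← Finset.sum_add_distrib]
    refine Finset.sum_le_sum fun v _ => ?_
    rw [← mul_add, ← mul_add]
    refine mul_le_mul_of_nonneg_left ?_ (hP v)
    rcases eq_or_ne (H v z) 0 with h0 | h0
    · simp [h0]
    · refine le_of_eq ?_
      have : M⁻¹ * (w v z * p z / H v z ^ 2 * w v z) + w v z * p z / H v z ^ 2 * p z +
        w v z * p z / H v z ^ 2 * p z = w v z * p z / H v z ^ 2 * H v z := by
        conv_rhs => rw [hH]
        simp only
        ring
      have h7 : w v z * p z / H v z ^ 2 * H v z = w v z * p z / H v z := by field_simp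
      rw [← h7, ← this]

end Covering

section MacCovering

variable {I J I' J' : Type*} [Fintype I] [DecidableEq I] [Fintype J] [DecidableEq J]
  [Fintype I'] [Fintype J']

lemma sum_prod_weights (P1 : V1 → ℝ) (P2 : V2 → ℝ) (F : (I → V1) → (J → V2) → ℝ) :
    ∑ ω : (I → V1) × (J → V2), ((∏ i, P1 (ω.1 i)) * ∏ j, P2 (ω.2 j)) * F ω.1 ω.2 =
      codebookMean P1 fun f => codebookMean P2 fun g => F f g := by
  rw [Fintype.sum_prod_type]
  unfold codebookMean
  refine Finset.sum_congr rfl fun f _ => ?_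
  rw [Finset.mul_sum]
  exact Finset.sum_congr rfl fun g _ => by ring

lemma codebookMean_pair_le {P1 : V1 → ℝ} {P2 : V2 → ℝ} (hP1 : ∀ v, 0 ≤ P1 v)
    (hP1' : ∑ v, P1 v = 1) (hP2 : ∀ v, 0 ≤ P2 v) (hP2' : ∑ v, P2 v = 1)
    {c w : V1 → V2 → ℝ} (hc : ∀ u v, 0 ≤ c u v) (hw : ∀ u v, 0 ≤ w u v)
    {e1 : I' → I} (he1 : Function.Injective e1) {e2 : J' → J} (he2 : Function.Injective e2)
    (i : I') (j : J') :
    codebookMean P1 (fun f : I → V1 => codebookMean P2 (fun g : J → V2 =>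
      c (f (e1 i)) (g (e2 j)) * ∑ i', ∑ j', w (f (e1 i')) (g (e2 j')))) ≤
    ∑ u, P1 u * ∑ v, P2 v * (c u v * (w u v + Fintype.card J' * (∑ v', P2 v' * w u v') +
      Fintype.card I' * (∑ u', P1 u' * w u' v) +
      Fintype.card I' * Fintype.card J' * ∑ u', P1 u' * ∑ v', P2 v' * w u' v')) := by
  set Ψ : V1 → V1 → ℝ := fun u u' =>
    ∑ v, P2 v * (c u v * (w u' v + Fintype.card J' * ∑ v', P2 v' * w u' v')) with hΨ
  have hΨ0 : ∀ u u', 0 ≤ Ψ u u' := fun u u' => Finset.sum_nonneg fun v _ =>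
    mul_nonneg (hP2 v) (mul_nonneg (hc u v) (add_nonneg (hw _ _) (mul_nonneg (Nat.cast_nonneg _)
      (Finset.sum_nonneg fun v' _ => mul_nonneg (hP2 v') (hw _ _)))))
  have h1 : ∀ f : I → V1, codebookMean P2 (fun g : J → V2 =>
      c (f (e1 i)) (g (e2 j)) * ∑ i', ∑ j', w (f (e1 i')) (g (e2 j'))) ≤
      ∑ i', Ψ (f (e1 i)) (f (e1 i')) := by
    intro f
    have e : (fun g : J → V2 => c (f (e1 i)) (g (e2 j)) *
        ∑ i', ∑ j', w (f (e1 i')) (g (e2 j'))) = fun g => ∑ i', ∑ j',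
        (fun v v' => c (f (e1 i)) v * w (f (e1 i')) v') (g (e2 j)) (g (e2 j')) := by
      funext g
      simp_rw [Finset.mul_sum]
    rw [e, codebookMean_sum]
    refine Finset.sum_le_sum fun i' _ => ?_
    rw [codebookMean_sum]
    refine (sum_codebookMean_eval₂_le hP2 hP2' he2 j
      (F := fun v v' => c (f (e1 i)) v * w (f (e1 i')) v')
      fun v v' => mul_nonneg (hc _ _) (hw _ _)).trans (le_of_eq ?_)
    simp only [hΨ]
    rw [Finset.mul_sum, ← Finset.sum_add_distrib]
    refine Finset.sum_congr rfl fun v _ => ?_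
    rw [mul_add, mul_add]
    congr 1
    rw [Finset.mul_sum, Finset.mul_sum, Finset.mul_sum, Finset.mul_sum]
    exact Finset.sum_congr rfl fun v' _ => by ring
  refine (codebookMean_mono hP1 h1).trans ?_
  rw [codebookMean_sum]
  refine (sum_codebookMean_eval₂_le hP1 hP1' he1 i hΨ0).trans (le_of_eq ?_)
  rw [Finset.mul_sum, ← Finset.sum_add_distrib]
  refine Finset.sum_congr rfl fun u _ => ?_
  have h2 : ∑ u', P1 u * P1 u' * Ψ u u' = P1 u * ∑ v, P2 v * (c u v *
      ((∑ u', P1 u' * w u' v) + Fintype.card J' * ∑ u', P1 u' * ∑ v', P2 v' * w u' v')) := by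
    simp only [hΨ]
    have : ∀ u', P1 u * P1 u' * ∑ v, P2 v * (c u v * (w u' v + Fintype.card J' *
        ∑ v', P2 v' * w u' v')) = ∑ v, P1 u * (P2 v * (c u v * (P1 u' * w u' v +
        Fintype.card J' * (P1 u' * ∑ v', P2 v' * w u' v')))) := fun u' => by
      rw [Finset.mul_sum]
      exact Finset.sum_congr rfl fun v _ => by ring
    simp_rw [this]
    rw [Finset.sum_comm, Finset.mul_sum]
    refine Finset.sum_congr rfl fun v _ => ?_
    rw [← Finset.mul_sum, ← Finset.mul_sum, ← Finset.mul_sum, Finset.sum_add_distrib,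
      Finset.mul_sum _ _ (Fintype.card J' : ℝ)]
  rw [h2]
  simp only [hΨ]
  rw [mul_left_comm, ← mul_add]
  congr 1
  rw [Finset.mul_sum univ _ (Fintype.card I' : ℝ), ← Finset.sum_add_distrib]
  exact Finset.sum_congr rfl fun v _ => by ring

lemma codebookMean_nested_eval {P1 : V1 → ℝ} {P2 : V2 → ℝ}
    (hP1' : ∑ v, P1 v = 1) (hP2' : ∑ v, P2 v = 1) (i : I) (j : J) (F : V1 → V2 → ℝ) :
    codebookMean P1 (fun f : I → V1 => codebookMean P2 (fun g : J → V2 => F (f i) (g j))) =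
      ∑ u, P1 u * ∑ v, P2 v * F u v := by
  simp_rw [fun f : I → V1 => codebookMean_eval hP2' j (F (f i))]
  exact codebookMean_eval hP1' i fun u => ∑ v, P2 v * F u v

variable [Nonempty I'] [Nonempty J'] in
/-- Soft covering for a pair of independent random codebooks. -/
lemma codebookMean_l1_le₂ {P1 : V1 → ℝ} {P2 : V2 → ℝ} (hP1 : ∀ v, 0 ≤ P1 v)
    (hP1' : ∑ v, P1 v = 1) (hP2 : ∀ v, 0 ≤ P2 v) (hP2' : ∑ v, P2 v = 1)
    {w : V1 → V2 → Z → ℝ} (hw : ∀ u v z, 0 ≤ w u v z) (hw1 : ∀ u v, ∑ z, w u v z = 1)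
    {e1 : I' → I} (he1 : Function.Injective e1) {e2 : J' → J} (he2 : Function.Injective e2)
    {l s1 s2 s3 : ℝ} (hl : 0 < l) (hs1 : 0 < s1) (hs1' : s1 ≤ 1) (hs2 : 0 < s2) (hs2' : s2 ≤ 1)
    (hs3 : 0 < s3) (hs3' : s3 ≤ 1) :
    codebookMean P1 (fun f : I → V1 => codebookMean P2 (fun g : J → V2 =>
      ∑ z, |(𝔼 i, 𝔼 j, w (f (e1 i)) (g (e2 j)) z) - ∑ u, P1 u * ∑ v, P2 v * w u v z|)) ≤
    l + 1 / l * ((Fintype.card I' : ℝ) ^ (-s1) * tilted P1 (fun u z => ∑ v, P2 v * w u v z) s1 +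
      (Fintype.card J' : ℝ) ^ (-s2) * tilted P2 (fun v z => ∑ u, P1 u * w u v z) s2 +
      ((Fintype.card I' : ℝ) * Fintype.card J') ^ (-s3) *
        tilted (fun a : V1 × V2 => P1 a.1 * P2 a.2) (fun a z => w a.1 a.2 z) s3) := by
  set p : Z → ℝ := fun z => ∑ u, P1 u * ∑ v, P2 v * w u v z with hpdef
  set w1 : V1 → Z → ℝ := fun u z => ∑ v, P2 v * w u v z with hw1def
  set w2 : V2 → Z → ℝ := fun v z => ∑ u, P1 u * w u v z with hw2def
  set M1 : ℝ := (Fintype.card I' : ℝ) with hM1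
  set M2 : ℝ := (Fintype.card J' : ℝ) with hM2
  have hM1pos : 0 < M1 := by rw [hM1]; exact_mod_cast Fintype.card_pos
  have hM2pos : 0 < M2 := by rw [hM2]; exact_mod_cast Fintype.card_pos
  have hw10 : ∀ u z, 0 ≤ w1 u z := fun u z =>
    Finset.sum_nonneg fun v _ => mul_nonneg (hP2 v) (hw u v z)
  have hw20 : ∀ v z, 0 ≤ w2 v z := fun v z =>
    Finset.sum_nonneg fun u _ => mul_nonneg (hP1 u) (hw u v z)
  have hp : ∀ z, 0 ≤ p z := fun z => Finset.sum_nonneg fun v _ => mul_nonneg (hP1 v) (hw10 v z)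
  have hp2 : ∀ z, ∑ v, P2 v * w2 v z = p z := fun z => by
    simp only [hpdef, hw2def, Finset.mul_sum]
    rw [Finset.sum_comm]
    exact Finset.sum_congr rfl fun u _ => Finset.sum_congr rfl fun v _ => by ring
  have hp1 : ∑ z, p z = 1 := by
    simp only [hpdef]
    rw [Finset.sum_comm]
    simp_rw [← Finset.mul_sum]
    have : ∀ u, ∑ z, ∑ v, P2 v * w u v z = 1 := fun u => by
      rw [Finset.sum_comm]; simp_rw [← Finset.mul_sum, hw1, mul_one, hP2']
    simp_rw [this, mul_one, hP1']
  set T : V1 → V2 → Z → ℝ := fun u v z => w1 u z / M1 + w2 v z / M2 + w u v z / (M1 * M2) with hT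
  have hT0 : ∀ u v z, 0 ≤ T u v z := fun u v z => by
    have := hw10 u z; have := hw20 v z; have := hw u v z
    simp only [hT]; positivity
  set H : V1 → V2 → Z → ℝ := fun u v z => 2 * p z + T u v z with hH
  have key := expected_l1_le (A := I' × J') (Ω := (I → V1) × (J → V2))
    (μ := fun ω => (∏ i, P1 (ω.1 i)) * ∏ j, P2 (ω.2 j))
    (fun ω => mul_nonneg (Finset.prod_nonneg fun _ _ => hP1 _)
      (Finset.prod_nonneg fun _ _ => hP2 _))
    (by
      have := sum_prod_weights (I := I) (J := J) P1 P2 (fun _ _ => 1)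
      simp only [codebookMean_const hP2', codebookMean_const hP1', mul_one] at this
      exact this)
    (w := fun a ω z => w (ω.1 (e1 a.1)) (ω.2 (e2 a.2)) z) (fun _ _ _ => hw _ _ _)
    (fun _ _ => hw1 _ _) hp hp1
    (fun a ω z => H (ω.1 (e1 a.1)) (ω.2 (e2 a.2)) z) ?_ hl
  · have hE : ∀ ω : (I → V1) × (J → V2), ∀ z,
        (𝔼 a : I' × J', w (ω.1 (e1 a.1)) (ω.2 (e2 a.2)) z) =
        𝔼 i, 𝔼 j, w (ω.1 (e1 i)) (ω.2 (e2 j)) z := fun ω z =>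
      Finset.expect_product' Finset.univ Finset.univ
        fun i j => w (ω.1 (e1 i)) (ω.2 (e2 j)) z
    simp_rw [hE] at key
    rw [sum_prod_weights P1 P2 (fun f g =>
      ∑ z, |(𝔼 i, 𝔼 j, w (f (e1 i)) (g (e2 j)) z) - p z|)] at key
    refine key.trans ?_
    have h1 : ∀ a : I' × J', ∑ ω : (I → V1) × (J → V2), ((∏ i, P1 (ω.1 i)) * ∏ j, P2 (ω.2 j)) *
        ∑ z, w (ω.1 (e1 a.1)) (ω.2 (e2 a.2)) z * (1 - 2 *
        (p z / H (ω.1 (e1 a.1)) (ω.2 (e2 a.2)) z)) ≤ M1 ^ (-s1) * tilted P1 w1 s1 +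
        M2 ^ (-s2) * tilted P2 w2 s2 + (M1 * M2) ^ (-s3) *
        tilted (fun a : V1 × V2 => P1 a.1 * P2 a.2) (fun a z => w a.1 a.2 z) s3 := by
      intro a
      rw [sum_prod_weights P1 P2 (fun f g => ∑ z, w (f (e1 a.1)) (g (e2 a.2)) z * (1 - 2 *
        (p z / H (f (e1 a.1)) (g (e2 a.2)) z))), codebookMean_nested_eval hP1' hP2' (e1 a.1)
        (e2 a.2) (fun u v => ∑ z, w u v z * (1 - 2 * (p z / H u v z)))]
      have hb : ∀ u v, P1 u * (P2 v * ∑ z, w u v z * (1 - 2 * (p z / H u v z))) ≤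
          P1 u * (P2 v * ∑ z, w u v z * (M1 ^ (-s1) * (w1 u z / p z) ^ s1 +
            M2 ^ (-s2) * (w2 v z / p z) ^ s2 + (M1 * M2) ^ (-s3) * (w u v z / p z) ^ s3)) := by
        intro u v
        rcases eq_or_lt_of_le (hP1 u) with h0 | h0
        · simp [← h0]
        rcases eq_or_lt_of_le (hP2 v) with h0' | h0'
        · simp [← h0']
        refine mul_le_mul_of_nonneg_left (mul_le_mul_of_nonneg_left
          (Finset.sum_le_sum fun z _ => ?_) h0'.le) h0.le
        rcases eq_or_ne (w u v z) 0 with hz | hz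
        · simp [hz]
        refine mul_le_mul_of_nonneg_left ?_ (hw u v z)
        have hpz : 0 < p z := by
          have h3 : P2 v * w u v z ≤ w1 u z := Finset.single_le_sum
            (f := fun v => P2 v * w u v z) (fun v _ => mul_nonneg (hP2 v) (hw u v z))
            (Finset.mem_univ v)
          have h4 : P1 u * w1 u z ≤ p z := Finset.single_le_sum
            (f := fun u => P1 u * w1 u z) (fun u _ => mul_nonneg (hP1 u) (hw10 u z))
            (Finset.mem_univ u)
          have h5 : 0 < P2 v * w u v z := mul_pos h0' (lt_of_le_of_ne (hw u v z) hz.symm)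
          exact (mul_pos h0 (h5.trans_le h3)).trans_le h4
        have hHpos : 0 < H u v z := add_pos_of_pos_of_nonneg (by linarith) (hT0 u v z)
        have h3 : H u v z = 2 * p z + T u v z := rfl
        have e1 : 1 - 2 * (p z / H u v z) = T u v z / H u v z := by
          rw [eq_div_iff hHpos.ne', sub_mul, mul_assoc, div_mul_cancel₀ _ hHpos.ne', h3]
          ring
        have e2 : T u v z / H u v z = w1 u z / M1 / H u v z + w2 v z / M2 / H u v z +
            w u v z / (M1 * M2) / H u v z := by
          simp only [hT]; ring
        have b : ∀ {M x s : ℝ}, 0 < M → 0 ≤ x → 0 < s → s ≤ 1 → x / M ≤ T u v z →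
            x / M / H u v z ≤ M ^ (-s) * (x / p z) ^ s := by
          intro M x s hM hx hs hs' hxT
          refine (div_add_le_rpow (div_nonneg hx hM.le) hpz hxT hs hs').trans_eq ?_
          rw [show x / M / p z = M⁻¹ * (x / p z) by field_simp,
              Real.mul_rpow (inv_nonneg.2 hM.le) (div_nonneg hx (hp z)),
              Real.inv_rpow hM.le, ← Real.rpow_neg hM.le]
        have n1 : 0 ≤ w1 u z / M1 := div_nonneg (hw10 _ _) hM1pos.le
        have n2 : 0 ≤ w2 v z / M2 := div_nonneg (hw20 _ _) hM2pos.le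
        have n3 : 0 ≤ w u v z / (M1 * M2) := div_nonneg (hw _ _ _) (by positivity)
        rw [e1, e2]
        refine add_le_add (add_le_add (b hM1pos (hw10 _ _) hs1 hs1' ?_)
          (b hM2pos (hw20 _ _) hs2 hs2' ?_)) (b (mul_pos hM1pos hM2pos) (hw _ _ _) hs3 hs3' ?_)
        all_goals simp only [hT]; linarith
      calc _ = ∑ u, ∑ v, P1 u * (P2 v * ∑ z, w u v z * (1 - 2 * (p z / H u v z))) := by
            simp_rw [Finset.mul_sum]
        _ ≤ ∑ u, ∑ v, P1 u * (P2 v * ∑ z, w u v z * (M1 ^ (-s1) * (w1 u z / p z) ^ s1 +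
            M2 ^ (-s2) * (w2 v z / p z) ^ s2 + (M1 * M2) ^ (-s3) * (w u v z / p z) ^ s3)) :=
            Finset.sum_le_sum fun u _ => Finset.sum_le_sum fun v _ => hb u v
        _ = (∑ u, ∑ v, ∑ z, P1 u * (P2 v * (w u v z * (M1 ^ (-s1) * (w1 u z / p z) ^ s1)))) +
            (∑ u, ∑ v, ∑ z, P1 u * (P2 v * (w u v z * (M2 ^ (-s2) * (w2 v z / p z) ^ s2)))) +
            ∑ u, ∑ v, ∑ z, P1 u * (P2 v * (w u v z *
              ((M1 * M2) ^ (-s3) * (w u v z / p z) ^ s3))) := by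
            simp_rw [← Finset.sum_add_distrib, Finset.mul_sum]
            refine Finset.sum_congr rfl fun u _ => Finset.sum_congr rfl fun v _ =>
              Finset.sum_congr rfl fun z _ => by ring
        _ = _ := by
            congr 1
            · congr 1
              · unfold tilted
                rw [Finset.mul_sum]
                refine Finset.sum_congr rfl fun u _ => ?_
                rw [Finset.sum_comm, Finset.mul_sum, Finset.mul_sum]
                refine Finset.sum_congr rfl fun z _ => ?_
                change _ = M1 ^ (-s1) * (P1 u * ((∑ v, P2 v * w u v z) * (w1 u z / p z) ^ s1))
                rw [Finset.sum_mul, Finset.mul_sum, Finset.mul_sum]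
                exact Finset.sum_congr rfl fun v _ => by ring
              · unfold tilted
                rw [Finset.mul_sum, Finset.sum_comm]
                refine Finset.sum_congr rfl fun v _ => ?_
                rw [Finset.sum_comm, Finset.mul_sum, Finset.mul_sum]
                refine Finset.sum_congr rfl fun z _ => ?_
                rw [hp2]
                change _ = M2 ^ (-s2) * (P2 v * ((∑ u, P1 u * w u v z) * (w2 v z / p z) ^ s2))
                rw [Finset.sum_mul, Finset.mul_sum, Finset.mul_sum]
                exact Finset.sum_congr rfl fun u _ => by ring
            · unfold tilted
              have hp3 : ∀ z, ∑ a : V1 × V2, P1 a.1 * P2 a.2 * w a.1 a.2 z = p z := fun z => by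
                rw [Fintype.sum_prod_type]
                simp only [hpdef, Finset.mul_sum, mul_assoc]
              simp_rw [hp3]
              rw [Fintype.sum_prod_type]
              simp_rw [Finset.mul_sum]
              refine Finset.sum_congr rfl fun u _ => Finset.sum_congr rfl fun v _ =>
                Finset.sum_congr rfl fun z _ => by ring
    have h2 := (Finset.expect_le_expect (s := Finset.univ) fun a _ => h1 a).trans_eq
      (Fintype.expect_const _)
    gcongr
  · intro a z
    set c : V1 → V2 → ℝ := fun u v => w u v z * p z / H u v z ^ 2 with hc
    have hc0 : ∀ u v, 0 ≤ c u v := fun u v => by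
      have := hw u v z; have := hp z
      simp only [hc]; positivity
    have hq : ∀ ω : (I → V1) × (J → V2),
        w (ω.1 (e1 a.1)) (ω.2 (e2 a.2)) z * p z / H (ω.1 (e1 a.1)) (ω.2 (e2 a.2)) z ^ 2 *
        ((𝔼 b : I' × J', w (ω.1 (e1 b.1)) (ω.2 (e2 b.2)) z) + p z) =
        (fun f g => (M1 * M2)⁻¹ * (c (f (e1 a.1)) (g (e2 a.2)) *
          ∑ i', ∑ j', w (f (e1 i')) (g (e2 j')) z) + c (f (e1 a.1)) (g (e2 a.2)) * p z)
          ω.1 ω.2 := by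
      intro ω
      rw [Fintype.expect_eq_sum_div_card, Fintype.sum_prod_type, Fintype.card_prod]
      push_cast
      simp only [hc, ← hM1, ← hM2]
      ring
    simp_rw [hq]
    rw [sum_prod_weights P1 P2 (fun f g => (M1 * M2)⁻¹ * (c (f (e1 a.1)) (g (e2 a.2)) *
          ∑ i', ∑ j', w (f (e1 i')) (g (e2 j')) z) + c (f (e1 a.1)) (g (e2 a.2)) * p z),
      sum_prod_weights P1 P2 (fun f g => w (f (e1 a.1)) (g (e2 a.2)) z * p z /
        H (f (e1 a.1)) (g (e2 a.2)) z), codebookMean_nested_eval hP1' hP2' (e1 a.1)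
        (e2 a.2) (fun u v => w u v z * p z / H u v z)]
    simp_rw [codebookMean_add, codebookMean_mul]
    rw [codebookMean_nested_eval hP1' hP2' (e1 a.1) (e2 a.2) (fun u v => c u v * p z)]
    have h1 := codebookMean_pair_le hP1 hP1' hP2 hP2' hc0 (fun u v => hw u v z) he1 he2 a.1 a.2
    refine (add_le_add_left (mul_le_mul_of_nonneg_left h1 (by positivity)) _).trans (le_of_eq ?_)
    rw [Finset.mul_sum, ← Finset.sum_add_distrib]
    refine Finset.sum_congr rfl fun u _ => ?_
    rw [mul_left_comm, ← mul_add]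
    congr 1
    rw [Finset.mul_sum, ← Finset.sum_add_distrib]
    refine Finset.sum_congr rfl fun v _ => ?_
    rw [mul_left_comm, ← mul_add]
    congr 1
    have e5 : w u v z * p z / H u v z = c u v * H u v z := by
      rcases eq_or_ne (H u v z) 0 with h0 | h0
      · simp [h0]
      · simp only [hc]; field_simp
    rw [e5]
    change (M1 * M2)⁻¹ * (c u v * (w u v z + M2 * w1 u z + M1 * w2 v z + M1 * M2 * p z)) +
      c u v * p z = c u v * (2 * p z + (w1 u z / M1 + w2 v z / M2 + w u v z / (M1 * M2)))
    field_simp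
    ring

end MacCovering

section Decoding

variable {I V D : Type*} [Fintype I] [DecidableEq I] [Nonempty I] [Fintype V] [Fintype D]

/-- The maximum likelihood decoder of the codebook `f` for the channel `U`. -/
def mlDecoder (U : V → D → ℝ) (f : I → V) (d : D) : I :=
  Classical.choose (Finite.exists_max fun i => U (f i) d)

omit [DecidableEq I] [Fintype V] [Fintype D] in
lemma le_mlDecoder (U : V → D → ℝ) (f : I → V) (d : D) (i : I) :
    U (f i) d ≤ U (f (mlDecoder U f d)) d :=
  Classical.choose_spec (Finite.exists_max fun i => U (f i) d) i

lemma min_le_rpow {x y s : ℝ} (hx : 0 ≤ x) (hy : 0 ≤ y) (hs : 0 < s) (hs1 : s ≤ 1) :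
    min x y ≤ x * (y / x) ^ s := by
  rcases eq_or_lt_of_le hx with rfl | hx
  · simp
  · rcases le_total 1 (y / x) with h | h
    · exact (min_le_left _ _).trans (le_mul_of_one_le_right hx.le (Real.one_le_rpow h hs.le))
    · rcases eq_or_lt_of_le hy with rfl | hy
      · rw [min_eq_right hx.le]
        exact mul_nonneg hx.le (Real.rpow_nonneg (by simp) _)
      · refine (min_le_right _ _).trans ?_
        calc y = x * (y / x) := by field_simp
          _ = x * (y / x) ^ (1 : ℝ) := by rw [Real.rpow_one]
          _ ≤ _ := mul_le_mul_of_nonneg_left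
            (Real.rpow_le_rpow_of_exponent_ge (by positivity) h hs1) hx.le

/-- Random coding bound on the error probability of maximum likelihood decoding. -/
lemma codebookMean_decoding_le {P : V → ℝ} (hP : ∀ v, 0 ≤ P v) (hP1 : ∑ v, P v = 1)
    {U : V → D → ℝ} (hU : ∀ v d, 0 ≤ U v d) {s : ℝ} (hs : 0 < s) (hs1 : s ≤ 1) :
    codebookMean P (fun f : I → V => 𝔼 i, ∑ d, U (f i) d *
      (if mlDecoder U f d ≠ i then 1 else 0)) ≤
      ((Fintype.card I : ℝ) - 1) ^ s * tilted P U (-s) := by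
  classical
  set M : ℝ := (Fintype.card I : ℝ) - 1 with hM
  have hM0 : 0 ≤ M := by
    have : 1 ≤ Fintype.card I := Fintype.card_pos
    have : (1 : ℝ) ≤ Fintype.card I := by exact_mod_cast this
    rw [hM]; linarith
  set q : D → ℝ := fun d => ∑ v, P v * U v d with hq
  have hq0 : ∀ d, 0 ≤ q d := fun d => Finset.sum_nonneg fun v _ => mul_nonneg (hP v) (hU v d)
  set G0 : V → ℝ := fun v => ∑ d, if U v d ≤ M * q d then U v d else 0 with hG0
  set G1 : V → V → ℝ := fun v v' => ∑ d, if U v d ≤ M * q d then 0 else U v' d with hG1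
  have h1 : ∀ (i : I) (f : I → V), ∑ d, U (f i) d * (if mlDecoder U f d ≠ i then 1 else 0) ≤
      G0 (f i) + ∑ i' ∈ Finset.univ.erase i, G1 (f i) (f i') := by
    intro i f
    simp only [hG0, hG1]
    rw [Finset.sum_comm, ← Finset.sum_add_distrib]
    refine Finset.sum_le_sum fun d _ => ?_
    by_cases hk : U (f i) d ≤ M * q d
    · simp only [hk, if_true, Finset.sum_const_zero, add_zero]
      split_ifs <;> simp [hU]
    · simp only [hk, if_false, zero_add]
      split_ifs with h
      · rw [mul_one]
        exact (le_mlDecoder U f d i).trans (Finset.single_le_sum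
          (f := fun i' => U (f i') d) (fun i' _ => hU _ _)
          (Finset.mem_erase.2 ⟨h, Finset.mem_univ _⟩))
      · rw [mul_zero]
        exact Finset.sum_nonneg fun i' _ => hU _ _
  have h2 : ∀ i : I, codebookMean P (fun f : I → V => ∑ d, U (f i) d *
      (if mlDecoder U f d ≠ i then 1 else 0)) ≤ M ^ s * tilted P U (-s) := by
    intro i
    refine (codebookMean_mono hP (h1 i)).trans ?_
    rw [codebookMean_add, codebookMean_eval hP1 i G0, codebookMean_sum,
      sum_erase_codebookMean_eval₂ hP1 i G1, ← hM, Finset.mul_sum, ← Finset.sum_add_distrib]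
    unfold tilted
    rw [Finset.mul_sum]
    refine Finset.sum_le_sum fun v _ => ?_
    rcases eq_or_lt_of_le (hP v) with h0 | h0
    · simp [← h0]
    have e1 : M * ∑ v', P v * P v' * G1 v v' =
        P v * ∑ d, if U v d ≤ M * q d then 0 else M * q d := by
      simp only [hG1]
      simp_rw [Finset.mul_sum]
      rw [Finset.sum_comm]
      refine Finset.sum_congr rfl fun d _ => ?_
      split_ifs
      · simp
      · simp only [hq, Finset.mul_sum]
        exact Finset.sum_congr rfl fun v' _ => by ring
    rw [e1, ← mul_add, mul_left_comm]
    refine mul_le_mul_of_nonneg_left ?_ h0.le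
    simp only [hG0]
    rw [← Finset.sum_add_distrib, Finset.mul_sum]
    refine Finset.sum_le_sum fun d _ => ?_
    have e2 : ((if U v d ≤ M * q d then U v d else 0) + if U v d ≤ M * q d then 0 else M * q d) =
        min (U v d) (M * q d) := by
      split_ifs with h
      · rw [min_eq_left h, add_zero]
      · rw [min_eq_right (not_le.1 h).le, zero_add]
    rw [e2]
    refine (min_le_rpow (hU v d) (mul_nonneg hM0 (hq0 d)) hs hs1).trans (le_of_eq ?_)
    rw [mul_div_assoc, Real.mul_rpow hM0 (div_nonneg (hq0 d) (hU v d)),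
      Real.rpow_neg (div_nonneg (hU v d) (hq0 d)),
      ← Real.inv_rpow (div_nonneg (hU v d) (hq0 d)), inv_div]
    ring
  have h3 : codebookMean P (fun f : I → V => 𝔼 i, ∑ d, U (f i) d *
      (if mlDecoder U f d ≠ i then 1 else 0)) = 𝔼 i, codebookMean P (fun f : I → V =>
      ∑ d, U (f i) d * (if mlDecoder U f d ≠ i then 1 else 0)) := by
    simp_rw [Fintype.expect_eq_sum_div_card, div_eq_inv_mul]
    rw [codebookMean_mul, codebookMean_sum]
  rw [h3]
  exact (Finset.expect_le_expect fun i _ => h2 i).trans_eq (Fintype.expect_const _)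

end Decoding

section OneShot

variable {S1 C R1 S2 K R2 H1 H2 : Type*}
  [Fintype S1] [Fintype C] [Fintype R1] [Fintype S2] [Fintype K] [Fintype R2]
  [Fintype H1] [Fintype H2]

open scoped Classical in
/-- A code law `p`, giving for each fresh message `s1` and shared key `c` of user 1 and each
message `s2` of user 2 the joint law of the observations of the two users and the eavesdropper,
is `ε`-good if both users recover the other's message and agree on a new key in `K`, while the
eavesdropper learns almost nothing about `s1` and the new key, and almost nothing about `s2`. -/
def IsGood (K : Type*) [Fintype K] (p : S1 → C → S2 → H1 → H2 → Z → ℝ) (ε : ℝ) : Prop :=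
  (∀ s1 c s2 h1 h2 z, 0 ≤ p s1 c s2 h1 h2 z) ∧
  (∀ s1 c s2, ∑ h1, ∑ h2, ∑ z, p s1 c s2 h1 h2 z = 1) ∧
  ∃ (g1 : H1 → K) (g2 : H2 → K) (d1 : H1 → S2) (d2 : H2 → S1 × C) (Q : Z → ℝ),
    (∀ z, 0 ≤ Q z) ∧ ∑ z, Q z = 1 ∧
    (𝔼 s1, 𝔼 c, 𝔼 s2, ∑ h1, ∑ h2, ∑ z, p s1 c s2 h1 h2 z *
      (if g1 h1 = g2 h2 ∧ d1 h1 = s2 ∧ d2 h2 = (s1, c) then 0 else 1) ≤ ε) ∧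
    (𝔼 s1, ∑ z, ∑ k, |(𝔼 c, 𝔼 s2, ∑ h1, ∑ h2, p s1 c s2 h1 h2 z *
      (if g1 h1 = k then 1 else 0)) - Q z / Fintype.card K| ≤ ε) ∧
    (𝔼 s2, ∑ z, |(𝔼 s1, 𝔼 c, ∑ h1, ∑ h2, p s1 c s2 h1 h2 z) - Q z| ≤ ε)

lemma expect_prod₃ {A B D : Type*} [Fintype A] [Fintype B] [Fintype D] (F : A × B × D → ℝ) :
    𝔼 x, F x = 𝔼 a, 𝔼 b, 𝔼 d, F (a, b, d) := by
  rw [← Finset.univ_product_univ, Finset.expect_product]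
  refine Finset.expect_congr rfl fun a _ => ?_
  rw [← Finset.univ_product_univ, Finset.expect_product]

open scoped Classical in
lemma expect_mul_boole (F : K → ℝ) (k : K) :
    𝔼 k', F k' * (if k' = k then 1 else 0) = F k / Fintype.card K := by
  rw [Fintype.expect_eq_sum_div_card]
  simp

/-- The code law obtained from a pair of codebooks by randomising over `R1`, `K` and `R2`. -/
def mixtureLaw (T : V1 → V2 → H1 → H2 → Z → ℝ) (f : S1 × C × R1 → V1) (g : S2 × K × R2 → V2)
    (s1 : S1) (c : C) (s2 : S2) (h1 : H1) (h2 : H2) (z : Z) : ℝ :=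
  𝔼 r1, 𝔼 k, 𝔼 r2, T (f (s1, c, r1)) (g (s2, k, r2)) h1 h2 z

omit [Fintype V1] [Fintype V2] in
lemma mixtureLaw_expect (T : V1 → V2 → H1 → H2 → Z → ℝ) (f : S1 × C × R1 → V1)
    (g : S2 × K × R2 → V2) (F : S1 → C → S2 → H1 → H2 → Z → ℝ) :
    𝔼 s1, 𝔼 c, 𝔼 s2, ∑ h1, ∑ h2, ∑ z, mixtureLaw T f g s1 c s2 h1 h2 z * F s1 c s2 h1 h2 z =
    𝔼 i, 𝔼 j, ∑ h1, ∑ h2, ∑ z, T (f i) (g j) h1 h2 z * F i.1 i.2.1 j.1 h1 h2 z := by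
  unfold mixtureLaw
  simp_rw [Finset.expect_mul, ← Finset.expect_sum_comm, expect_prod₃]
  refine Finset.expect_congr rfl fun s1 _ => Finset.expect_congr rfl fun c _ => ?_
  exact Finset.expect_comm ..

variable [Nonempty R1] [Nonempty S2] [Nonempty K] [Nonempty R2]

omit [Fintype V1] [Fintype V2] in
set_option maxHeartbeats 400000 in
open scoped Classical in
/-- A pair of codebooks with small error probabilities and small leakage yields a good code. -/
lemma isGood_mixtureLaw {A : V2 → H2 → ℝ} {B : V1 → H1 → H2 → Z → ℝ}
    (hA : ∀ v h, 0 ≤ A v h) (hB : ∀ v h1 h2 z, 0 ≤ B v h1 h2 z)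
    {T : V1 → V2 → H1 → H2 → Z → ℝ} (hT : ∀ u v h1 h2 z, T u v h1 h2 z = A v h2 * B u h1 h2 z)
    (hT1 : ∀ u v, ∑ h1, ∑ h2, ∑ z, T u v h1 h2 z = 1)
    (f : S1 × C × R1 → V1) (g : S2 × K × R2 → V2)
    (dec2 : H2 → S1 × C × R1) (dec1 : H1 → S2 × K × R2) {Q : Z → ℝ} (hQ : ∀ z, 0 ≤ Q z)
    (hQ1 : ∑ z, Q z = 1) {w : V1 → V2 → Z → ℝ}
    (hw : ∀ u v z, w u v z = ∑ h1, ∑ h2, T u v h1 h2 z) {ε : ℝ}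
    (hε : 2 * (𝔼 i, 𝔼 j, ∑ h1, ∑ h2, ∑ z, T (f i) (g j) h1 h2 z *
        (if dec1 h1 ≠ j then 1 else 0)) +
      (𝔼 i, 𝔼 j, ∑ h1, ∑ h2, ∑ z, T (f i) (g j) h1 h2 z * (if dec2 h2 ≠ i then 1 else 0)) +
      (𝔼 s1, 𝔼 k, ∑ z, |(𝔼 c, 𝔼 r1, 𝔼 s2, 𝔼 r2, w (f (s1, c, r1)) (g (s2, k, r2)) z) - Q z|) +
      (𝔼 s2, ∑ z, |(𝔼 i, 𝔼 k, 𝔼 r2, w (f i) (g (s2, k, r2)) z) - Q z|) ≤ ε) :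
    IsGood K (mixtureLaw T f g) ε := by
  have hT0 : ∀ u v h1 h2 z, 0 ≤ T u v h1 h2 z := fun u v h1 h2 z => by
    rw [hT]; exact mul_nonneg (hA _ _) (hB _ _ _ _)
  set E1 := 𝔼 i, 𝔼 j, ∑ h1, ∑ h2, ∑ z, T (f i) (g j) h1 h2 z *
        (if dec1 h1 ≠ j then (1 : ℝ) else 0) with hE1
  set E2 := 𝔼 i, 𝔼 j, ∑ h1, ∑ h2, ∑ z, T (f i) (g j) h1 h2 z *
        (if dec2 h2 ≠ i then (1 : ℝ) else 0) with hE2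
  set Lk1 := 𝔼 s1, 𝔼 k, ∑ z,
    |(𝔼 c, 𝔼 r1, 𝔼 s2, 𝔼 r2, w (f (s1, c, r1)) (g (s2, k, r2)) z) - Q z| with hLk1
  set Lk2 := 𝔼 s2, ∑ z, |(𝔼 i, 𝔼 k, 𝔼 r2, w (f i) (g (s2, k, r2)) z) - Q z| with hLk2
  have ind0 : ∀ (q : Prop) [Decidable q], (0 : ℝ) ≤ if q then 1 else 0 := fun q _ => by split_ifs <;> simp
  have hE10 : 0 ≤ E1 := Finset.expect_nonneg fun i _ => Finset.expect_nonneg fun j _ =>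
    Finset.sum_nonneg fun _ _ => Finset.sum_nonneg fun _ _ => Finset.sum_nonneg fun _ _ =>
    mul_nonneg (hT0 _ _ _ _ _) (ind0 _)
  have hE20 : 0 ≤ E2 := Finset.expect_nonneg fun i _ => Finset.expect_nonneg fun j _ =>
    Finset.sum_nonneg fun _ _ => Finset.sum_nonneg fun _ _ => Finset.sum_nonneg fun _ _ =>
    mul_nonneg (hT0 _ _ _ _ _) (ind0 _)
  have hLk10 : 0 ≤ Lk1 := Finset.expect_nonneg fun i _ => Finset.expect_nonneg fun j _ =>
    Finset.sum_nonneg fun _ _ => abs_nonneg _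
  have hLk20 : 0 ≤ Lk2 := Finset.expect_nonneg fun i _ =>
    Finset.sum_nonneg fun _ _ => abs_nonneg _
  set b : H1 → H2 → ℝ := fun h1 h2 => 𝔼 i, ∑ z, B (f i) h1 h2 z with hb
  choose G hG using fun h2 : H2 => Finite.exists_min (α := S2 × K × R2)
    fun j => ∑ h1, b h1 h2 * (if dec1 h1 ≠ j then (1 : ℝ) else 0)
  have hGerr : 𝔼 i, 𝔼 j, ∑ h1, ∑ h2, ∑ z, T (f i) (g j) h1 h2 z *
      (if dec1 h1 ≠ G h2 then (1 : ℝ) else 0) ≤ E1 := by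
    have e : ∀ F : S2 × K × R2 → H1 → H2 → ℝ,
        𝔼 i, 𝔼 j, ∑ h1, ∑ h2, ∑ z, T (f i) (g j) h1 h2 z * F j h1 h2 =
        𝔼 j, ∑ h2, A (g j) h2 * ∑ h1, b h1 h2 * F j h1 h2 := by
      intro F
      rw [Finset.expect_comm]
      refine Finset.expect_congr rfl fun j _ => ?_
      simp only [hb, hT]
      simp_rw [Finset.expect_mul, ← Finset.expect_sum_comm, Finset.mul_expect,
        ← Finset.expect_sum_comm, Finset.sum_mul, Finset.mul_sum]
      refine Finset.expect_congr rfl fun i _ => ?_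
      rw [Finset.sum_comm]
      simp_rw [mul_assoc]
    rw [hE1, e (fun _ h1 h2 => if dec1 h1 ≠ G h2 then (1 : ℝ) else 0),
      e (fun j h1 _ => if dec1 h1 ≠ j then (1 : ℝ) else 0)]
    exact Finset.expect_le_expect fun j _ => Finset.sum_le_sum fun h2 _ =>
      mul_le_mul_of_nonneg_left (hG h2 j) (hA _ _)
  refine ⟨fun s1 c s2 h1 h2 z => Finset.expect_nonneg fun _ _ => Finset.expect_nonneg
    fun _ _ => Finset.expect_nonneg fun _ _ => hT0 _ _ _ _ _, fun s1 c s2 => ?_,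
    fun h1 => (dec1 h1).2.1, fun h2 => (G h2).2.1, fun h1 => (dec1 h1).1,
    fun h2 => ((dec2 h2).1, (dec2 h2).2.1), Q, hQ, hQ1, ?_, ?_, ?_⟩
  · unfold mixtureLaw
    simp_rw [← Finset.expect_sum_comm, hT1, Fintype.expect_const]
  · refine (mixtureLaw_expect T f g (fun s1 c s2 h1 h2 z =>
      (if (dec1 h1).2.1 = (G h2).2.1 ∧ (dec1 h1).1 = s2 ∧
        ((dec2 h2).1, (dec2 h2).2.1) = (s1, c) then 0 else 1))).trans_le ?_
    have h1 : 𝔼 i, 𝔼 j, ∑ h1, ∑ h2, ∑ z, T (f i) (g j) h1 h2 z *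
        (if (dec1 h1).2.1 = (G h2).2.1 ∧ (dec1 h1).1 = j.1 ∧
        ((dec2 h2).1, (dec2 h2).2.1) = (i.1, i.2.1) then (0 : ℝ) else 1) ≤
        (𝔼 i, 𝔼 j, ∑ h1, ∑ h2, ∑ z, T (f i) (g j) h1 h2 z *
          (if dec1 h1 ≠ G h2 then (1 : ℝ) else 0)) + E1 + E2 := by
      simp only [hE1, hE2, ← Finset.expect_add_distrib, ← Finset.sum_add_distrib, ← mul_add]
      refine Finset.expect_le_expect fun i _ => Finset.expect_le_expect fun j _ =>
        Finset.sum_le_sum fun h1 _ => Finset.sum_le_sum fun h2 _ =>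
        Finset.sum_le_sum fun z _ => mul_le_mul_of_nonneg_left ?_ (hT0 _ _ _ _ _)
      by_cases c1 : dec1 h1 = G h2
      · by_cases c2 : dec1 h1 = j
        · by_cases c3 : dec2 h2 = i
          · subst c3; rw [← c1, ← c2]; simp
          · have := ind0 (dec1 h1 ≠ G h2)
            have := ind0 (dec1 h1 ≠ j)
            rw [if_pos (show dec2 h2 ≠ i from c3)]
            split_ifs <;> linarith
        · rw [if_pos (show dec1 h1 ≠ j from c2)]
          have := ind0 (dec1 h1 ≠ G h2)
          have := ind0 (dec2 h2 ≠ i)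
          split_ifs <;> linarith
      · rw [if_pos (show dec1 h1 ≠ G h2 from c1)]
        have := ind0 (dec1 h1 ≠ j)
        have := ind0 (dec2 h2 ≠ i)
        split_ifs <;> linarith
    linarith
  · have h1 : ∀ s1, ∑ z, ∑ k, |(𝔼 c, 𝔼 s2, ∑ h1, ∑ h2, mixtureLaw T f g s1 c s2 h1 h2 z *
        (if (dec1 h1).2.1 = k then 1 else 0)) - Q z / Fintype.card K| ≤
        (𝔼 k, ∑ z, |(𝔼 c, 𝔼 r1, 𝔼 s2, 𝔼 r2, w (f (s1, c, r1)) (g (s2, k, r2)) z) - Q z|) +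
        2 * 𝔼 c, 𝔼 r1, 𝔼 j, ∑ h1, ∑ h2, ∑ z, T (f (s1, c, r1)) (g j) h1 h2 z *
          (if dec1 h1 ≠ j then 1 else 0) := by
      intro s1
      have e1 : ∀ z k, 𝔼 c, 𝔼 s2, ∑ h1, ∑ h2, mixtureLaw T f g s1 c s2 h1 h2 z *
          (if (dec1 h1).2.1 = k then 1 else 0) = 𝔼 c, 𝔼 r1, 𝔼 j, ∑ h1, ∑ h2,
          T (f (s1, c, r1)) (g j) h1 h2 z * (if (dec1 h1).2.1 = k then 1 else 0) := by
        intro z k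
        unfold mixtureLaw
        simp_rw [Finset.expect_mul, ← Finset.expect_sum_comm, expect_prod₃]
        refine Finset.expect_congr rfl fun c _ => ?_
        exact Finset.expect_comm ..
      have e2 : ∀ z k, (𝔼 c, 𝔼 r1, 𝔼 s2, 𝔼 r2, w (f (s1, c, r1)) (g (s2, k, r2)) z) /
          Fintype.card K = 𝔼 c, 𝔼 r1, 𝔼 j : S2 × K × R2, ∑ h1, ∑ h2,
          T (f (s1, c, r1)) (g j) h1 h2 z * (if j.2.1 = k then 1 else 0) := by
        intro z k
        rw [Finset.expect_div]
        refine Finset.expect_congr rfl fun c _ => ?_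
        rw [Finset.expect_div]
        refine Finset.expect_congr rfl fun r1 _ => ?_
        rw [Finset.expect_div, expect_prod₃]
        refine Finset.expect_congr rfl fun s2 _ => ?_
        rw [← expect_mul_boole (fun k => 𝔼 r2, w (f (s1, c, r1)) (g (s2, k, r2)) z)]
        refine Finset.expect_congr rfl fun k' _ => ?_
        rw [Finset.expect_mul]
        refine Finset.expect_congr rfl fun r2 _ => ?_
        rw [hw, Finset.sum_mul]
        refine Finset.sum_congr rfl fun h1 _ => ?_
        rw [Finset.sum_mul]
      have e3 : (𝔼 k, ∑ z, |(𝔼 c, 𝔼 r1, 𝔼 s2, 𝔼 r2, w (f (s1, c, r1)) (g (s2, k, r2)) z) - Q z|)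
          = ∑ z, ∑ k, |(𝔼 c, 𝔼 r1, 𝔼 s2, 𝔼 r2, w (f (s1, c, r1)) (g (s2, k, r2)) z) /
            Fintype.card K - Q z / Fintype.card K| := by
        rw [Fintype.expect_eq_sum_div_card, Finset.sum_comm, Finset.sum_div]
        refine Finset.sum_congr rfl fun z _ => ?_
        rw [Finset.sum_div]
        refine Finset.sum_congr rfl fun k _ => ?_
        rw [← sub_div, abs_div, Nat.abs_cast]
      have e4 : ∀ z k, |(𝔼 c, 𝔼 r1, 𝔼 j, ∑ h1, ∑ h2,
          T (f (s1, c, r1)) (g j) h1 h2 z * (if (dec1 h1).2.1 = k then 1 else 0)) -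
          Q z / Fintype.card K| ≤
          |(𝔼 c, 𝔼 r1, 𝔼 s2, 𝔼 r2, w (f (s1, c, r1)) (g (s2, k, r2)) z) /
            Fintype.card K - Q z / Fintype.card K| + 𝔼 c, 𝔼 r1, 𝔼 j, ∑ h1, ∑ h2,
            T (f (s1, c, r1)) (g j) h1 h2 z * |(if (dec1 h1).2.1 = k then (1 : ℝ) else 0) -
              (if j.2.1 = k then 1 else 0)| := by
        intro z k
        refine (abs_sub_le _ ((𝔼 c, 𝔼 r1, 𝔼 s2, 𝔼 r2, w (f (s1, c, r1)) (g (s2, k, r2)) z) /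
            Fintype.card K) _).trans ?_
        rw [add_comm]
        refine add_le_add le_rfl ?_
        rw [e2]
        simp only [← Finset.expect_sub_distrib, ← Finset.sum_sub_distrib, ← mul_sub]
        refine (Finset.abs_expect_le ..).trans (Finset.expect_le_expect fun c _ => ?_)
        refine (Finset.abs_expect_le ..).trans (Finset.expect_le_expect fun c _ => ?_)
        refine (Finset.abs_expect_le ..).trans (Finset.expect_le_expect fun c _ => ?_)
        refine (Finset.abs_sum_le_sum_abs ..).trans (Finset.sum_le_sum fun c _ => ?_)
        refine (Finset.abs_sum_le_sum_abs ..).trans (Finset.sum_le_sum fun c _ => ?_)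
        rw [abs_mul, abs_of_nonneg (hT0 _ _ _ _ _)]
      simp_rw [e1]
      refine (Finset.sum_le_sum fun z _ => Finset.sum_le_sum fun k _ => e4 z k).trans ?_
      simp_rw [Finset.sum_add_distrib]
      rw [← e3]
      refine add_le_add le_rfl ?_
      simp only [Finset.mul_expect, ← Finset.expect_sum_comm]
      refine Finset.expect_le_expect fun c _ => Finset.expect_le_expect fun r1 _ =>
        Finset.expect_le_expect fun j _ => ?_
      have e5 : ∀ z, ∑ k, ∑ h1, ∑ h2, T (f (s1, c, r1)) (g j) h1 h2 z *
          |(if (dec1 h1).2.1 = k then (1 : ℝ) else 0) - (if j.2.1 = k then 1 else 0)| ≤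
          ∑ h1, ∑ h2, T (f (s1, c, r1)) (g j) h1 h2 z *
            (2 * if dec1 h1 ≠ j then (1 : ℝ) else 0) := by
        intro z
        rw [Finset.sum_comm]
        refine Finset.sum_le_sum fun h1 _ => ?_
        rw [Finset.sum_comm]
        refine Finset.sum_le_sum fun h2 _ => ?_
        rw [← Finset.mul_sum]
        refine mul_le_mul_of_nonneg_left ?_ (hT0 _ _ _ _ _)
        by_cases hd : dec1 h1 = j
        · simp [hd]
        · rw [if_pos (show dec1 h1 ≠ j from hd)]
          refine (Finset.sum_le_sum fun k _ => abs_sub _ _).trans ?_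
          simp only [Finset.sum_add_distrib]
          have : ∀ k0 : K, ∑ k, |if k0 = k then (1 : ℝ) else 0| = 1 := fun k0 => by
            simp [apply_ite abs]
          rw [this, this]; norm_num
      refine (Finset.sum_le_sum fun z _ => e5 z).trans (le_of_eq ?_)
      rw [Finset.mul_sum, Finset.sum_comm]
      refine Finset.sum_congr rfl fun h1 _ => ?_
      rw [Finset.mul_sum, Finset.sum_comm]
      refine Finset.sum_congr rfl fun h2 _ => ?_
      rw [Finset.mul_sum]
      exact Finset.sum_congr rfl fun z _ => by ring
    have h2 := Finset.expect_le_expect (s := Finset.univ) fun s1 _ => h1 s1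
    rw [Finset.expect_add_distrib, ← Finset.mul_expect, ← hLk1,
      ← expect_prod₃ (fun i => 𝔼 j, ∑ h1, ∑ h2, ∑ z, T (f i) (g j) h1 h2 z *
          (if dec1 h1 ≠ j then 1 else 0)), ← hE1] at h2
    linarith
  · have h1 : ∀ s2 z, 𝔼 s1, 𝔼 c, ∑ h1, ∑ h2, mixtureLaw T f g s1 c s2 h1 h2 z =
        𝔼 i, 𝔼 k, 𝔼 r2, w (f i) (g (s2, k, r2)) z := by
      intro s2 z
      unfold mixtureLaw
      simp_rw [expect_prod₃ (fun i : S1 × C × R1 => 𝔼 k, 𝔼 r2, w (f i) (g (s2, k, r2)) z), hw,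
        ← Finset.expect_sum_comm]
    simp_rw [h1]
    linarith

end OneShot

section Composition

lemma expect_prod₂ {A B : Type*} [Fintype A] [Fintype B] (F : A × B → ℝ) :
    𝔼 x, F x = 𝔼 a, 𝔼 b, F (a, b) := by
  rw [← Finset.univ_product_univ, Finset.expect_product]

lemma expect_rotate₃ {A B D : Type*} [Fintype A] [Fintype B] [Fintype D] (F : A → B → D → ℝ) :
    𝔼 a, 𝔼 b, 𝔼 d, F a b d = 𝔼 d, 𝔼 a, 𝔼 b, F a b d := by
  simp_rw [Finset.expect_comm (s := (Finset.univ : Finset B)) (t := (Finset.univ : Finset D))]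
  exact Finset.expect_comm ..

variable {S1 C S2 K H1 H2 S1' S2' K' H1' H2' Z' : Type*}
  [Fintype S1] [Fintype C] [Fintype S2] [Fintype K] [Fintype H1] [Fintype H2]
  [Fintype S1'] [Fintype S2'] [Fintype K'] [Fintype H1'] [Fintype H2'] [Fintype Z']

lemma sum_pairs₂ (F : H1 → H2 → ℝ) (F' : H1 → H1' → H2' → ℝ) :
    ∑ h1 : H1 × H1', ∑ h2 : H2 × H2', F h1.1 h2.1 * F' h1.1 h1.2 h2.2 =
      ∑ h1, ∑ h2, F h1 h2 * ∑ h1', ∑ h2', F' h1 h1' h2' := by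
  simp_rw [Fintype.sum_prod_type, Finset.mul_sum]
  exact Finset.sum_congr rfl fun h1 _ => Finset.sum_comm

lemma sum_pairs₃ (F : H1 → H2 → Z → ℝ) (F' : H1 → H1' → H2' → Z' → ℝ) :
    ∑ h1 : H1 × H1', ∑ h2 : H2 × H2', ∑ z : Z × Z',
      F h1.1 h2.1 z.1 * F' h1.1 h1.2 h2.2 z.2 =
      ∑ h1, ∑ h2, ∑ z, F h1 h2 z * ∑ h1', ∑ h2', ∑ z', F' h1 h1' h2' z' := by
  have e : ∀ (h1 : H1 × H1') (h2 : H2 × H2'), ∑ z : Z × Z', F h1.1 h2.1 z.1 * F' h1.1 h1.2 h2.2 z.2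
      = (∑ z, F h1.1 h2.1 z) * ∑ z', F' h1.1 h1.2 h2.2 z' := fun h1 h2 => by
    rw [Fintype.sum_prod_type, Finset.sum_mul_sum]
  simp only [e]
  rw [sum_pairs₂ (fun h1 h2 => ∑ z, F h1 h2 z) (fun h1 h1' h2' => ∑ z', F' h1 h1' h2' z')]
  simp only [Finset.sum_mul]

set_option maxHeartbeats 1000000 in
open scoped Classical in
/-- Two good codes can be concatenated: the key generated by the first one masks an additional
message `m`, and the masked message is used as the public message of the second code. -/
lemma IsGood.comp [AddGroup K] [Nonempty S1'] [Nonempty S2'] [Nonempty S1] [Nonempty S2]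
    [Nonempty C] {p : S1 → C → S2 → H1 → H2 → Z → ℝ}
    {p' : S1' → K → S2' → H1' → H2' → Z' → ℝ} {ε ε' : ℝ} (h : IsGood K p ε)
    (h' : IsGood K' p' ε') :
    ∃ g : H1 → K, IsGood K' (fun (s : S1 × S1' × K) (c : C) (t : S2 × S2') (h1 : H1 × H1')
      (h2 : H2 × H2') (z : Z × Z') => p s.1 c t.1 h1.1 h2.1 z.1 *
        p' s.2.1 (s.2.2 + g h1.1) t.2 h1.2 h2.2 z.2) (ε + ε') := by
  obtain ⟨hp0, hp1, g1, g2, d1, d2, Q, hQ, hQ1, herr, hl1, hl2⟩ := h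
  obtain ⟨hp0', hp1', g1', g2', d1', d2', Q', hQ', hQ1', herr', hl1', hl2'⟩ := h'
  have ind0 : ∀ (q : Prop) [Decidable q], (0 : ℝ) ≤ if q then 0 else 1 :=
    fun q _ => by split_ifs <;> simp
  refine ⟨g1, fun _ _ _ _ _ _ => mul_nonneg (hp0 ..) (hp0' ..), fun s c t => ?_,
    fun x => g1' x.2, fun x => g2' x.2, fun x => (d1 x.1, d1' x.2),
    fun x => (((d2 x.1).1, (d2' x.2).1, (d2' x.2).2 - g2 x.1), (d2 x.1).2),
    fun z => Q z.1 * Q' z.2, fun z => mul_nonneg (hQ _) (hQ' _), ?_, ?_, ?_, ?_⟩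
  · rw [sum_pairs₃ (fun h1 h2 z => p s.1 c t.1 h1 h2 z)
      (fun h1 h1' h2' z' => p' s.2.1 (s.2.2 + g1 h1) t.2 h1' h2' z')]
    simp_rw [hp1', mul_one, hp1]
  · rw [Fintype.sum_prod_type]
    simp_rw [← Finset.mul_sum, hQ1', mul_one, hQ1]
  · set E0 : S1 → C → S2 → ℝ := fun s c t => ∑ h1, ∑ h2, ∑ z, p s c t h1 h2 z *
      (if g1 h1 = g2 h2 ∧ d1 h1 = t ∧ d2 h2 = (s, c) then 0 else 1) with hE0
    set Er : S1' → K → S2' → ℝ := fun s c t => ∑ h1, ∑ h2, ∑ z, p' s c t h1 h2 z *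
      (if g1' h1 = g2' h2 ∧ d1' h1 = t ∧ d2' h2 = (s, c) then 0 else 1) with hEr
    refine (Finset.expect_le_expect (g := fun s : S1 × S1' × K => 𝔼 c, 𝔼 t : S2 × S2',
      (E0 s.1 c t.1 +
        ∑ h1, ∑ h2, ∑ z, p s.1 c t.1 h1 h2 z * Er s.2.1 (s.2.2 + g1 h1) t.2)) fun s _ =>
      Finset.expect_le_expect fun c _ => Finset.expect_le_expect fun t _ => ?_).trans ?_
    · have e1 : E0 s.1 c t.1 =
          ∑ h1 : H1 × H1', ∑ h2 : H2 × H2', ∑ z : Z × Z', (p s.1 c t.1 h1.1 h2.1 z.1 *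
          (if g1 h1.1 = g2 h2.1 ∧ d1 h1.1 = t.1 ∧ d2 h2.1 = (s.1, c) then 0 else 1)) *
          p' s.2.1 (s.2.2 + g1 h1.1) t.2 h1.2 h2.2 z.2 := by
        rw [sum_pairs₃ (fun h1 h2 z => p s.1 c t.1 h1 h2 z *
          (if g1 h1 = g2 h2 ∧ d1 h1 = t.1 ∧ d2 h2 = (s.1, c) then 0 else 1))
          (fun h1 h1' h2' z' => p' s.2.1 (s.2.2 + g1 h1) t.2 h1' h2' z')]
        simp_rw [hp1', mul_one]
        rfl
      have e2 : (∑ h1, ∑ h2, ∑ z, p s.1 c t.1 h1 h2 z * Er s.2.1 (s.2.2 + g1 h1) t.2) =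
          ∑ h1 : H1 × H1', ∑ h2 : H2 × H2', ∑ z : Z × Z', p s.1 c t.1 h1.1 h2.1 z.1 *
          (p' s.2.1 (s.2.2 + g1 h1.1) t.2 h1.2 h2.2 z.2 *
          (if g1' h1.2 = g2' h2.2 ∧ d1' h1.2 = t.2 ∧ d2' h2.2 = (s.2.1, s.2.2 + g1 h1.1)
            then 0 else 1)) :=
        (sum_pairs₃ (fun h1 h2 z => p s.1 c t.1 h1 h2 z)
          (fun h1 h1' h2' z' => p' s.2.1 (s.2.2 + g1 h1) t.2 h1' h2' z' *
          (if g1' h1' = g2' h2' ∧ d1' h1' = t.2 ∧ d2' h2' = (s.2.1, s.2.2 + g1 h1)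
            then 0 else 1))).symm
      rw [e1, e2]
      simp only [← Finset.sum_add_distrib]
      refine Finset.sum_le_sum fun h1 _ => Finset.sum_le_sum fun h2 _ =>
        Finset.sum_le_sum fun z _ => ?_
      rw [mul_right_comm (p s.1 c t.1 h1.1 h2.1 z.1) (ite _ _ _), ← mul_assoc, ← mul_add]
      refine mul_le_mul_of_nonneg_left ?_ (mul_nonneg (hp0 ..) (hp0' ..))
      by_cases c1 : g1 h1.1 = g2 h2.1 ∧ d1 h1.1 = t.1 ∧ d2 h2.1 = (s.1, c)
      · by_cases c2 : g1' h1.2 = g2' h2.2 ∧ d1' h1.2 = t.2 ∧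
          d2' h2.2 = (s.2.1, s.2.2 + g1 h1.1)
        · rw [if_pos]
          · exact add_nonneg (ind0 _) (ind0 _)
          · obtain ⟨a1, a2, a3⟩ := c1
            obtain ⟨a4, a5, a6⟩ := c2
            refine ⟨a4, Prod.ext a2 a5, ?_⟩
            rw [a3, a6, a1]
            simp
        · rw [if_neg c2]
          have := ind0 (g1 h1.1 = g2 h2.1 ∧ d1 h1.1 = t.1 ∧ d2 h2.1 = (s.1, c))
          refine le_trans (b := 1) ?_ (by linarith)
          split_ifs <;> norm_num
      · rw [if_neg c1]
        have := ind0 (g1' h1.2 = g2' h2.2 ∧ d1' h1.2 = t.2 ∧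
          d2' h2.2 = (s.2.1, s.2.2 + g1 h1.1))
        refine le_trans (b := 1) ?_ (by linarith)
        split_ifs <;> norm_num
    simp_rw [Finset.expect_add_distrib]
    refine add_le_add ?_ ?_
    · refine le_of_eq_of_le ?_ herr
      rw [expect_prod₃]
      simp_rw [expect_prod₂, Fintype.expect_const]
      rfl
    · refine le_of_eq_of_le ?_ herr'
      rw [expect_prod₃]
      simp_rw [expect_prod₂]
      have b2 : ∀ k : K, 𝔼 s', 𝔼 m, 𝔼 t', Er s' (m + k) t' = 𝔼 s', 𝔼 c', 𝔼 t', Er s' c' t' :=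
        fun k => Finset.expect_congr rfl fun s' _ =>
          Fintype.expect_equiv (Equiv.addRight k) _ _ fun m => rfl
      have b3 : 𝔼 s, 𝔼 c, 𝔼 t, ∑ h1, ∑ h2, ∑ z, p s c t h1 h2 z *
          (𝔼 s', 𝔼 m, 𝔼 t', Er s' (m + g1 h1) t') = 𝔼 s', 𝔼 c', 𝔼 t', Er s' c' t' := by
        simp_rw [b2, ← Finset.sum_mul, hp1, one_mul, Fintype.expect_const]
      rw [← b3]
      simp_rw [Finset.mul_expect, ← Finset.expect_sum_comm]
      refine Finset.expect_congr rfl fun s1 _ => ?_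
      rw [expect_rotate₃]
      exact Finset.expect_congr rfl fun c _ => expect_rotate₃ _
  · set a : S1 → Z → K → ℝ := fun s z k => 𝔼 c, 𝔼 t, ∑ h1, ∑ h2, p s c t h1 h2 z *
      (if g1 h1 = k then 1 else 0) with ha
    set b : S1' → K → Z' → K' → ℝ := fun s c z k => 𝔼 t, ∑ h1, ∑ h2, p' s c t h1 h2 z *
      (if g1' h1 = k then 1 else 0) with hb
    have hb0 : ∀ s c z k, 0 ≤ b s c z k := fun s c z k => Finset.expect_nonneg fun t _ =>
      Finset.sum_nonneg fun _ _ => Finset.sum_nonneg fun _ _ => mul_nonneg (hp0' ..)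
        (by split_ifs <;> simp)
    have hb1 : ∀ s c, ∑ z, ∑ k, b s c z k = 1 := by
      intro s c
      simp only [hb]
      simp_rw [← Finset.expect_sum_comm]
      have : ∀ t z, ∑ k, ∑ h1, ∑ h2, p' s c t h1 h2 z * (if g1' h1 = k then (1 : ℝ) else 0) =
          ∑ h1, ∑ h2, p' s c t h1 h2 z := by
        intro t z
        rw [Finset.sum_comm]
        refine Finset.sum_congr rfl fun h1 _ => ?_
        rw [Finset.sum_comm]
        refine Finset.sum_congr rfl fun h2 _ => ?_
        rw [← Finset.mul_sum]
        simp
      simp_rw [this]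
      have : ∀ t, ∑ z, ∑ h1, ∑ h2, p' s c t h1 h2 z = 1 := fun t => by
        rw [← hp1' s c t, Finset.sum_comm]
        exact Finset.sum_congr rfl fun h1 _ => Finset.sum_comm
      simp_rw [this, Fintype.expect_const]
    have c1 : ∀ (s : S1 × S1' × K) (z : Z × Z') (k' : K'),
        (𝔼 c, 𝔼 t : S2 × S2', ∑ h1 : H1 × H1', ∑ h2 : H2 × H2', p s.1 c t.1 h1.1 h2.1 z.1 *
        p' s.2.1 (s.2.2 + g1 h1.1) t.2 h1.2 h2.2 z.2 * (if g1' h1.2 = k' then 1 else 0)) =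
        ∑ k, a s.1 z.1 k * b s.2.1 (s.2.2 + k) z.2 k' := by
      intro s z k'
      have e1 : ∀ c t t', ∑ h1 : H1 × H1', ∑ h2 : H2 × H2', p s.1 c t h1.1 h2.1 z.1 *
        p' s.2.1 (s.2.2 + g1 h1.1) t' h1.2 h2.2 z.2 * (if g1' h1.2 = k' then 1 else 0) =
        ∑ h1, ∑ h2, p s.1 c t h1 h2 z.1 * ∑ h1', ∑ h2', p' s.2.1 (s.2.2 + g1 h1) t' h1' h2' z.2
          * (if g1' h1' = k' then 1 else 0) := by
        intro c t t'
        rw [← sum_pairs₂ (fun h1 h2 => p s.1 c t h1 h2 z.1) (fun h1 h1' h2' =>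
          p' s.2.1 (s.2.2 + g1 h1) t' h1' h2' z.2 * (if g1' h1' = k' then 1 else 0))]
        simp_rw [mul_assoc]
      simp_rw [expect_prod₂, e1]
      have e2 : ∀ c t, (𝔼 t', ∑ h1, ∑ h2, p s.1 c t h1 h2 z.1 *
          ∑ h1', ∑ h2', p' s.2.1 (s.2.2 + g1 h1) t' h1' h2' z.2
          * (if g1' h1' = k' then 1 else 0)) =
          ∑ k, (∑ h1, ∑ h2, p s.1 c t h1 h2 z.1 * (if g1 h1 = k then 1 else 0)) *
            b s.2.1 (s.2.2 + k) z.2 k' := by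
        intro c t
        simp_rw [Finset.expect_sum_comm, ← Finset.mul_expect, Finset.sum_mul]
        conv_rhs => rw [Finset.sum_comm]
        refine Finset.sum_congr rfl fun h1 _ => ?_
        conv_rhs => rw [Finset.sum_comm]
        refine Finset.sum_congr rfl fun h2 _ => ?_
        simp only [mul_ite, mul_one, mul_zero, ite_mul, zero_mul, Finset.sum_ite_eq,
          Finset.mem_univ, if_true]
        simp only [hb]
        simp_rw [Finset.expect_sum_comm, mul_ite, mul_one, mul_zero]
      simp_rw [e2, Finset.expect_sum_comm, ← Finset.expect_mul]
      rfl
    have c2 : ∀ (s : S1 × S1' × K), ∑ z : Z × Z', ∑ k',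
        |(∑ k, a s.1 z.1 k * b s.2.1 (s.2.2 + k) z.2 k') - Q z.1 * Q' z.2 / Fintype.card K'| ≤
        (∑ z, ∑ k, |a s.1 z k - Q z / Fintype.card K|) +
        ∑ z, ∑ k, |(𝔼 c, b s.2.1 c z k) - Q' z / Fintype.card K'| := by
      intro s
      have e1 : ∀ z z' k', |(∑ k, a s.1 z k * b s.2.1 (s.2.2 + k) z' k') -
          Q z * Q' z' / Fintype.card K'| ≤
          (∑ k, |a s.1 z k - Q z / Fintype.card K| * b s.2.1 (s.2.2 + k) z' k') +
          Q z * |(𝔼 c, b s.2.1 c z' k') - Q' z' / Fintype.card K'| := by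
        intro z z' k'
        have e2 : (𝔼 c, b s.2.1 c z' k') = 𝔼 k, b s.2.1 (s.2.2 + k) z' k' :=
          (Fintype.expect_equiv (Equiv.addLeft s.2.2) _ _ fun m => rfl).symm
        have e3 : (∑ k, a s.1 z k * b s.2.1 (s.2.2 + k) z' k') -
          Q z * Q' z' / Fintype.card K' = (∑ k, (a s.1 z k - Q z / Fintype.card K) *
            b s.2.1 (s.2.2 + k) z' k') +
          Q z * ((𝔼 c, b s.2.1 c z' k') - Q' z' / Fintype.card K') := by
          rw [e2, Fintype.expect_eq_sum_div_card]
          simp_rw [sub_mul, Finset.sum_sub_distrib, ← Finset.mul_sum]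
          ring
        rw [e3]
        refine (abs_add_le _ _).trans (add_le_add ((Finset.abs_sum_le_sum_abs ..).trans_eq ?_) ?_)
        · exact Finset.sum_congr rfl fun k _ => by rw [abs_mul, abs_of_nonneg (hb0 ..)]
        · rw [abs_mul, abs_of_nonneg (hQ z)]
      rw [Fintype.sum_prod_type]
      refine (Finset.sum_le_sum fun z _ => Finset.sum_le_sum fun z' _ =>
        Finset.sum_le_sum fun k' _ => e1 z z' k').trans (le_of_eq ?_)
      simp_rw [Finset.sum_add_distrib, ← Finset.mul_sum]
      rw [← Finset.sum_mul, hQ1, one_mul]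
      congr 1
      refine Finset.sum_congr rfl fun z _ => ?_
      have : ∀ z', ∑ k', ∑ k, |a s.1 z k - Q z / Fintype.card K| * b s.2.1 (s.2.2 + k) z' k' =
          ∑ k, |a s.1 z k - Q z / Fintype.card K| * ∑ k', b s.2.1 (s.2.2 + k) z' k' := fun z' => by
        rw [Finset.sum_comm]; simp_rw [Finset.mul_sum]
      simp_rw [this]
      rw [Finset.sum_comm]
      simp_rw [← Finset.mul_sum, hb1, mul_one]
    simp_rw [c1]
    refine (Finset.expect_le_expect fun s _ => c2 s).trans ?_
    rw [Finset.expect_add_distrib, expect_prod₃, expect_prod₃]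
    simp only [Fintype.expect_const]
    exact add_le_add hl1 hl1'
  · set a : S2 → Z → ℝ := fun t z => 𝔼 s, 𝔼 c, ∑ h1, ∑ h2, p s c t h1 h2 z with ha
    set b : S2' → Z' → ℝ := fun t z => 𝔼 s, 𝔼 c, ∑ h1, ∑ h2, p' s c t h1 h2 z with hb
    have hb0 : ∀ t z, 0 ≤ b t z := fun t z => Finset.expect_nonneg fun s _ =>
      Finset.expect_nonneg fun c _ =>
      Finset.sum_nonneg fun _ _ => Finset.sum_nonneg fun _ _ => hp0' ..
    have hb1 : ∀ t, ∑ z, b t z = 1 := by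
      intro t
      simp only [hb]
      simp_rw [← Finset.expect_sum_comm]
      have : ∀ s c, ∑ z, ∑ h1, ∑ h2, p' s c t h1 h2 z = 1 := fun s c => by
        rw [← hp1' s c t, Finset.sum_comm]
        exact Finset.sum_congr rfl fun h1 _ => Finset.sum_comm
      simp_rw [this, Fintype.expect_const]
    have c1 : ∀ (t : S2 × S2') (z : Z × Z'), (𝔼 s : S1 × S1' × K, 𝔼 c, ∑ h1 : H1 × H1',
        ∑ h2 : H2 × H2', p s.1 c t.1 h1.1 h2.1 z.1 *
        p' s.2.1 (s.2.2 + g1 h1.1) t.2 h1.2 h2.2 z.2) = a t.1 z.1 * b t.2 z.2 := by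
      intro t z
      have e1 : ∀ s s' m c, ∑ h1 : H1 × H1', ∑ h2 : H2 × H2', p s c t.1 h1.1 h2.1 z.1 *
          p' s' (m + g1 h1.1) t.2 h1.2 h2.2 z.2 = ∑ h1, ∑ h2, p s c t.1 h1 h2 z.1 *
          ∑ h1', ∑ h2', p' s' (m + g1 h1) t.2 h1' h2' z.2 := fun s s' m c =>
        sum_pairs₂ (fun h1 h2 => p s c t.1 h1 h2 z.1) (fun h1 h1' h2' =>
          p' s' (m + g1 h1) t.2 h1' h2' z.2)
      rw [expect_prod₃]
      simp_rw [e1]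
      have b2 : ∀ k : K, 𝔼 s', 𝔼 m, ∑ h1', ∑ h2', p' s' (m + k) t.2 h1' h2' z.2 = b t.2 z.2 :=
        fun k => Finset.expect_congr rfl fun s' _ =>
          Fintype.expect_equiv (Equiv.addRight k) _ _ fun m => rfl
      have b3 : 𝔼 s, 𝔼 c, ∑ h1, ∑ h2, p s c t.1 h1 h2 z.1 *
          (𝔼 s', 𝔼 m, ∑ h1', ∑ h2', p' s' (m + g1 h1) t.2 h1' h2' z.2) =
          a t.1 z.1 * b t.2 z.2 := by
        simp_rw [b2, ← Finset.sum_mul, ← Finset.expect_mul]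
        rfl
      rw [← b3]
      refine Finset.expect_congr rfl fun s1 _ => ?_
      rw [expect_rotate₃]
      refine Finset.expect_congr rfl fun c _ => ?_
      simp_rw [Finset.mul_expect, Finset.expect_sum_comm]
    have c2 : ∀ (t : S2 × S2'), ∑ z : Z × Z', |a t.1 z.1 * b t.2 z.2 - Q z.1 * Q' z.2| ≤
        (∑ z, |a t.1 z - Q z|) + ∑ z, |b t.2 z - Q' z| := by
      intro t
      have e1 : ∀ z z', |a t.1 z * b t.2 z' - Q z * Q' z'| ≤
          |a t.1 z - Q z| * b t.2 z' + Q z * |b t.2 z' - Q' z'| := by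
        intro z z'
        have e3 : a t.1 z * b t.2 z' - Q z * Q' z' =
          (a t.1 z - Q z) * b t.2 z' + Q z * (b t.2 z' - Q' z') := by ring
        rw [e3]
        refine (abs_add_le _ _).trans_eq ?_
        rw [abs_mul, abs_mul, abs_of_nonneg (hQ z), abs_of_nonneg (hb0 _ _)]
      rw [Fintype.sum_prod_type]
      refine (Finset.sum_le_sum fun z _ => Finset.sum_le_sum fun z' _ =>
        e1 z z').trans (le_of_eq ?_)
      simp_rw [Finset.sum_add_distrib, ← Finset.mul_sum]
      simp only [hb1, mul_one]
      rw [← Finset.sum_mul, hQ1, one_mul]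
    simp_rw [c1]
    refine (Finset.expect_le_expect fun s _ => c2 s).trans ?_
    rw [Finset.expect_add_distrib]
    simp_rw [expect_prod₂]
    simp only [Fintype.expect_const]
    exact add_le_add hl2 hl2'

end Composition

section Existence

lemma codebookMean_expect {I V A : Type*} [Fintype I] [DecidableEq I] [Fintype V] [Fintype A]
    (P : V → ℝ) (F : A → (I → V) → ℝ) :
    codebookMean P (fun f => 𝔼 a, F a f) = 𝔼 a, codebookMean P (F a) := by
  unfold codebookMean
  simp_rw [Finset.mul_expect, Finset.expect_sum_comm]

lemma codebookMean_comm {I J : Type*} [Fintype I] [DecidableEq I] [Fintype J] [DecidableEq J]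
    (P1 : V1 → ℝ) (P2 : V2 → ℝ) (F : (I → V1) → (J → V2) → ℝ) :
    codebookMean P1 (fun f => codebookMean P2 (fun g => F f g)) =
      codebookMean P2 (fun g => codebookMean P1 (fun f => F f g)) := by
  unfold codebookMean
  simp_rw [Finset.mul_sum]
  rw [Finset.sum_comm]
  exact Finset.sum_congr rfl fun g _ => Finset.sum_congr rfl fun f _ => by ring

variable {I J H1 H2 : Type*} [Fintype I] [DecidableEq I] [Nonempty I] [Fintype J]
  [DecidableEq J] [Nonempty J] [Fintype H1] [Fintype H2]

/-- The channel from the codeword of user 1 to the observation of user 2. -/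
def channel₁ (P2 : V2 → ℝ) (T : V1 → V2 → H1 → H2 → Z → ℝ) (u : V1) (h2 : H2) : ℝ :=
  ∑ v, P2 v * ∑ h1, ∑ z, T u v h1 h2 z

/-- The channel from the codeword of user 2 to the observation of user 1. -/
def channel₂ (P1 : V1 → ℝ) (T : V1 → V2 → H1 → H2 → Z → ℝ) (v : V2) (h1 : H1) : ℝ :=
  ∑ u, P1 u * ∑ h2, ∑ z, T u v h1 h2 z

/-- Random codebooks with maximum likelihood decoding have small error probability, and at the
same time any functional that is small on average can be made small. -/
lemma exists_codebooks {P1 : V1 → ℝ} {P2 : V2 → ℝ} (hP1 : ∀ v, 0 ≤ P1 v)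
    (hP1' : ∑ v, P1 v = 1) (hP2 : ∀ v, 0 ≤ P2 v) (hP2' : ∑ v, P2 v = 1)
    {T : V1 → V2 → H1 → H2 → Z → ℝ} (hT0 : ∀ u v h1 h2 z, 0 ≤ T u v h1 h2 z)
    {s t : ℝ} (hs : 0 < s) (hs1 : s ≤ 1) (ht : 0 < t) (ht1 : t ≤ 1)
    {Λ : (I → V1) → (J → V2) → ℝ} {l : ℝ}
    (hΛ : codebookMean P1 (fun f => codebookMean P2 (fun g => Λ f g)) ≤ l) :
    ∃ (f : I → V1) (g : J → V2) (dec2 : H2 → I) (dec1 : H1 → J),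
      2 * (𝔼 i, 𝔼 j, ∑ h1, ∑ h2, ∑ z, T (f i) (g j) h1 h2 z *
        (if dec1 h1 ≠ j then 1 else 0)) +
      (𝔼 i, 𝔼 j, ∑ h1, ∑ h2, ∑ z, T (f i) (g j) h1 h2 z * (if dec2 h2 ≠ i then 1 else 0)) +
      Λ f g ≤ 2 * (((Fintype.card J : ℝ) - 1) ^ t * tilted P2 (channel₂ P1 T) (-t)) +
        ((Fintype.card I : ℝ) - 1) ^ s * tilted P1 (channel₁ P2 T) (-s) + l := by
  set E1 : (I → V1) → (J → V2) → ℝ := fun f g => 𝔼 i, 𝔼 j, ∑ h1, ∑ h2, ∑ z,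
    T (f i) (g j) h1 h2 z * (if mlDecoder (channel₂ P1 T) g h1 ≠ j then 1 else 0) with hE1
  set E2 : (I → V1) → (J → V2) → ℝ := fun f g => 𝔼 i, 𝔼 j, ∑ h1, ∑ h2, ∑ z,
    T (f i) (g j) h1 h2 z * (if mlDecoder (channel₁ P2 T) f h2 ≠ i then 1 else 0) with hE2
  have c1 : ∀ g, codebookMean P1 (fun f => E1 f g) = 𝔼 j, ∑ h1, channel₂ P1 T (g j) h1 *
      (if mlDecoder (channel₂ P1 T) g h1 ≠ j then 1 else 0) := by
    intro g
    simp only [hE1]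
    rw [codebookMean_expect]
    have : ∀ i, codebookMean P1 (fun f : I → V1 => 𝔼 j, ∑ h1, ∑ h2, ∑ z, T (f i) (g j) h1 h2 z *
        (if mlDecoder (channel₂ P1 T) g h1 ≠ j then 1 else 0)) =
        𝔼 j, ∑ h1, channel₂ P1 T (g j) h1 *
      (if mlDecoder (channel₂ P1 T) g h1 ≠ j then 1 else 0) := by
      intro i
      rw [codebookMean_eval hP1' i (fun u => 𝔼 j, ∑ h1, ∑ h2, ∑ z, T u (g j) h1 h2 z *
        (if mlDecoder (channel₂ P1 T) g h1 ≠ j then 1 else 0))]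
      simp_rw [Finset.mul_expect, ← Finset.expect_sum_comm]
      refine Finset.expect_congr rfl fun j _ => ?_
      simp_rw [Finset.mul_sum]
      rw [Finset.sum_comm]
      refine Finset.sum_congr rfl fun h1 _ => ?_
      simp only [channel₂, Finset.sum_mul, Finset.mul_sum, mul_assoc]
    simp only [this, Fintype.expect_const]
  have c2 : ∀ f, codebookMean P2 (fun g => E2 f g) = 𝔼 i, ∑ h2, channel₁ P2 T (f i) h2 *
      (if mlDecoder (channel₁ P2 T) f h2 ≠ i then 1 else 0) := by
    intro f
    simp only [hE2]
    rw [codebookMean_expect]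
    refine Finset.expect_congr rfl fun i _ => ?_
    rw [codebookMean_expect]
    have : ∀ j, codebookMean P2 (fun g : J → V2 => ∑ h1, ∑ h2, ∑ z, T (f i) (g j) h1 h2 z *
        (if mlDecoder (channel₁ P2 T) f h2 ≠ i then 1 else 0)) =
        ∑ h2, channel₁ P2 T (f i) h2 *
      (if mlDecoder (channel₁ P2 T) f h2 ≠ i then 1 else 0) := by
      intro j
      rw [codebookMean_eval hP2' j (fun v => ∑ h1, ∑ h2, ∑ z, T (f i) v h1 h2 z *
        (if mlDecoder (channel₁ P2 T) f h2 ≠ i then 1 else 0))]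
      simp only [channel₁, Finset.sum_mul, Finset.mul_sum, mul_assoc]
      conv_rhs => rw [Finset.sum_comm]
      exact Finset.sum_congr rfl fun v _ => Finset.sum_comm
    simp only [this, Fintype.expect_const]
  have hch2 : ∀ v h1, 0 ≤ channel₂ P1 T v h1 := fun v h1 => Finset.sum_nonneg fun u _ =>
    mul_nonneg (hP1 u) (Finset.sum_nonneg fun _ _ => Finset.sum_nonneg fun _ _ => hT0 ..)
  have hch1 : ∀ u h2, 0 ≤ channel₁ P2 T u h2 := fun v h1 => Finset.sum_nonneg fun u _ =>
    mul_nonneg (hP2 u) (Finset.sum_nonneg fun _ _ => Finset.sum_nonneg fun _ _ => hT0 ..)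
  have b1 : codebookMean P1 (fun f => codebookMean P2 (fun g => E1 f g)) ≤
      ((Fintype.card J : ℝ) - 1) ^ t * tilted P2 (channel₂ P1 T) (-t) := by
    rw [codebookMean_comm]
    simp only [c1]
    exact codebookMean_decoding_le hP2 hP2' hch2 ht ht1
  have b2 : codebookMean P1 (fun f => codebookMean P2 (fun g => E2 f g)) ≤
      ((Fintype.card I : ℝ) - 1) ^ s * tilted P1 (channel₁ P2 T) (-s) := by
    simp only [c2]
    exact codebookMean_decoding_le hP1 hP1' hch1 hs hs1
  obtain ⟨f, hf⟩ := exists_le_codebookMean (I := I) hP1 hP1'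
    (fun f => codebookMean P2 (fun g : J → V2 => 2 * E1 f g + E2 f g + Λ f g))
  obtain ⟨g, hg⟩ := exists_le_codebookMean hP2 hP2' (fun g : J → V2 =>
    2 * E1 f g + E2 f g + Λ f g)
  refine ⟨f, g, mlDecoder (channel₁ P2 T) f, mlDecoder (channel₂ P1 T) g,
    (hg.trans hf).trans ?_⟩
  simp only [codebookMean_add, codebookMean_mul]
  linarith

end Existence

section Covering

variable {S1 C R1 S2 K R2 : Type*} [Fintype S1] [DecidableEq S1] [Fintype C] [DecidableEq C]
  [Fintype R1] [DecidableEq R1] [Fintype S2] [DecidableEq S2] [Fintype K] [DecidableEq K]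
  [Fintype R2] [DecidableEq R2]
  [Nonempty S1] [Nonempty C] [Nonempty R1] [Nonempty S2] [Nonempty K] [Nonempty R2]

/-- The total leakage of a pair of codebooks relative to a reference law `Q`. -/
def leakage (w : V1 → V2 → Z → ℝ) (Q : Z → ℝ) (f : S1 × C × R1 → V1) (g : S2 × K × R2 → V2) : ℝ :=
  (𝔼 s1, 𝔼 k, ∑ z, |(𝔼 c, 𝔼 r1, 𝔼 s2, 𝔼 r2, w (f (s1, c, r1)) (g (s2, k, r2)) z) - Q z|) +
  (𝔼 s2, ∑ z, |(𝔼 i, 𝔼 k, 𝔼 r2, w (f i) (g (s2, k, r2)) z) - Q z|)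

omit [Fintype V1] [Fintype V2] [DecidableEq S1] [DecidableEq C] [DecidableEq R1]
  [DecidableEq S2] [DecidableEq K] [DecidableEq R2] [Nonempty S1] [Nonempty C] [Nonempty R1]
  [Nonempty S2] [Nonempty K] [Nonempty R2] in
lemma leakage_eq (w : V1 → V2 → Z → ℝ) (Q : Z → ℝ) (f : S1 × C × R1 → V1)
    (g : S2 × K × R2 → V2) : leakage w Q f g =
    (𝔼 s1, 𝔼 k, ∑ z, |(𝔼 i : C × R1, 𝔼 j : S2 × R2, w (f (s1, i)) (g (j.1, k, j.2)) z) - Q z|) +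
    (𝔼 s2, ∑ z, |(𝔼 i, 𝔼 j : K × R2, w (f i) (g (s2, j)) z) - Q z|) := by
  unfold leakage
  simp only [expect_prod₂]

lemma tilted_nonneg {A D : Type*} [Fintype A] [Fintype D] {P : A → ℝ} (hP : ∀ a, 0 ≤ P a)
    {U : A → D → ℝ} (hU : ∀ a d, 0 ≤ U a d) (t : ℝ) : 0 ≤ tilted P U t :=
  Finset.sum_nonneg fun a _ => mul_nonneg (hP a) (Finset.sum_nonneg fun d _ =>
    mul_nonneg (hU a d) (Real.rpow_nonneg (div_nonneg (hU a d) (Finset.sum_nonneg fun a' _ =>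
      mul_nonneg (hP a') (hU a' d))) t))

lemma rpow_neg_mul_tilted_le {A D : Type*} [Fintype A] [Fintype D] {P : A → ℝ}
    (hP : ∀ a, 0 ≤ P a) {U : A → D → ℝ} (hU : ∀ a d, 0 ≤ U a d) {s m M : ℝ} (hs : 0 < s)
    (hm : 0 < m) (hM : m ≤ M) : M ^ (-s) * tilted P U s ≤ m ^ (-s) * tilted P U s :=
  mul_le_mul_of_nonneg_right (Real.rpow_le_rpow_of_nonpos hm hM (by linarith))
    (tilted_nonneg hP hU s)

lemma codebookMean_l1_le₂' {I J I' J' : Type*} [Fintype I] [DecidableEq I] [Fintype J]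
    [DecidableEq J] [Fintype I'] [Nonempty I'] [Fintype J'] [Nonempty J'] {P1 : V1 → ℝ}
    {P2 : V2 → ℝ} (hP1 : ∀ v, 0 ≤ P1 v)
    (hP1' : ∑ v, P1 v = 1) (hP2 : ∀ v, 0 ≤ P2 v) (hP2' : ∑ v, P2 v = 1)
    {w : V1 → V2 → Z → ℝ} (hw : ∀ u v z, 0 ≤ w u v z) (hw1 : ∀ u v, ∑ z, w u v z = 1)
    {l s1 s2 s3 : ℝ} (hl : 0 < l) (hs1 : 0 < s1) (hs1' : s1 ≤ 1) (hs2 : 0 < s2) (hs2' : s2 ≤ 1)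
    (hs3 : 0 < s3) (hs3' : s3 ≤ 1) {m1 m2 m3 : ℝ} (hm1 : 0 < m1) (hm2 : 0 < m2) (hm3 : 0 < m3)
    {e1 : I' → I} (he1 : Function.Injective e1) {e2 : J' → J}
    (he2 : Function.Injective e2) (h1 : m1 ≤ Fintype.card I') (h2 : m2 ≤ Fintype.card J')
    (h3 : m3 ≤ Fintype.card I' * Fintype.card J') :
    codebookMean P1 (fun f : I → V1 => codebookMean P2 (fun g : J → V2 =>
      ∑ z, |(𝔼 i, 𝔼 j, w (f (e1 i)) (g (e2 j)) z) - ∑ u, P1 u * ∑ v, P2 v * w u v z|)) ≤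
    l + 1 / l * (m1 ^ (-s1) * tilted P1 (fun u z => ∑ v, P2 v * w u v z) s1 +
      m2 ^ (-s2) * tilted P2 (fun v z => ∑ u, P1 u * w u v z) s2 +
      m3 ^ (-s3) * tilted (fun a : V1 × V2 => P1 a.1 * P2 a.2) (fun a z => w a.1 a.2 z) s3) := by
  refine (codebookMean_l1_le₂ hP1 hP1' hP2 hP2' hw hw1 he1 he2 hl hs1 hs1' hs2 hs2' hs3
      hs3').trans ?_
  refine add_le_add le_rfl (mul_le_mul_of_nonneg_left (add_le_add (add_le_add ?_ ?_) ?_)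
    (by positivity))
  · exact rpow_neg_mul_tilted_le hP1 (fun u z => Finset.sum_nonneg fun v _ =>
        mul_nonneg (hP2 v) (hw u v z)) hs1 hm1 h1
  · exact rpow_neg_mul_tilted_le hP2 (fun u z => Finset.sum_nonneg fun v _ =>
        mul_nonneg (hP1 v) (hw v u z)) hs2 hm2 h2
  · exact rpow_neg_mul_tilted_le (fun a : V1 × V2 => mul_nonneg (hP1 a.1) (hP2 a.2))
        (fun a z => hw a.1 a.2 z) hs3 hm3 h3

lemma codebookMean_revealed_l1_le {I J J' : Type*} [Fintype I] [DecidableEq I] [Nonempty I]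
    [Fintype J] [DecidableEq J] [Fintype J'] [Nonempty J'] {P1 : V1 → ℝ} {P2 : V2 → ℝ}
    (hP1 : ∀ v, 0 ≤ P1 v)
    (hP1' : ∑ v, P1 v = 1) (hP2 : ∀ v, 0 ≤ P2 v) (hP2' : ∑ v, P2 v = 1)
    {w : V1 → V2 → Z → ℝ} (hw : ∀ u v z, 0 ≤ w u v z) (hw1 : ∀ u v, ∑ z, w u v z = 1)
    {l s : ℝ} (hl : 0 < l) (hs : 0 < s) (hs' : s ≤ 1) {m : ℝ} (hm : 0 < m)
    {e2 : J' → J} (he2 : Function.Injective e2) (h2 : m ≤ Fintype.card J') :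
    codebookMean P1 (fun f : I → V1 => codebookMean P2 (fun g : J → V2 =>
      ∑ z, |(𝔼 i, 𝔼 j, w (f i) (g (e2 j)) z) - 𝔼 i, ∑ v, P2 v * w (f i) v z|)) ≤
      l + 1 / l * (m ^ (-s) * tilted P2 (fun v (a : V1 × Z) => P1 a.1 * w a.1 v a.2) s) := by
  set U : V2 → V1 × Z → ℝ := fun v a => P1 a.1 * w a.1 v a.2 with hU
  have hU0 : ∀ v a, 0 ≤ U v a := fun v a => mul_nonneg (hP1 _) (hw _ _ _)
  have hw2 : ∀ u z, 0 ≤ ∑ v, P2 v * w u v z := fun u z => Finset.sum_nonneg fun v _ =>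
        mul_nonneg (hP2 v) (hw u v z)
  have htil : ∑ u, P1 u * tilted P2 (w u) s = tilted P2 U s := by
    unfold tilted
    simp_rw [Finset.mul_sum]
    rw [Finset.sum_comm]
    refine Finset.sum_congr rfl fun v _ => ?_
    rw [Fintype.sum_prod_type]
    refine Finset.sum_congr rfl fun u _ => Finset.sum_congr rfl fun z _ => ?_
    rcases (hP1 u).eq_or_lt with h | h
    · simp [hU, ← h]
    · simp only [hU]
      have : ∑ v', P2 v' * (P1 u * w u v' z) = P1 u * ∑ v', P2 v' * w u v' z := by
        rw [Finset.mul_sum]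
        exact Finset.sum_congr rfl fun v' _ => by ring
      rw [this, mul_div_mul_left _ _ h.ne']
      ring
  have b1 : ∀ f : I → V1, codebookMean P2 (fun g : J → V2 =>
    ∑ z, |(𝔼 i, 𝔼 j, w (f i) (g (e2 j)) z) - 𝔼 i, ∑ v, P2 v * w (f i) v z|) ≤
    𝔼 i, (l + 1 / l * (m ^ (-s) * tilted P2 (w (f i)) s)) := by
    intro f
    refine (codebookMean_mono hP2 (G := fun g : J → V2 => 𝔼 i,
      ∑ z, |(𝔼 j, w (f i) (g (e2 j)) z) - ∑ v, P2 v * w (f i) v z|) fun g => ?_).trans ?_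
    · rw [Finset.expect_sum_comm]
      refine Finset.sum_le_sum fun z _ => ?_
      rw [← Finset.expect_sub_distrib]
      exact Finset.abs_expect_le ..
    · rw [codebookMean_expect]
      refine Finset.expect_le_expect fun i _ => ?_
      refine (codebookMean_l1_le hP2 hP2' (hw (f i)) (hw1 (f i)) he2 hl hs hs').trans ?_
      refine add_le_add le_rfl (mul_le_mul_of_nonneg_left ?_ (by positivity))
      exact rpow_neg_mul_tilted_le hP2 (hw (f i)) hs hm h2
  refine (codebookMean_mono hP1 b1).trans (le_of_eq ?_)
  rw [codebookMean_expect]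
  have : ∀ i, codebookMean P1 (fun f : I → V1 =>
      l + 1 / l * (m ^ (-s) * tilted P2 (w (f i)) s)) =
      l + 1 / l * (m ^ (-s) * tilted P2 U s) := by
    intro i
    rw [codebookMean_add, codebookMean_const hP1', codebookMean_mul, codebookMean_mul,
      codebookMean_eval hP1' i (fun u => tilted P2 (w u) s), htil]
  simp only [this, Fintype.expect_const]

/-- Both users' codebooks cover the output law. -/
lemma codebookMean_leakage_le {P1 : V1 → ℝ} {P2 : V2 → ℝ} (hP1 : ∀ v, 0 ≤ P1 v)
    (hP1' : ∑ v, P1 v = 1) (hP2 : ∀ v, 0 ≤ P2 v) (hP2' : ∑ v, P2 v = 1)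
    {w : V1 → V2 → Z → ℝ} (hw : ∀ u v z, 0 ≤ w u v z) (hw1 : ∀ u v, ∑ z, w u v z = 1)
    {l s1 s2 s3 : ℝ} (hl : 0 < l) (hs1 : 0 < s1) (hs1' : s1 ≤ 1) (hs2 : 0 < s2) (hs2' : s2 ≤ 1)
    (hs3 : 0 < s3) (hs3' : s3 ≤ 1) {m1 m2 m3 : ℝ} (hm1 : 0 < m1) (hm2 : 0 < m2) (hm3 : 0 < m3)
    (hcr : m1 ≤ Fintype.card C * Fintype.card R1) (hsr : m2 ≤ Fintype.card S2 * Fintype.card R2)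
    (hkr : m2 ≤ Fintype.card K * Fintype.card R2)
    (h3 : m3 ≤ Fintype.card C * Fintype.card R1 * (Fintype.card S2 * Fintype.card R2))
    (h4 : m3 ≤ Fintype.card (S1 × C × R1) * (Fintype.card K * Fintype.card R2)) :
    codebookMean P1 (fun f : S1 × C × R1 → V1 => codebookMean P2 (fun g : S2 × K × R2 → V2 =>
      leakage w (fun z => ∑ u, P1 u * ∑ v, P2 v * w u v z) f g)) ≤
    2 * (l + 1 / l * (m1 ^ (-s1) * tilted P1 (fun u z => ∑ v, P2 v * w u v z) s1 +
      m2 ^ (-s2) * tilted P2 (fun v z => ∑ u, P1 u * w u v z) s2 +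
      m3 ^ (-s3) * tilted (fun a : V1 × V2 => P1 a.1 * P2 a.2) (fun a z => w a.1 a.2 z) s3)) := by
  simp only [leakage_eq, codebookMean_add, codebookMean_expect]
  rw [two_mul]
  refine add_le_add ?_ ?_
  · refine Finset.expect_le Finset.univ_nonempty fun s0 _ =>
      Finset.expect_le Finset.univ_nonempty fun k _ => ?_
    refine codebookMean_l1_le₂' hP1 hP1' hP2 hP2' hw hw1 hl hs1 hs1' hs2 hs2' hs3 hs3' hm1 hm2 hm3
      (e1 := fun i : C × R1 => (s0, i)) (fun a b h => (Prod.ext_iff.1 h).2)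
      (e2 := fun j : S2 × R2 => (j.1, k, j.2)) (fun a b h => ?_) ?_ ?_ ?_
    · simp only [Prod.mk.injEq, true_and] at h
      exact Prod.ext h.1 h.2
    · simpa using hcr
    · simpa using hsr
    · simpa using h3
  · refine Finset.expect_le Finset.univ_nonempty fun s0 _ => ?_
    refine codebookMean_l1_le₂' hP1 hP1' hP2 hP2' hw hw1 hl hs1 hs1' hs2 hs2' hs3 hs3' hm1 hm2 hm3
      (e1 := id) Function.injective_id
      (e2 := fun j : K × R2 => (s0, j)) (fun a b h => (Prod.ext_iff.1 h).2) ?_ ?_ ?_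
    · refine hcr.trans ?_
      have : (1 : ℝ) ≤ Fintype.card S1 := by exact_mod_cast Fintype.card_pos
      simp only [Fintype.card_prod, Nat.cast_mul]
      exact le_mul_of_one_le_left (by positivity) this
    · simpa using hkr
    · simpa using h4

/-- The codeword of user 1 is revealed, and the codebook of user 2 covers the output law. -/
lemma codebookMean_leakage_le' [Subsingleton S1] {P1 : V1 → ℝ} {P2 : V2 → ℝ}
    (hP1 : ∀ v, 0 ≤ P1 v)
    (hP1' : ∑ v, P1 v = 1) (hP2 : ∀ v, 0 ≤ P2 v) (hP2' : ∑ v, P2 v = 1)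
    {w : V1 → V2 → Z → ℝ} (hw : ∀ u v z, 0 ≤ w u v z) (hw1 : ∀ u v, ∑ z, w u v z = 1)
    {l s : ℝ} (hl : 0 < l) (hs : 0 < s) (hs' : s ≤ 1) {m : ℝ} (hm : 0 < m)
    (hsr : m ≤ Fintype.card S2 * Fintype.card R2)
    (hkr : m ≤ Fintype.card K * Fintype.card R2) :
    codebookMean P1 (fun f : S1 × C × R1 → V1 => codebookMean P2 (fun g : S2 × K × R2 → V2 =>
      leakage w (fun z => 𝔼 i, ∑ v, P2 v * w (f i) v z) f g)) ≤
    2 * (l + 1 / l * (m ^ (-s) * tilted P2 (fun v (a : V1 × Z) => P1 a.1 * w a.1 v a.2) s)) := by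
  simp only [leakage_eq, codebookMean_add, codebookMean_expect]
  rw [two_mul]
  refine add_le_add ?_ ?_
  · refine Finset.expect_le Finset.univ_nonempty fun s0 _ =>
      Finset.expect_le Finset.univ_nonempty fun k _ => ?_
    have hs1 : ∀ F : S1 × C × R1 → ℝ, 𝔼 i, F i = 𝔼 j : C × R1, F (s0, j) := by
      intro F
      rw [expect_prod₂]
      have : ∀ a, 𝔼 b, F (a, b) = 𝔼 b, F (s0, b) := fun a => by rw [Subsingleton.elim a s0]
      simp only [this, Fintype.expect_const]
    have := codebookMean_revealed_l1_le (I := S1 × C × R1) hP1 hP1' hP2 hP2' hw hw1 hl hs hs' hm (e2 := fun j : S2 × R2 => (j.1, k, j.2)) (fun a b h => by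
      simp only [Prod.mk.injEq, true_and] at h
      exact Prod.ext h.1 h.2) (by simpa using hsr)
    simp only [hs1] at this ⊢
    exact this
  · refine Finset.expect_le Finset.univ_nonempty fun s0 _ => ?_
    exact codebookMean_revealed_l1_le hP1 hP1' hP2 hP2' hw hw1 hl hs hs' hm (e2 := fun j : K × R2 => (s0, j)) (fun a b h => (Prod.ext_iff.1 h).2)
      (by simpa using hkr)

end Covering

section Transport

variable {S1 C S2 K H1 H2 S1' C' S2' K' H1' H2' Z' : Type*}
  [Fintype S1] [Fintype C] [Fintype S2] [Fintype K] [Fintype H1] [Fintype H2]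
  [Fintype S1'] [Fintype C'] [Fintype S2'] [Fintype K'] [Fintype H1'] [Fintype H2'] [Fintype Z']
  {p : S1 → C → S2 → H1 → H2 → Z → ℝ} {ε : ℝ}

lemma IsGood.mono (h : IsGood K p ε) {ε' : ℝ} (hε : ε ≤ ε') : IsGood K p ε' := by
  obtain ⟨h0, h1, g1, g2, d1, d2, Q, hQ, hQ1, a, b, c⟩ := h
  exact ⟨h0, h1, g1, g2, d1, d2, Q, hQ, hQ1, a.trans hε, b.trans hε, c.trans hε⟩

/-- Goodness is invariant under relabelling. -/
lemma IsGood.map (h : IsGood K p ε) (σ1 : S1' ≃ S1) (γ : C' ≃ C) (σ2 : S2' ≃ S2) (κ : K ≃ K')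
    (e1 : H1' ≃ H1) (e2 : H2' ≃ H2) (ez : Z' ≃ Z) :
    IsGood K' (fun s1 c s2 h1 h2 z => p (σ1 s1) (γ c) (σ2 s2) (e1 h1) (e2 h2) (ez z)) ε := by
  obtain ⟨h0, h1, g1, g2, d1, d2, Q, hQ, hQ1, herr, hl1, hl2⟩ := h
  refine ⟨fun _ _ _ _ _ _ => h0 .., fun s1 c s2 => ?_, fun h => κ (g1 (e1 h)),
    fun h => κ (g2 (e2 h)), fun h => σ2.symm (d1 (e1 h)),
    fun h => (σ1.symm (d2 (e2 h)).1, γ.symm (d2 (e2 h)).2), fun z => Q (ez z),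
    fun z => hQ _, ?_, ?_, ?_, ?_⟩
  · rw [← h1 (σ1 s1) (γ c) (σ2 s2)]
    exact Fintype.sum_equiv e1 _ _ fun x => Fintype.sum_equiv e2 _ _ fun y =>
      Fintype.sum_equiv ez _ _ fun z => rfl
  · rw [← hQ1]
    exact Fintype.sum_equiv ez _ _ fun z => rfl
  · refine le_of_eq_of_le ?_ herr
    refine Fintype.expect_equiv σ1 _ _ fun s1 => Fintype.expect_equiv γ _ _ fun c =>
      Fintype.expect_equiv σ2 _ _ fun s2 => Fintype.sum_equiv e1 _ _ fun x =>
      Fintype.sum_equiv e2 _ _ fun y => Fintype.sum_equiv ez _ _ fun z => ?_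
    congr 1
    have : (κ (g1 (e1 x)) = κ (g2 (e2 y)) ∧ σ2.symm (d1 (e1 x)) = s2 ∧
        (σ1.symm (d2 (e2 y)).1, γ.symm (d2 (e2 y)).2) = (s1, c)) ↔
        (g1 (e1 x) = g2 (e2 y) ∧ d1 (e1 x) = σ2 s2 ∧ d2 (e2 y) = (σ1 s1, γ c)) := by
      simp [Equiv.symm_apply_eq, Prod.ext_iff]
    split_ifs <;> tauto
  · refine le_of_eq_of_le ?_ hl1
    refine Fintype.expect_equiv σ1 _ _ fun s1 => Fintype.sum_equiv ez _ _ fun z =>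
      Fintype.sum_equiv κ.symm _ _ fun k => ?_
    rw [Fintype.card_congr κ]
    congr 2
    refine Fintype.expect_equiv γ _ _ fun c =>
      Fintype.expect_equiv σ2 _ _ fun s2 => Fintype.sum_equiv e1 _ _ fun x =>
      Fintype.sum_equiv e2 _ _ fun y => ?_
    congr 1
    have : κ (g1 (e1 x)) = k ↔ g1 (e1 x) = κ.symm k := by rw [Equiv.eq_symm_apply]
    split_ifs <;> tauto
  · refine le_of_eq_of_le ?_ hl2
    refine Fintype.expect_equiv σ2 _ _ fun s1 => Fintype.sum_equiv ez _ _ fun z => ?_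
    congr 2
    exact Fintype.expect_equiv σ1 _ _ fun c =>
      Fintype.expect_equiv γ _ _ fun s2 => Fintype.sum_equiv e1 _ _ fun x =>
      Fintype.sum_equiv e2 _ _ fun y => rfl

/-- A code that generates a key can be used as a code without key. -/
lemma IsGood.forget [Nonempty K] [Unique K'] (h : IsGood K p ε) : IsGood K' p ε := by
  obtain ⟨h0, h1, g1, g2, d1, d2, Q, hQ, hQ1, herr, hl1, hl2⟩ := h
  refine ⟨h0, h1, fun _ => default, fun _ => default, d1, d2, Q, hQ, hQ1, ?_, ?_, hl2⟩
  · refine le_trans ?_ herr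
    refine Finset.expect_le_expect fun s1 _ => Finset.expect_le_expect fun c _ =>
      Finset.expect_le_expect fun s2 _ => Finset.sum_le_sum fun x _ => Finset.sum_le_sum fun y _ =>
      Finset.sum_le_sum fun z _ => mul_le_mul_of_nonneg_left ?_ (h0 ..)
    by_cases hc : d1 x = s2 ∧ d2 y = (s1, c)
    · rw [if_pos ⟨rfl, hc⟩]
      split_ifs <;> simp
    · rw [if_neg (fun h => hc h.2), if_neg (fun h => hc h.2)]
  · refine le_trans ?_ hl1
    refine Finset.expect_le_expect fun s1 _ => Finset.sum_le_sum fun z _ => ?_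
    rw [Fintype.sum_unique]
    refine le_trans (le_of_eq ?_) (Finset.abs_sum_le_sum_abs _ _)
    congr 1
    rw [Finset.sum_sub_distrib, Finset.sum_const, Finset.card_univ, nsmul_eq_mul,
      mul_div_cancel₀ _ (by positivity), Fintype.card_unique, Nat.cast_one, div_one]
    congr 1
    simp_rw [Finset.expect_sum_comm]
    conv_rhs => rw [Finset.sum_comm]
    refine Finset.sum_congr rfl fun x _ => ?_
    conv_rhs => rw [Finset.sum_comm]
    refine Finset.sum_congr rfl fun y _ => ?_
    rw [← Finset.expect_sum_comm]
    refine Finset.expect_congr rfl fun c _ => ?_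
    rw [← Finset.expect_sum_comm]
    refine Finset.expect_congr rfl fun s2 _ => ?_
    rw [← Finset.mul_sum, Finset.sum_eq_single (g1 x) (fun k _ hk => if_neg hk.symm)
      (fun h => (h (Finset.mem_univ _)).elim), if_pos rfl]
    simp

lemma expect_default {A : Type*} [Fintype A] [Unique A] (F : A → ℝ) : 𝔼 a, F a = F default := by
  rw [Fintype.expect_eq_sum_div_card]
  simp

/-- Exchanging the roles of the users in a code without keys. -/
lemma IsGood.swap [Unique C] [Unique K] (h : IsGood K p ε) :
    IsGood K (fun (s2 : S2) (_ : C) (s1 : S1) (h2 : H2) (h1 : H1) (z : Z) =>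
      p s1 default s2 h1 h2 z) ε := by
  obtain ⟨h0, h1, g1, g2, d1, d2, Q, hQ, hQ1, herr, hl1, hl2⟩ := h
  refine ⟨fun _ _ _ _ _ _ => h0 .., fun s2 _ s1 => ?_, g2, g1, fun h => (d2 h).1,
    fun h => (d1 h, default), Q, hQ, hQ1, ?_, ?_, ?_⟩
  · rw [← h1 s1 default s2, Finset.sum_comm]
  · refine le_of_eq_of_le ?_ herr
    simp_rw [expect_default]
    rw [Finset.expect_comm]
    refine Finset.expect_congr rfl fun s1 _ => Finset.expect_congr rfl fun s2 _ => ?_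
    rw [Finset.sum_comm]
    refine Finset.sum_congr rfl fun x _ => Finset.sum_congr rfl fun y _ =>
      Finset.sum_congr rfl fun z _ => ?_
    congr 1
    have hc : (d2 y).2 = default := Subsingleton.elim _ _
    have : (g2 y = g1 x ∧ (d2 y).1 = s1 ∧ (d1 x, (default : C)) = (s2, default)) ↔
        (g1 x = g2 y ∧ d1 x = s2 ∧ d2 y = (s1, default)) := by
      simp only [Prod.ext_iff, and_true, hc]
      tauto
    split_ifs <;> tauto
  · refine le_of_eq_of_le ?_ hl2
    refine Finset.expect_congr rfl fun s2 _ => Finset.sum_congr rfl fun z _ => ?_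
    rw [Fintype.sum_unique, Fintype.card_unique, Nat.cast_one, div_one]
    congr 2
    simp_rw [expect_default]
    refine Finset.expect_congr rfl fun s1 _ => ?_
    rw [Finset.sum_comm]
    refine Finset.sum_congr rfl fun x _ => Finset.sum_congr rfl fun y _ => ?_
    rw [if_pos (Subsingleton.elim _ _), mul_one]
  · refine le_of_eq_of_le ?_ hl1
    refine Finset.expect_congr rfl fun s2 _ => Finset.sum_congr rfl fun z _ => ?_
    rw [Fintype.sum_unique, Fintype.card_unique, Nat.cast_one, div_one]
    congr 2
    simp_rw [expect_default]
    refine Finset.expect_congr rfl fun s1 _ => ?_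
    rw [Finset.sum_comm]
    refine Finset.sum_congr rfl fun x _ => Finset.sum_congr rfl fun y _ => ?_
    rw [if_pos (Subsingleton.elim _ _), mul_one]

end Transport

section Causal

variable {X Y : Type*} [Fintype X]

/-- A kernel that generates inputs causally from past inputs and outputs. -/
def IsCausalKernel (N : ℕ) (q : (Fin N → X) → (Fin N → Y) → ℝ) : Prop :=
  ∃ φ : Fin N → (Fin N → X) → (Fin N → Y) → X → ℝ,
    (∀ (k : Fin N) (x x' : Fin N → X) (y y' : Fin N → Y),
      (∀ j : Fin N, (j : ℕ) < (k : ℕ) → x j = x' j ∧ y j = y' j) → φ k x y = φ k x' y') ∧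
    (∀ k x y, (∀ a, 0 ≤ φ k x y a) ∧ ∑ a, φ k x y a = 1) ∧
    ∀ x y, q x y = ∏ k, φ k x y (x k)

lemma IsCausalKernel.append {N N' : ℕ} {q : (Fin N → X) → (Fin N → Y) → ℝ}
    {q' : (Fin N → X) → (Fin N → Y) → (Fin N' → X) → (Fin N' → Y) → ℝ}
    (h : IsCausalKernel N q) (h' : ∀ x y, IsCausalKernel N' (q' x y)) :
    IsCausalKernel (N + N') fun x y =>
      q (fun i => x (Fin.castAdd N' i)) (fun i => y (Fin.castAdd N' i)) *
      q' (fun i => x (Fin.castAdd N' i)) (fun i => y (Fin.castAdd N' i))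
        (fun i => x (Fin.natAdd N i)) (fun i => y (Fin.natAdd N i)) := by
  obtain ⟨φ, hφ, hφ1, hq⟩ := h
  choose φ' hφ' hφ1' hq' using h'
  refine ⟨fun k x y => Fin.addCases
    (fun i => φ i (fun i => x (Fin.castAdd N' i)) (fun i => y (Fin.castAdd N' i)))
    (fun i => φ' (fun i => x (Fin.castAdd N' i)) (fun i => y (Fin.castAdd N' i)) i
      (fun i => x (Fin.natAdd N i)) (fun i => y (Fin.natAdd N i))) k, ?_, ?_, ?_⟩
  · intro k x x' y y' hxy
    refine Fin.addCases (fun i hxy => ?_) (fun i hxy => ?_) k hxy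
    · simp only [Fin.addCases_left]
      exact hφ i _ _ _ _ fun j hj => hxy _ (by simpa using hj)
    · simp only [Fin.addCases_right]
      have e1 : (fun i => x (Fin.castAdd N' i)) = fun i => x' (Fin.castAdd N' i) :=
        funext fun j => (hxy _ (by simp; omega)).1
      have e2 : (fun i => y (Fin.castAdd N' i)) = fun i => y' (Fin.castAdd N' i) :=
        funext fun j => (hxy _ (by simp; omega)).2
      rw [e1, e2]
      exact hφ' _ _ i _ _ _ _ fun j hj => hxy _ (by simpa using hj)
  · intro k x y
    refine Fin.addCases (fun i => ?_) (fun i => ?_) k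
    · simp only [Fin.addCases_left]
      exact hφ1 ..
    · simp only [Fin.addCases_right]
      exact hφ1' ..
  · intro x y
    beta_reduce
    rw [Fin.prod_univ_add, hq, hq']
    simp

lemma isCausalKernel_of_pmf (N : ℕ) {P : (Fin N → X) → ℝ} (hP : ∀ x, 0 ≤ P x)
    (hP1 : ∑ x, P x = 1) : IsCausalKernel N fun x (_ : Fin N → Y) => P x := by
  induction N with
  | zero =>
    refine ⟨fun k => k.elim0, fun k => k.elim0, fun k => k.elim0, fun x y => ?_⟩
    rw [Fintype.sum_unique] at hP1
    beta_reduce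
    rw [Subsingleton.elim x default, hP1]
    simp
  | succ N ih =>
    have hX : Nonempty X := by
      by_contra h
      rw [not_nonempty_iff] at h
      have : IsEmpty (Fin (N + 1) → X) := ⟨fun f => h.elim (f 0)⟩
      simp at hP1
    have hsum : ∀ F : (Fin (N + 1) → X) → ℝ, ∑ x, F x =
        ∑ x : Fin N → X, ∑ a, F (Fin.snoc (α := fun _ => X) x a) := fun F => by
      rw [← (Fin.snocEquiv (fun _ : Fin (N + 1) => X)).sum_comp, Fintype.sum_prod_type,
        Finset.sum_comm]
      rfl
    set M : (Fin N → X) → ℝ := fun x => ∑ a, P (Fin.snoc (α := fun _ => X) x a) with hM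
    have hM0 : ∀ x, 0 ≤ M x := fun x => Finset.sum_nonneg fun _ _ => hP _
    have key := IsCausalKernel.append (N' := 1) (Y := Y) (ih hM0 (by rw [← hP1, hsum]))
      (q' := fun x _ x' _ => if M x = 0 then (Fintype.card X : ℝ)⁻¹ else
        P (Fin.snoc (α := fun _ => X) x (x' 0)) / M x) fun x y =>
        ⟨fun _ _ _ a => if M x = 0 then (Fintype.card X : ℝ)⁻¹ else
        P (Fin.snoc (α := fun _ => X) x a) / M x, fun _ _ _ _ _ _ => rfl, fun _ _ _ => ⟨fun a => by
          split_ifs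
          · positivity
          · exact div_nonneg (hP _) (hM0 _), by
          split_ifs with h
          · simp
          · rw [← Finset.sum_div, div_self h]⟩, fun x' y' => by simp⟩
    convert key using 3 with x y
    have e : Fin.snoc (α := fun _ => X) (fun i : Fin N => x (Fin.castAdd 1 i))
        (x (Fin.natAdd N 0)) = x := Fin.snoc_init_self x
    rw [e]
    split_ifs with h
    · rw [h, zero_mul]
      refine le_antisymm ?_ (hP x)
      calc P x = P (Fin.snoc (α := fun _ => X) (fun i : Fin N => x (Fin.castAdd 1 i))
            (x (Fin.natAdd N 0))) := by rw [e]
        _ ≤ M fun i => x (Fin.castAdd 1 i) := Finset.single_le_sum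
            (f := fun a => P (Fin.snoc (α := fun _ => X) (fun i => x (Fin.castAdd 1 i)) a))
            (fun a _ => hP _) (Finset.mem_univ _)
        _ = 0 := h
    · rw [mul_div_cancel₀ _ h]

end Causal

section HasCode

/-- The law of the observations of the users and the eavesdropper for adaptive encoders. -/
def codeLaw {S1 C S2 X1 X2 Y1 Y2 Z : Type*} {N : ℕ} (W : X1 → X2 → Y1 × Y2 × Z → ℝ)
    (q1 : S1 → C → (Fin N → X1) → (Fin N → Y1) → ℝ) (q2 : S2 → (Fin N → X2) → (Fin N → Y2) → ℝ)
    (s1 : S1) (c : C) (s2 : S2) (h1 : (Fin N → X1) × (Fin N → Y1))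
    (h2 : (Fin N → X2) × (Fin N → Y2)) (z : Fin N → Z) : ℝ :=
  q1 s1 c h1.1 h1.2 * q2 s2 h2.1 h2.2 * ∏ k, W (h1.1 k) (h2.1 k) (h1.2 k, h2.2 k, z k)

/-- `W` admits an `ε`-good adaptive code of length `N` with `l1` messages and `c` shared keys for
user 1, with `l2` messages for user 2, which generates a key with `k` values. -/
def HasCode (W : X1 → X2 → Y1 × Y2 × Z → ℝ) (N l1 c l2 k : ℕ) (ε : ℝ) : Prop :=
  (0 < l1 ∧ 0 < c ∧ 0 < l2 ∧ 0 < k) ∧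
  ∃ (q1 : Fin l1 → Fin c → (Fin N → X1) → (Fin N → Y1) → ℝ)
    (q2 : Fin l2 → (Fin N → X2) → (Fin N → Y2) → ℝ),
    (∀ s c, IsCausalKernel N (q1 s c)) ∧ (∀ s, IsCausalKernel N (q2 s)) ∧
    IsGood (Fin k) (codeLaw W q1 q2) ε

variable {W : X1 → X2 → Y1 × Y2 × Z → ℝ} {N l1 c l2 k N' l1' l2' k' : ℕ} {ε ε' : ℝ}

lemma HasCode.mono (h : HasCode W N l1 c l2 k ε) (hε : ε ≤ ε') : HasCode W N l1 c l2 k ε' := by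
  obtain ⟨hp, q1, q2, h1, h2, hg⟩ := h
  exact ⟨hp, q1, q2, h1, h2, hg.mono hε⟩

lemma HasCode.forget (h : HasCode W N l1 c l2 k ε) : HasCode W N l1 c l2 1 ε := by
  obtain ⟨hp, q1, q2, h1, h2, hg⟩ := h
  have : NeZero k := ⟨hp.2.2.2.ne'⟩
  exact ⟨⟨hp.1, hp.2.1, hp.2.2.1, one_pos⟩, q1, q2, h1, h2, hg.forget⟩

/-- The channel with the roles of the users exchanged. -/
def swapChannel {X1 X2 Y1 Y2 Z : Type*} (W : X1 → X2 → Y1 × Y2 × Z → ℝ) :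
    X2 → X1 → Y2 × Y1 × Z → ℝ :=
  fun x2 x1 y => W x1 x2 (y.2.1, y.1, y.2.2)

lemma HasCode.swap (h : HasCode W N l1 1 l2 1 ε) : HasCode (swapChannel W) N l2 1 l1 1 ε := by
  obtain ⟨hp, q1, q2, h1, h2, hg⟩ := h
  refine ⟨⟨hp.2.2.1, one_pos, hp.1, one_pos⟩, fun s _ => q2 s, fun s => q1 s default,
    fun s _ => h2 s, fun s => h1 s _, ?_⟩
  convert hg.swap using 7 with s2 _ s1 x y z
  simp only [codeLaw, swapChannel, mul_comm]

/-- Splitting the input and output sequences of a user. -/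
def splitEquiv (X Y : Type*) (N N' : ℕ) : (Fin (N + N') → X) × (Fin (N + N') → Y) ≃
    ((Fin N → X) × (Fin N → Y)) × (Fin N' → X) × (Fin N' → Y) :=
  ((Fin.appendEquiv N N').symm.prodCongr (Fin.appendEquiv N N').symm).trans
    (Equiv.prodProdProdComm _ _ _ _)

/-- Two codes can be used one after the other, the key generated by the first one being used by
the second one, partly as a key and partly to encrypt messages. -/
lemma HasCode.comp (h : HasCode W N l1 c l2 k ε) (h' : HasCode W N' l1' k l2' k' ε') :
    HasCode W (N + N') (l1 * (l1' * k)) c (l2 * l2') k' (ε + ε') := by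
  obtain ⟨⟨p1, p2, p3, p4⟩, q1, q2, h1, h2, hg⟩ := h
  obtain ⟨⟨p1', p2', p3', p4'⟩, q1', q2', h1', h2', hg'⟩ := h'
  have : NeZero k := ⟨p4.ne'⟩
  have : NeZero l1 := ⟨p1.ne'⟩
  have : NeZero c := ⟨p2.ne'⟩
  have : NeZero l2 := ⟨p3.ne'⟩
  have : NeZero l1' := ⟨p1'.ne'⟩
  have : NeZero l2' := ⟨p3'.ne'⟩
  obtain ⟨g, hG⟩ := hg.comp hg'
  set σ1 : Fin (l1 * (l1' * k)) ≃ Fin l1 × Fin l1' × Fin k :=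
    finProdFinEquiv.symm.trans ((Equiv.refl _).prodCongr finProdFinEquiv.symm) with hσ1
  set σ2 : Fin (l2 * l2') ≃ Fin l2 × Fin l2' := finProdFinEquiv.symm with hσ2
  have hG' := hG.map σ1 (Equiv.refl _) σ2 (Equiv.refl _) (splitEquiv X1 Y1 N N')
    (splitEquiv X2 Y2 N N') (Fin.appendEquiv N N').symm
  refine ⟨⟨by positivity, p2, by positivity, p4'⟩,
    fun s c x y => q1 (σ1 s).1 c (fun i => x (Fin.castAdd N' i)) (fun i => y (Fin.castAdd N' i)) *
      q1' (σ1 s).2.1 ((σ1 s).2.2 + g (fun i => x (Fin.castAdd N' i), fun i => y (Fin.castAdd N' i)))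
        (fun i => x (Fin.natAdd N i)) (fun i => y (Fin.natAdd N i)),
    fun s x y => q2 (σ2 s).1 (fun i => x (Fin.castAdd N' i)) (fun i => y (Fin.castAdd N' i)) *
      q2' (σ2 s).2 (fun i => x (Fin.natAdd N i)) (fun i => y (Fin.natAdd N i)),
    fun s c => ?_, fun s => ?_, ?_⟩
  · exact IsCausalKernel.append (h1 _ _)
      (q' := fun x y => q1' (σ1 s).2.1 ((σ1 s).2.2 + g (x, y))) fun x y => h1' _ _
  · exact IsCausalKernel.append (h2 _) (q' := fun x y => q2' (σ2 s).2) fun x y => h2' _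
  · convert hG' using 1
    funext s c t x y z
    simp only [codeLaw, Fin.prod_univ_add]
    simp only [splitEquiv, Equiv.trans_apply, Equiv.prodCongr_apply, Prod.map,
      Equiv.prodProdProdComm_apply, Fin.appendEquiv_symm_apply, Equiv.refl_apply]
    ring

end HasCode

section BlockLaw

lemma sum_pi_prod {n : ℕ} {A : Type*} [Fintype A] (F : Fin n → A → ℝ) :
    ∑ a : Fin n → A, ∏ k, F k (a k) = ∏ k, ∑ a, F k a := by
  rw [Finset.prod_univ_sum, Fintype.piFinset_univ]

/-- The law of inputs and outputs over `n` uses of the channel, given the auxiliary sequences. -/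
def blockLaw {V1 V2 X1 X2 Y1 Y2 Z : Type*} {n : ℕ} (PX1 : V1 → X1 → ℝ) (PX2 : V2 → X2 → ℝ)
    (W : X1 → X2 → Y1 × Y2 × Z → ℝ) (u : Fin n → V1) (v : Fin n → V2)
    (h1 : (Fin n → X1) × (Fin n → Y1)) (h2 : (Fin n → X2) × (Fin n → Y2)) (z : Fin n → Z) : ℝ :=
  ∏ k, PX1 (u k) (h1.1 k) * PX2 (v k) (h2.1 k) * W (h1.1 k) (h2.1 k) (h1.2 k, h2.2 k, z k)

variable {n : ℕ} {W : X1 → X2 → Y1 × Y2 × Z → ℝ} {PX1 : V1 → X1 → ℝ} {PX2 : V2 → X2 → ℝ}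

omit [Fintype V1] [Fintype V2] [Fintype X1] [Fintype X2] [Fintype Y1] [Fintype Y2] [Fintype Z] in
lemma blockLaw_nonneg (hW : ∀ x1 x2 y, 0 ≤ W x1 x2 y) (h1 : ∀ u x, 0 ≤ PX1 u x)
    (h2 : ∀ v x, 0 ≤ PX2 v x) (u : Fin n → V1) (v : Fin n → V2)
    (a : (Fin n → X1) × (Fin n → Y1)) (b : (Fin n → X2) × (Fin n → Y2)) (z : Fin n → Z) :
    0 ≤ blockLaw PX1 PX2 W u v a b z :=
  Finset.prod_nonneg fun _ _ => mul_nonneg (mul_nonneg (h1 _ _) (h2 _ _)) (hW _ _ _)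

omit [Fintype V1] [Fintype V2] [Fintype X1] [Fintype X2] [Fintype Y1] [Fintype Y2] in
lemma sum_blockLaw_z (u : Fin n → V1) (v : Fin n → V2) (a : (Fin n → X1) × (Fin n → Y1))
    (b : (Fin n → X2) × (Fin n → Y2)) : ∑ z, blockLaw PX1 PX2 W u v a b z =
      ∏ k, ∑ z, PX1 (u k) (a.1 k) * PX2 (v k) (b.1 k) * W (a.1 k) (b.1 k) (a.2 k, b.2 k, z) :=
  sum_pi_prod fun k z =>
    PX1 (u k) (a.1 k) * PX2 (v k) (b.1 k) * W (a.1 k) (b.1 k) (a.2 k, b.2 k, z)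

lemma sum_pi_pair_prod {A B : Type*} [Fintype A] [Fintype B] (F : Fin n → A → B → ℝ) :
    ∑ h : (Fin n → A) × (Fin n → B), ∏ k, F k (h.1 k) (h.2 k) = ∏ k, ∑ x : A × B, F k x.1 x.2 := by
  rw [Fintype.sum_prod_type]
  simp_rw [Fintype.sum_prod_type]
  rw [← sum_pi_prod]
  exact Finset.sum_congr rfl fun x _ => sum_pi_prod fun k => F k (x k)

/-- The law of a single use of the channel, given the auxiliary symbols. -/
def letterLaw {V1 V2 X1 X2 Y1 Y2 Z : Type*} (PX1 : V1 → X1 → ℝ) (PX2 : V2 → X2 → ℝ)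
    (W : X1 → X2 → Y1 × Y2 × Z → ℝ) (u : V1) (v : V2) (h1 : X1 × Y1) (h2 : X2 × Y2) (z : Z) : ℝ :=
  PX1 u h1.1 * PX2 v h2.1 * W h1.1 h2.1 (h1.2, h2.2, z)

omit [Fintype V1] [Fintype V2] in
lemma sum_letterLaw (hW1 : ∀ x1 x2, ∑ y, W x1 x2 y = 1) (h1 : ∀ u, ∑ x, PX1 u x = 1)
    (h2 : ∀ v, ∑ x, PX2 v x = 1) (u : V1) (v : V2) :
    ∑ a, ∑ b, ∑ z, letterLaw PX1 PX2 W u v a b z = 1 := by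
  have : ∀ x1 x2, ∑ y1, ∑ y2, ∑ z, W x1 x2 (y1, y2, z) = 1 := fun x1 x2 => by
    rw [← hW1 x1 x2, Fintype.sum_prod_type]
    simp_rw [Fintype.sum_prod_type]
  unfold letterLaw
  calc _ = ∑ x1, ∑ x2, PX1 u x1 * PX2 v x2 * ∑ y1, ∑ y2, ∑ z, W x1 x2 (y1, y2, z) := by
        simp_rw [Fintype.sum_prod_type, Finset.mul_sum]
        exact Finset.sum_congr rfl fun x1 _ => Finset.sum_comm
    _ = 1 := by
        simp_rw [this, mul_one, ← Finset.mul_sum, h2, mul_one, h1]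

omit [Fintype V1] [Fintype V2] in
lemma sum_blockLaw (hW1 : ∀ x1 x2, ∑ y, W x1 x2 y = 1) (h1 : ∀ u, ∑ x, PX1 u x = 1)
    (h2 : ∀ v, ∑ x, PX2 v x = 1) (u : Fin n → V1) (v : Fin n → V2) :
    ∑ a, ∑ b, ∑ z, blockLaw PX1 PX2 W u v a b z = 1 := by
  have e : ∀ (a : (Fin n → X1) × (Fin n → Y1)), ∑ b, ∑ z, blockLaw PX1 PX2 W u v a b z =
      ∏ k, ∑ b, ∑ z, letterLaw PX1 PX2 W (u k) (v k) (a.1 k, a.2 k) b z := fun a => by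
    simp_rw [sum_blockLaw_z]
    exact sum_pi_pair_prod fun k x y => ∑ z,
      letterLaw PX1 PX2 W (u k) (v k) (a.1 k, a.2 k) (x, y) z
  simp_rw [e]
  rw [sum_pi_pair_prod fun k x y => ∑ b, ∑ z, letterLaw PX1 PX2 W (u k) (v k) (x, y) b z]
  exact Finset.prod_eq_one fun k _ => sum_letterLaw hW1 h1 h2 (u k) (v k)

omit [Fintype V1] [Fintype V2] in
/-- A code that is good for random codebooks with prefixing yields an adaptive code. -/
lemma hasCode_of_isGood_mixtureLaw {l1 c l2 k : ℕ} {R1 R2 : Type*} [Fintype R1] [Fintype R2]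
    [Nonempty R1] [Nonempty R2]
    (h1 : ∀ u x, 0 ≤ PX1 u x) (h1' : ∀ u, ∑ x, PX1 u x = 1)
    (h2 : ∀ v x, 0 ≤ PX2 v x) (h2' : ∀ v, ∑ x, PX2 v x = 1) {ε : ℝ}
    (hp : 0 < l1 ∧ 0 < c ∧ 0 < l2 ∧ 0 < k)
    {f : Fin l1 × Fin c × R1 → Fin n → V1} {g : Fin l2 × Fin k × R2 → Fin n → V2}
    (h : IsGood (Fin k) (mixtureLaw (blockLaw PX1 PX2 W) f g) ε) : HasCode W n l1 c l2 k ε := by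
  have : NeZero k := ⟨hp.2.2.2.ne'⟩
  refine ⟨hp, fun s c x _ => 𝔼 r, ∏ k, PX1 (f (s, c, r) k) (x k),
    fun s x _ => 𝔼 k, 𝔼 r, ∏ i, PX2 (g (s, k, r) i) (x i), fun s c => ?_, fun s => ?_, ?_⟩
  · refine isCausalKernel_of_pmf n (fun x => Finset.expect_nonneg fun _ _ =>
      Finset.prod_nonneg fun _ _ => h1 _ _) ?_
    rw [← Finset.expect_sum_comm]
    simp_rw [sum_pi_prod fun k => PX1 (f (s, c, _) k), h1', Finset.prod_const_one]
    exact Fintype.expect_const _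
  · refine isCausalKernel_of_pmf n (fun x => Finset.expect_nonneg fun _ _ =>
      Finset.expect_nonneg fun _ _ => Finset.prod_nonneg fun _ _ => h2 _ _) ?_
    simp_rw [← Finset.expect_sum_comm]
    simp_rw [sum_pi_prod fun i => PX2 (g (s, _, _) i), h2', Finset.prod_const_one]
    simp only [Fintype.expect_const]
  · convert h using 1
    funext s c t a b z
    simp only [codeLaw, mixtureLaw, blockLaw, Finset.prod_mul_distrib, ← Finset.expect_mul,
      ← Finset.mul_expect]

lemma IsGood.of_unique {S1 C S2 K H1 H2 : Type*} [Fintype S1] [Fintype C] [Fintype S2] [Fintype K]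
    [Fintype H1] [Fintype H2] [Unique S1] [Unique C] [Unique S2] [Unique K]
    {p : S1 → C → S2 → H1 → H2 → Z → ℝ} (h0 : ∀ s1 c s2 h1 h2 z, 0 ≤ p s1 c s2 h1 h2 z)
    (h1 : ∀ s1 c s2, ∑ h1, ∑ h2, ∑ z, p s1 c s2 h1 h2 z = 1) : IsGood K p 0 := by
  refine ⟨h0, h1, default, default, default, default,
    fun z => ∑ h1, ∑ h2, p default default default h1 h2 z,
    fun z => Finset.sum_nonneg fun _ _ => Finset.sum_nonneg fun _ _ => h0 .., ?_, ?_, ?_, ?_⟩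
  · rw [← h1 default default default, Finset.sum_comm]
    exact Finset.sum_congr rfl fun _ _ => Finset.sum_comm
  · simp_rw [expect_default]
    refine (Finset.sum_eq_zero fun x _ => Finset.sum_eq_zero fun y _ =>
      Finset.sum_eq_zero fun z _ => ?_).le
    rw [if_pos ⟨Subsingleton.elim _ _, Subsingleton.elim _ _, Subsingleton.elim _ _⟩, mul_zero]
  · simp_rw [expect_default]
    refine (Finset.sum_eq_zero fun z _ => ?_).le
    rw [Fintype.sum_unique, Fintype.card_unique, Nat.cast_one, div_one, abs_eq_zero, sub_eq_zero]
    refine Finset.sum_congr rfl fun x _ => Finset.sum_congr rfl fun y _ => ?_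
    rw [if_pos (Subsingleton.elim _ _), mul_one]
  · simp_rw [expect_default]
    simp

/-- Random inputs convey nothing. -/
lemma hasCode_one [Nonempty X1] [Nonempty X2] (hW : ∀ x1 x2 y, 0 ≤ W x1 x2 y)
    (hW1 : ∀ x1 x2, ∑ y, W x1 x2 y = 1) (N : ℕ) : HasCode W N 1 1 1 1 0 := by
  set U1 : Unit → X1 → ℝ := fun _ _ => (Fintype.card X1 : ℝ)⁻¹ with hU1
  set U2 : Unit → X2 → ℝ := fun _ _ => (Fintype.card X2 : ℝ)⁻¹ with hU2
  have a1 : ∀ u x, 0 ≤ U1 u x := fun _ _ => by simp [hU1]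
  have a2 : ∀ u x, 0 ≤ U2 u x := fun _ _ => by simp [hU2]
  have b1 : ∀ u, ∑ x, U1 u x = 1 := fun _ => by simp [hU1]
  have b2 : ∀ u, ∑ x, U2 u x = 1 := fun _ => by simp [hU2]
  refine hasCode_of_isGood_mixtureLaw (R1 := Unit) (R2 := Unit) (f := fun _ _ => ())
    (g := fun _ _ => ()) a1 b1 a2 b2 (by simp) (IsGood.of_unique ?_ ?_)
  · exact fun s1 c s2 x y z => Finset.expect_nonneg fun _ _ => Finset.expect_nonneg fun _ _ =>
      Finset.expect_nonneg fun _ _ => blockLaw_nonneg hW a1 a2 _ _ _ _ _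
  · intro s1 c s2
    simp only [mixtureLaw, expect_default]
    exact sum_blockLaw hW1 b1 b2 _ _

end BlockLaw

section Tilted

variable {A D : Type*} [Fintype A] [Fintype D]

/-- Tilted sums are invariant under relabelling. -/
lemma tilted_equiv {A' D' : Type*} [Fintype A'] [Fintype D'] (eA : A' ≃ A) (eD : D' ≃ D)
    (P : A → ℝ) (U : A → D → ℝ) (t : ℝ) :
    tilted (fun a => P (eA a)) (fun a d => U (eA a) (eD d)) t = tilted P U t := by
  unfold tilted
  refine Fintype.sum_equiv eA _ _ fun a => ?_
  congr 1
  refine Fintype.sum_equiv eD _ _ fun d => ?_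
  rw [eA.sum_comp fun a' => P a' * U a' (eD d)]

/-- Tilted sums of product laws are powers. -/
lemma tilted_pi {n : ℕ} {P : A → ℝ} {U : A → D → ℝ} (hP : ∀ a, 0 ≤ P a) (hU : ∀ a d, 0 ≤ U a d)
    (t : ℝ) : tilted (fun a : Fin n → A => ∏ k, P (a k))
      (fun a (d : Fin n → D) => ∏ k, U (a k) (d k)) t = tilted P U t ^ n := by
  unfold tilted
  have e : ∀ d : Fin n → D, ∑ a : Fin n → A, (∏ k, P (a k)) * ∏ k, U (a k) (d k) =
      ∏ k, ∑ a, P a * U a (d k) := fun d => by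
    simp_rw [← Finset.prod_mul_distrib]
    exact sum_pi_prod fun k a => P a * U a (d k)
  simp_rw [e, ← Finset.prod_div_distrib]
  simp_rw [← Real.finsetProd_rpow _ _ (fun k _ =>
    div_nonneg (hU _ _) (Finset.sum_nonneg fun a _ => mul_nonneg (hP a) (hU a _))),
    ← Finset.prod_mul_distrib]
  simp_rw [fun a : Fin n → A => sum_pi_prod fun k d =>
    U (a k) d * (U (a k) d / ∑ a', P a' * U a' d) ^ t, ← Finset.prod_mul_distrib]
  rw [sum_pi_prod fun k a => P a * ∑ d, U a d * (U a d / ∑ a', P a' * U a' d) ^ t]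
  simp

/-- The mutual information between the input, distributed according to `P`, and the output of
the channel `U`. -/
def info (P : A → ℝ) (U : A → D → ℝ) : ℝ :=
  ∑ a, P a * ∑ d, U a d * Real.log (U a d / ∑ a', P a' * U a' d)

variable {P : A → ℝ} {U : A → D → ℝ}

lemma tilted_zero (hP1 : ∑ a, P a = 1) (hU1 : ∀ a, ∑ d, U a d = 1) : tilted P U 0 = 1 := by
  unfold tilted
  simp [hU1, hP1]

lemma hasDerivAt_tilted (hP : ∀ a, 0 ≤ P a) (hU : ∀ a d, 0 ≤ U a d) :
    HasDerivAt (tilted P U) (info P U) 0 := by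
  unfold tilted info
  simp_rw [Finset.mul_sum]
  refine HasDerivAt.fun_sum fun a _ => HasDerivAt.fun_sum fun d _ => ?_
  rcases (hP a).eq_or_lt with h | h
  · simp only [← h, zero_mul]
    exact hasDerivAt_const ..
  rcases (hU a d).eq_or_lt with h' | h'
  · simp only [← h', zero_mul, mul_zero]
    exact hasDerivAt_const ..
  have h0 : 0 < U a d / ∑ a', P a' * U a' d := div_pos h' (lt_of_lt_of_le (mul_pos h h')
    (Finset.single_le_sum (f := fun a' => P a' * U a' d)
      (fun a' _ => mul_nonneg (hP a') (hU a' d)) (Finset.mem_univ a)))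
  have := ((Real.hasStrictDerivAt_const_rpow h0 0).hasDerivAt.const_mul (U a d)).const_mul (P a)
  simpa using this

lemma exists_pos_lt_one_of_deriv_neg {f : ℝ → ℝ} {f' : ℝ} (h : HasDerivAt f f' 0) (h0 : f 0 = 1)
    (hf' : f' < 0) : ∃ s, 0 < s ∧ s ≤ 1 ∧ f s < 1 := by
  have h1 : ∀ᶠ s in nhdsWithin (0 : ℝ) (Set.Ioi 0), slope f 0 s < 0 :=
    (hasDerivAt_iff_tendsto_slope.1 h |>.mono_left
      (nhdsWithin_mono _ fun x hx => ne_of_gt hx)).eventually (gt_mem_nhds hf')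
  have h2 : ∀ᶠ s in nhdsWithin (0 : ℝ) (Set.Ioi 0), s ∈ Set.Ioc (0 : ℝ) 1 :=
    Ioc_mem_nhdsGT one_pos
  obtain ⟨s, hs, hs'⟩ := (h1.and h2).exists
  refine ⟨s, hs'.1, hs'.2, ?_⟩
  rw [slope_def_field, sub_zero, div_neg_iff] at hs
  rcases hs with hs | hs
  · exact absurd hs.2 (not_lt.2 hs'.1.le)
  · linarith

lemma exists_tilted_lt_one (hP : ∀ a, 0 ≤ P a) (hP1 : ∑ a, P a = 1) (hU : ∀ a d, 0 ≤ U a d)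
    (hU1 : ∀ a, ∑ d, U a d = 1) {R : ℝ} (hR : info P U < R) :
    ∃ s, 0 < s ∧ s ≤ 1 ∧ Real.exp (-s * R) * tilted P U s < 1 := by
  have h := ((((hasDerivAt_id (0 : ℝ)).neg.mul_const R).exp).mul (hasDerivAt_tilted hP hU))
  refine exists_pos_lt_one_of_deriv_neg (f := fun s => Real.exp (-s * R) * tilted P U s)
    h (by simp [tilted_zero hP1 hU1]) ?_
  simp [tilted_zero hP1 hU1]
  linarith

lemma exists_tilted_neg_lt_one (hP : ∀ a, 0 ≤ P a) (hP1 : ∑ a, P a = 1) (hU : ∀ a d, 0 ≤ U a d)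
    (hU1 : ∀ a, ∑ d, U a d = 1) {R : ℝ} (hR : R < info P U) :
    ∃ s, 0 < s ∧ s ≤ 1 ∧ Real.exp (s * R) * tilted P U (-s) < 1 := by
  have h1 : HasDerivAt (fun s => tilted P U (-s)) (-info P U) 0 := by
    have := HasDerivAt.scomp (0 : ℝ) (g₁ := tilted P U) (h := fun s => -s) (h' := -1)
      (by simpa using hasDerivAt_tilted hP hU) (hasDerivAt_neg 0)
    rw [neg_one_smul] at this
    exact this
  have h := ((((hasDerivAt_id (0 : ℝ)).mul_const R).exp).mul h1)
  refine exists_pos_lt_one_of_deriv_neg (f := fun s => Real.exp (s * R) * tilted P U (-s))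
    h (by simp [tilted_zero hP1 hU1]) ?_
  simp [tilted_zero hP1 hU1]
  linarith

end Tilted

section Tensorization

/-- The law of a sequence of independent letters. -/
def piLaw {A : Type*} {n : ℕ} (P : A → ℝ) (a : Fin n → A) : ℝ := ∏ k, P (a k)

lemma piLaw_nonneg {A : Type*} {n : ℕ} {P : A → ℝ} (hP : ∀ a, 0 ≤ P a) (a : Fin n → A) :
    0 ≤ piLaw P a :=
  Finset.prod_nonneg fun _ _ => hP _

lemma sum_piLaw {A : Type*} [Fintype A] {n : ℕ} {P : A → ℝ} (hP : ∑ a, P a = 1) :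
    ∑ a : Fin n → A, piLaw P a = 1 := by
  unfold piLaw
  rw [sum_pi_prod fun _ => P]
  simp [hP]

/-- The channel from the codewords to the eavesdropper. -/
def wire {V1 V2 H1 H2 Z : Type*} [Fintype H1] [Fintype H2] (T : V1 → V2 → H1 → H2 → Z → ℝ)
    (u : V1) (v : V2) (z : Z) : ℝ :=
  ∑ h1, ∑ h2, T u v h1 h2 z

section Tripartite

variable {H1 H2 : Type*} [Fintype H1] [Fintype H2] {P1 : V1 → ℝ} {P2 : V2 → ℝ}
  {T : V1 → V2 → H1 → H2 → Z → ℝ}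

omit [Fintype V1] [Fintype V2] [Fintype Z] in
lemma wire_nonneg (hT : ∀ u v a b z, 0 ≤ T u v a b z) (u : V1) (v : V2) (z : Z) :
    0 ≤ wire T u v z :=
  Finset.sum_nonneg fun _ _ => Finset.sum_nonneg fun _ _ => hT ..

omit [Fintype V1] [Fintype V2] in
lemma sum_wire (hT : ∀ u v, ∑ a, ∑ b, ∑ z, T u v a b z = 1) (u : V1) (v : V2) :
    ∑ z, wire T u v z = 1 := by
  unfold wire
  rw [← hT u v, Finset.sum_comm]
  exact Finset.sum_congr rfl fun _ _ => Finset.sum_comm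

omit [Fintype V1] [Fintype H2] in
lemma channel₁_nonneg (h2 : ∀ v, 0 ≤ P2 v) (hT : ∀ u v a b z, 0 ≤ T u v a b z) (u : V1) (b : H2) :
    0 ≤ channel₁ P2 T u b :=
  Finset.sum_nonneg fun _ _ => mul_nonneg (h2 _) (Finset.sum_nonneg fun _ _ =>
    Finset.sum_nonneg fun _ _ => hT ..)

omit [Fintype V2] [Fintype H1] in
lemma channel₂_nonneg (h1 : ∀ v, 0 ≤ P1 v) (hT : ∀ u v a b z, 0 ≤ T u v a b z) (v : V2) (a : H1) :
    0 ≤ channel₂ P1 T v a :=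
  Finset.sum_nonneg fun _ _ => mul_nonneg (h1 _) (Finset.sum_nonneg fun _ _ =>
    Finset.sum_nonneg fun _ _ => hT ..)

omit [Fintype V1] in
lemma sum_channel₁ (h2 : ∑ v, P2 v = 1) (hT : ∀ u v, ∑ a, ∑ b, ∑ z, T u v a b z = 1) (u : V1) :
    ∑ b, channel₁ P2 T u b = 1 := by
  unfold channel₁
  rw [Finset.sum_comm, ← h2]
  refine Finset.sum_congr rfl fun v _ => ?_
  rw [← Finset.mul_sum, Finset.sum_comm, hT, mul_one]

omit [Fintype V2] in
lemma sum_channel₂ (h1 : ∑ v, P1 v = 1) (hT : ∀ u v, ∑ a, ∑ b, ∑ z, T u v a b z = 1) (v : V2) :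
    ∑ a, channel₂ P1 T v a = 1 := by
  unfold channel₂
  rw [Finset.sum_comm, ← h1]
  refine Finset.sum_congr rfl fun u _ => ?_
  rw [← Finset.mul_sum, hT, mul_one]

end Tripartite

variable {n : ℕ} {W : X1 → X2 → Y1 × Y2 × Z → ℝ} {P1 : V1 → ℝ} {P2 : V2 → ℝ}
  {PX1 : V1 → X1 → ℝ} {PX2 : V2 → X2 → ℝ}

omit [Fintype V1] [Fintype V2] [Fintype X1] [Fintype Y1] in
lemma sum_sum_blockLaw (u : Fin n → V1) (v : Fin n → V2) (a : (Fin n → X1) × (Fin n → Y1)) :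
    ∑ b, ∑ z, blockLaw PX1 PX2 W u v a b z =
      ∏ k, ∑ b, ∑ z, letterLaw PX1 PX2 W (u k) (v k) (a.1 k, a.2 k) b z := by
  simp_rw [sum_blockLaw_z]
  exact sum_pi_pair_prod fun k x y => ∑ z,
    letterLaw PX1 PX2 W (u k) (v k) (a.1 k, a.2 k) (x, y) z

omit [Fintype V1] [Fintype V2] [Fintype X2] [Fintype Y2] in
lemma sum_sum_blockLaw' (u : Fin n → V1) (v : Fin n → V2) (b : (Fin n → X2) × (Fin n → Y2)) :
    ∑ a, ∑ z, blockLaw PX1 PX2 W u v a b z =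
      ∏ k, ∑ a, ∑ z, letterLaw PX1 PX2 W (u k) (v k) a (b.1 k, b.2 k) z := by
  simp_rw [sum_blockLaw_z]
  exact sum_pi_pair_prod fun k x y => ∑ z,
    letterLaw PX1 PX2 W (u k) (v k) (x, y) (b.1 k, b.2 k) z

omit [Fintype V1] [Fintype V2] [Fintype Z] in
lemma wire_blockLaw (u : Fin n → V1) (v : Fin n → V2) (z : Fin n → Z) :
    wire (blockLaw PX1 PX2 W) u v z = ∏ k, wire (letterLaw PX1 PX2 W) (u k) (v k) (z k) := by
  unfold wire
  have e : ∀ a : (Fin n → X1) × (Fin n → Y1), ∑ b, blockLaw PX1 PX2 W u v a b z =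
      ∏ k, ∑ b, letterLaw PX1 PX2 W (u k) (v k) (a.1 k, a.2 k) b (z k) := fun a =>
    sum_pi_pair_prod fun k x y => letterLaw PX1 PX2 W (u k) (v k) (a.1 k, a.2 k) (x, y) (z k)
  simp_rw [e]
  exact sum_pi_pair_prod fun k x y => ∑ b, letterLaw PX1 PX2 W (u k) (v k) (x, y) b (z k)

lemma sum_piLaw_mul {A : Type*} [Fintype A] (P : A → ℝ) (F : Fin n → A → ℝ) :
    ∑ a : Fin n → A, piLaw P a * ∏ k, F k (a k) = ∏ k, ∑ a, P a * F k a := by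
  unfold piLaw
  simp_rw [← Finset.prod_mul_distrib]
  exact sum_pi_prod fun k a => P a * F k a

lemma tilted_block₁ (h1 : ∀ v, 0 ≤ P1 v) (h2 : ∀ v, 0 ≤ P2 v)
    (hT : ∀ u v a b z, 0 ≤ letterLaw PX1 PX2 W u v a b z) (t : ℝ) :
    tilted (piLaw P1) (channel₁ (piLaw P2) (blockLaw (n := n) PX1 PX2 W)) t =
      tilted P1 (channel₁ P2 (letterLaw PX1 PX2 W)) t ^ n := by
  rw [← tilted_pi h1 (channel₁_nonneg h2 hT),
    ← tilted_equiv (Equiv.refl _) (Equiv.arrowProdEquivProdArrow (Fin n) (fun _ => X2)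
      (fun _ => Y2)).symm]
  congr 1
  funext u b
  unfold channel₁
  simp_rw [sum_sum_blockLaw']
  exact sum_piLaw_mul P2 fun k v =>
    ∑ a, ∑ z, letterLaw PX1 PX2 W (u k) v a (b.1 k, b.2 k) z

lemma tilted_block₂ (h1 : ∀ v, 0 ≤ P1 v) (h2 : ∀ v, 0 ≤ P2 v)
    (hT : ∀ u v a b z, 0 ≤ letterLaw PX1 PX2 W u v a b z) (t : ℝ) :
    tilted (piLaw P2) (channel₂ (piLaw P1) (blockLaw (n := n) PX1 PX2 W)) t =
      tilted P2 (channel₂ P1 (letterLaw PX1 PX2 W)) t ^ n := by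
  rw [← tilted_pi h2 (channel₂_nonneg h1 hT),
    ← tilted_equiv (Equiv.refl _) (Equiv.arrowProdEquivProdArrow (Fin n) (fun _ => X1)
      (fun _ => Y1)).symm]
  congr 1
  funext u b
  unfold channel₂
  simp_rw [sum_sum_blockLaw]
  exact sum_piLaw_mul P1 fun k v =>
    ∑ a, ∑ z, letterLaw PX1 PX2 W v (u k) (b.1 k, b.2 k) a z

lemma tilted_wire₁ (h1 : ∀ v, 0 ≤ P1 v) (h2 : ∀ v, 0 ≤ P2 v)
    (hT : ∀ u v a b z, 0 ≤ letterLaw PX1 PX2 W u v a b z) (t : ℝ) :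
    tilted (piLaw P1) (fun u z => ∑ v, piLaw P2 v * wire (blockLaw (n := n) PX1 PX2 W) u v z) t =
      tilted P1 (fun u z => ∑ v, P2 v * wire (letterLaw PX1 PX2 W) u v z) t ^ n := by
  rw [← tilted_pi h1 fun u z => Finset.sum_nonneg fun v _ => mul_nonneg (h2 v)
    (wire_nonneg hT u v z)]
  congr 1
  funext u b
  simp_rw [wire_blockLaw]
  exact sum_piLaw_mul P2 fun k v => wire (letterLaw PX1 PX2 W) (u k) v (b k)

lemma tilted_wire₂ (h1 : ∀ v, 0 ≤ P1 v) (h2 : ∀ v, 0 ≤ P2 v)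
    (hT : ∀ u v a b z, 0 ≤ letterLaw PX1 PX2 W u v a b z) (t : ℝ) :
    tilted (piLaw P2) (fun v z => ∑ u, piLaw P1 u * wire (blockLaw (n := n) PX1 PX2 W) u v z) t =
      tilted P2 (fun v z => ∑ u, P1 u * wire (letterLaw PX1 PX2 W) u v z) t ^ n := by
  rw [← tilted_pi h2 fun v z => Finset.sum_nonneg fun u _ => mul_nonneg (h1 u)
    (wire_nonneg hT u v z)]
  congr 1
  funext u b
  simp_rw [wire_blockLaw]
  exact sum_piLaw_mul P1 fun k v => wire (letterLaw PX1 PX2 W) v (u k) (b k)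

lemma tilted_wire_pair (h1 : ∀ v, 0 ≤ P1 v) (h2 : ∀ v, 0 ≤ P2 v)
    (hT : ∀ u v a b z, 0 ≤ letterLaw PX1 PX2 W u v a b z) (t : ℝ) :
    tilted (fun a : (Fin n → V1) × (Fin n → V2) => piLaw P1 a.1 * piLaw P2 a.2)
      (fun a z => wire (blockLaw (n := n) PX1 PX2 W) a.1 a.2 z) t =
      tilted (fun a : V1 × V2 => P1 a.1 * P2 a.2)
        (fun a z => wire (letterLaw PX1 PX2 W) a.1 a.2 z) t ^ n := by
  rw [← tilted_pi (fun a : V1 × V2 => mul_nonneg (h1 a.1) (h2 a.2))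
    (fun a z => wire_nonneg hT a.1 a.2 z),
    ← tilted_equiv (Equiv.arrowProdEquivProdArrow (Fin n) (fun _ => V1)
      (fun _ => V2)).symm (Equiv.refl _)]
  congr 1
  · funext a
    exact Finset.prod_mul_distrib.symm
  · funext a z
    rw [wire_blockLaw]
    rfl

lemma tilted_wire_revealed (h1 : ∀ v, 0 ≤ P1 v) (h2 : ∀ v, 0 ≤ P2 v)
    (hT : ∀ u v a b z, 0 ≤ letterLaw PX1 PX2 W u v a b z) (t : ℝ) :
    tilted (piLaw P2) (fun v (a : (Fin n → V1) × (Fin n → Z)) =>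
      piLaw P1 a.1 * wire (blockLaw (n := n) PX1 PX2 W) a.1 v a.2) t =
      tilted P2 (fun v (a : V1 × Z) => P1 a.1 * wire (letterLaw PX1 PX2 W) a.1 v a.2) t ^ n := by
  rw [← tilted_pi h2 (fun v (a : V1 × Z) => mul_nonneg (h1 a.1) (wire_nonneg hT a.1 v a.2)),
    ← tilted_equiv (Equiv.refl _) (Equiv.arrowProdEquivProdArrow (Fin n) (fun _ => V1)
      (fun _ => Z)).symm]
  congr 1
  funext v a
  rw [wire_blockLaw]
  exact Finset.prod_mul_distrib.symm

end Tensorization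

section Block

lemma rpow_mul_pow_le {x R t ρ T : ℝ} {n : ℕ} (hx : 0 ≤ x) (hxR : x ≤ 8 * Real.exp (n * R))
    (ht : 0 < t) (ht1 : t ≤ 1) (hT : 0 ≤ T) (h : Real.exp (t * R) * T ≤ ρ) :
    x ^ t * T ^ n ≤ 8 * ρ ^ n := by
  have h8 : (8 : ℝ) ^ t ≤ 8 := by
    simpa using Real.rpow_le_rpow_of_exponent_le (by norm_num : (1 : ℝ) ≤ 8) ht1
  calc x ^ t * T ^ n ≤ (8 * Real.exp (n * R)) ^ t * T ^ n :=
        mul_le_mul_of_nonneg_right (Real.rpow_le_rpow hx hxR ht.le) (pow_nonneg hT n)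
    _ = 8 ^ t * (Real.exp (t * R) * T) ^ n := by
        rw [Real.mul_rpow (by norm_num) (Real.exp_pos _).le, ← Real.exp_mul, mul_pow,
          ← Real.exp_nat_mul]
        ring_nf
    _ ≤ 8 * ρ ^ n := mul_le_mul h8 (pow_le_pow_left₀ (by positivity) h n) (by positivity)
        (by norm_num)

lemma exp_rpow_neg_mul_pow_le {R s ρ T : ℝ} {n : ℕ} (hT : 0 ≤ T)
    (h : Real.exp (-s * R) * T ≤ ρ) : Real.exp (n * R) ^ (-s) * T ^ n ≤ ρ ^ n := by
  calc Real.exp (n * R) ^ (-s) * T ^ n = (Real.exp (-s * R) * T) ^ n := by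
        rw [← Real.exp_mul, mul_pow, ← Real.exp_nat_mul]
        ring_nf
    _ ≤ ρ ^ n := pow_le_pow_left₀ (by positivity) h n


variable {W : X1 → X2 → Y1 × Y2 × Z → ℝ} {P1 : V1 → ℝ} {P2 : V2 → ℝ}
  {PX1 : V1 → X1 → ℝ} {PX2 : V2 → X2 → ℝ}

/-- Random codebooks of length `n` yield a code as soon as, on average, they have small leakage. -/
lemma hasCode_of_leakage (hW : ∀ x1 x2 y, 0 ≤ W x1 x2 y) (hW1 : ∀ x1 x2, ∑ y, W x1 x2 y = 1)
    (h1 : ∀ u, 0 ≤ P1 u) (h1' : ∑ u, P1 u = 1) (h2 : ∀ v, 0 ≤ P2 v) (h2' : ∑ v, P2 v = 1)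
    (hX1 : ∀ u x, 0 ≤ PX1 u x) (hX1' : ∀ u, ∑ x, PX1 u x = 1)
    (hX2 : ∀ v x, 0 ≤ PX2 v x) (hX2' : ∀ v, ∑ x, PX2 v x = 1) {R s R' t ρ : ℝ}
    (hs : 0 < s) (hs1 : s ≤ 1) (ht : 0 < t) (ht1 : t ≤ 1)
    (hsρ : Real.exp (s * R) * tilted P1 (channel₁ P2 (letterLaw PX1 PX2 W)) (-s) ≤ ρ)
    (htρ : Real.exp (t * R') * tilted P2 (channel₂ P1 (letterLaw PX1 PX2 W)) (-t) ≤ ρ)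
    {n l1 c r1 l2 k r2 : ℕ} (hpos : (0 < l1 ∧ 0 < c ∧ 0 < l2 ∧ 0 < k) ∧ 0 < r1 ∧ 0 < r2)
    (hI : (l1 * c * r1 : ℝ) - 1 ≤ 8 * Real.exp (n * R))
    (hJ : (l2 * k * r2 : ℝ) - 1 ≤ 8 * Real.exp (n * R'))
    {Q : (Fin l1 × Fin c × Fin r1 → Fin n → V1) → (Fin n → Z) → ℝ} (hQ : ∀ f z, 0 ≤ Q f z)
    (hQ1 : ∀ f, ∑ z, Q f z = 1) {l : ℝ}
    (hl : codebookMean (piLaw P1) (fun f : Fin l1 × Fin c × Fin r1 → Fin n → V1 =>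
      codebookMean (piLaw P2) (fun g : Fin l2 × Fin k × Fin r2 → Fin n → V2 =>
        leakage (wire (blockLaw PX1 PX2 W)) (Q f) f g)) ≤ l) :
    HasCode W n l1 c l2 k (24 * ρ ^ n + l) := by
  obtain ⟨⟨p1, p2, p3, p4⟩, p5, p6⟩ := hpos
  have : NeZero l1 := ⟨p1.ne'⟩
  have : NeZero c := ⟨p2.ne'⟩
  have : NeZero l2 := ⟨p3.ne'⟩
  have : NeZero k := ⟨p4.ne'⟩
  have : NeZero r1 := ⟨p5.ne'⟩
  have : NeZero r2 := ⟨p6.ne'⟩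
  have hT : ∀ u v a b z, 0 ≤ letterLaw PX1 PX2 W u v a b z := fun u v a b z =>
    mul_nonneg (mul_nonneg (hX1 _ _) (hX2 _ _)) (hW _ _ _)
  obtain ⟨f, g, dec2, dec1, hfg⟩ := exists_codebooks (piLaw_nonneg h1) (sum_piLaw h1')
    (piLaw_nonneg h2) (sum_piLaw h2') (blockLaw_nonneg hW hX1 hX2) hs hs1 ht ht1 hl
  refine hasCode_of_isGood_mixtureLaw hX1 hX1' hX2 hX2' ⟨p1, p2, p3, p4⟩ (f := f) (g := g)
    (isGood_mixtureLaw (A := fun v b => ∏ k, PX2 (v k) (b.1 k))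
      (B := fun u a b z => ∏ k, PX1 (u k) (a.1 k) * W (a.1 k) (b.1 k) (a.2 k, b.2 k, z k))
      (fun _ _ => Finset.prod_nonneg fun _ _ => hX2 _ _)
      (fun _ _ _ _ => Finset.prod_nonneg fun _ _ => mul_nonneg (hX1 _ _) (hW _ _ _))
      (fun u v a b z => ?_) (sum_blockLaw hW1 hX1' hX2') f g dec2 dec1 (hQ f) (hQ1 f)
      (fun u v z => rfl) (le_trans (le_trans (le_of_eq ?_) hfg) ?_))
  · rw [← Finset.prod_mul_distrib]
    exact Finset.prod_congr rfl fun k _ => by ring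
  · rw [leakage, ← add_assoc]
    congr!
  · rw [tilted_block₁ h1 h2 hT, tilted_block₂ h1 h2 hT]
    simp only [Fintype.card_prod, Fintype.card_fin, Nat.cast_mul]
    have e1 := rpow_mul_pow_le (n := n) (x := (l1 * c * r1 : ℝ) - 1) (sub_nonneg.2 (by
      exact_mod_cast Nat.one_le_iff_ne_zero.2 (by positivity))) hI hs hs1
      (tilted_nonneg h1 (channel₁_nonneg h2 hT) _) hsρ
    have e2 := rpow_mul_pow_le (n := n) (x := (l2 * k * r2 : ℝ) - 1) (sub_nonneg.2 (by
      exact_mod_cast Nat.one_le_iff_ne_zero.2 (by positivity))) hJ ht ht1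
      (tilted_nonneg h2 (channel₂_nonneg h1 hT) _) htρ
    rw [mul_assoc] at e1 e2
    linarith

lemma exists_lt_one_forall {ι : Type*} [Finite ι] {a : ι → ℝ} (h : ∀ i, a i < 1) :
    ∃ ρ, 0 < ρ ∧ ρ < 1 ∧ ∀ i, a i ≤ ρ := by
  have : ∀ᶠ x in nhdsWithin (1 : ℝ) (Set.Iio 1), ∀ i, a i ≤ x :=
    Filter.eventually_all.2 fun i =>
      nhdsWithin_le_nhds ((lt_mem_nhds (h i)).mono fun _ => le_of_lt)
  obtain ⟨ρ, h1, h2⟩ := (this.and (Ioo_mem_nhdsLT (zero_lt_one' ℝ))).exists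
  exact ⟨ρ, h2.1, h2.2, h1⟩

lemma le_sqrt_pow {ρ : ℝ} (h0 : 0 < ρ) (h1 : ρ < 1) (n : ℕ) : ρ ^ n ≤ Real.sqrt ρ ^ n :=
  pow_le_pow_left₀ h0.le (by
    nth_rewrite 1 [← Real.mul_self_sqrt h0.le]
    exact mul_le_of_le_one_left (Real.sqrt_nonneg _) (Real.sqrt_le_one.2 h1.le)) n

lemma one_div_sqrt_pow_mul {ρ : ℝ} (h0 : 0 < ρ) (n : ℕ) :
    1 / Real.sqrt ρ ^ n * ρ ^ n = Real.sqrt ρ ^ n := by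
  have := Real.sqrt_pos.2 h0
  nth_rewrite 2 [← Real.mul_self_sqrt h0.le]
  rw [mul_pow]
  field_simp

/-- Block codes in which the codebooks of both users cover the output law. -/
lemma exists_hasCode (hW : ∀ x1 x2 y, 0 ≤ W x1 x2 y) (hW1 : ∀ x1 x2, ∑ y, W x1 x2 y = 1)
    (h1 : ∀ u, 0 ≤ P1 u) (h1' : ∑ u, P1 u = 1) (h2 : ∀ v, 0 ≤ P2 v) (h2' : ∑ v, P2 v = 1)
    (hX1 : ∀ u x, 0 ≤ PX1 u x) (hX1' : ∀ u, ∑ x, PX1 u x = 1)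
    (hX2 : ∀ v x, 0 ≤ PX2 v x) (hX2' : ∀ v, ∑ x, PX2 v x = 1) {A1 A2 B1 B2 B : ℝ}
    (hA1 : A1 < info P1 (channel₁ P2 (letterLaw PX1 PX2 W)))
    (hA2 : A2 < info P2 (channel₂ P1 (letterLaw PX1 PX2 W)))
    (hB1 : info P1 (fun u z => ∑ v, P2 v * wire (letterLaw PX1 PX2 W) u v z) < B1)
    (hB2 : info P2 (fun v z => ∑ u, P1 u * wire (letterLaw PX1 PX2 W) u v z) < B2)
    (hB : info (fun a : V1 × V2 => P1 a.1 * P2 a.2)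
      (fun a z => wire (letterLaw PX1 PX2 W) a.1 a.2 z) < B) :
    ∃ ρ, 0 < ρ ∧ ρ < 1 ∧ ∀ n l1 c r1 l2 k r2 : ℕ,
      (0 < l1 ∧ 0 < c ∧ 0 < l2 ∧ 0 < k) ∧ 0 < r1 ∧ 0 < r2 →
      (l1 * c * r1 : ℝ) - 1 ≤ 8 * Real.exp (n * A1) →
      (l2 * k * r2 : ℝ) - 1 ≤ 8 * Real.exp (n * A2) →
      Real.exp (n * B1) ≤ c * r1 → Real.exp (n * B2) ≤ l2 * r2 → Real.exp (n * B2) ≤ k * r2 →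
      Real.exp (n * B) ≤ c * r1 * (l2 * r2) → Real.exp (n * B) ≤ l1 * (c * r1) * (k * r2) →
      HasCode W n l1 c l2 k (32 * ρ ^ n) := by
  have hT : ∀ u v a b z, 0 ≤ letterLaw PX1 PX2 W u v a b z := fun u v a b z =>
    mul_nonneg (mul_nonneg (hX1 _ _) (hX2 _ _)) (hW _ _ _)
  have hT1 := sum_letterLaw (PX1 := PX1) (PX2 := PX2) hW1 hX1' hX2'
  have n1 : ∀ u z, 0 ≤ ∑ v, P2 v * wire (letterLaw PX1 PX2 W) u v z := fun u z =>
    Finset.sum_nonneg fun v _ => mul_nonneg (h2 v) (wire_nonneg hT u v z)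
  have n2 : ∀ v z, 0 ≤ ∑ u, P1 u * wire (letterLaw PX1 PX2 W) u v z := fun v z =>
    Finset.sum_nonneg fun u _ => mul_nonneg (h1 u) (wire_nonneg hT u v z)
  have m1 : ∀ u, ∑ z, ∑ v, P2 v * wire (letterLaw PX1 PX2 W) u v z = 1 := fun u => by
    rw [Finset.sum_comm]
    simp_rw [← Finset.mul_sum, sum_wire hT1, mul_one, h2']
  have m2 : ∀ v, ∑ z, ∑ u, P1 u * wire (letterLaw PX1 PX2 W) u v z = 1 := fun v => by
    rw [Finset.sum_comm]
    simp_rw [← Finset.mul_sum, sum_wire hT1, mul_one, h1']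
  have n3 : ∀ a : V1 × V2, 0 ≤ P1 a.1 * P2 a.2 := fun a => mul_nonneg (h1 _) (h2 _)
  have m3 : ∑ a : V1 × V2, P1 a.1 * P2 a.2 = 1 := by
    rw [Fintype.sum_prod_type]
    simp_rw [← Finset.mul_sum, h2', mul_one, h1']
  obtain ⟨s, hs, hs1, hsρ⟩ := exists_tilted_neg_lt_one h1 h1' (channel₁_nonneg h2 hT)
    (sum_channel₁ h2' hT1) hA1
  obtain ⟨t, ht, ht1, htρ⟩ := exists_tilted_neg_lt_one h2 h2' (channel₂_nonneg h1 hT)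
    (sum_channel₂ h1' hT1) hA2
  obtain ⟨b1, hb1, hb1', hbρ⟩ := exists_tilted_lt_one h1 h1' n1 m1 hB1
  obtain ⟨b2, hb2, hb2', hbρ2⟩ := exists_tilted_lt_one h2 h2' n2 m2 hB2
  obtain ⟨b, hb, hb', hbρ3⟩ := exists_tilted_lt_one n3 m3
    (fun a z => wire_nonneg hT a.1 a.2 z) (fun a => sum_wire hT1 a.1 a.2) hB
  obtain ⟨ρ, hρ0, hρ1, hρ⟩ := exists_lt_one_forall (a := ![_, _, _, _, _]) (by
    intro i
    fin_cases i
    exacts [hsρ, htρ, hbρ, hbρ2, hbρ3])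
  refine ⟨Real.sqrt ρ, Real.sqrt_pos.2 hρ0, (Real.sqrt_lt' one_pos).2 (by simpa using hρ1),
    fun n l1 c r1 l2 k r2 hpos hI hJ c1 c2 c3 c4 c5 => ?_⟩
  obtain ⟨⟨p1, p2, p3, p4⟩, p5, p6⟩ := id hpos
  have : NeZero l1 := ⟨p1.ne'⟩
  have : NeZero c := ⟨p2.ne'⟩
  have : NeZero l2 := ⟨p3.ne'⟩
  have : NeZero k := ⟨p4.ne'⟩
  have : NeZero r1 := ⟨p5.ne'⟩
  have : NeZero r2 := ⟨p6.ne'⟩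
  have hTn := blockLaw_nonneg (n := n) hW hX1 hX2
  have hTn1 := sum_blockLaw (n := n) hW1 hX1' hX2'
  have key := hasCode_of_leakage hW hW1 h1 h1' h2 h2' hX1 hX1' hX2 hX2' hs hs1 ht ht1 (hρ 0) (hρ 1)
    hpos hI hJ (Q := fun _ z => ∑ u, piLaw P1 u * ∑ v, piLaw P2 v *
      wire (blockLaw PX1 PX2 W) u v z)
    (fun _ z => Finset.sum_nonneg fun u _ => mul_nonneg (piLaw_nonneg h1 u)
      (Finset.sum_nonneg fun v _ => mul_nonneg (piLaw_nonneg h2 v) (wire_nonneg hTn u v z)))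
    (fun _ => by
      rw [Finset.sum_comm]
      simp_rw [← Finset.mul_sum]
      simp_rw [Finset.sum_comm (s := (Finset.univ : Finset (Fin n → Z))), ← Finset.mul_sum,
        sum_wire hTn1, mul_one, sum_piLaw h2', mul_one, sum_piLaw h1'])
    (codebookMean_leakage_le (piLaw_nonneg h1) (sum_piLaw h1') (piLaw_nonneg h2) (sum_piLaw h2')
      (wire_nonneg hTn) (sum_wire hTn1) (l := Real.sqrt ρ ^ n) (pow_pos (Real.sqrt_pos.2 hρ0) n)
      hb1 hb1' hb2 hb2' hb hb' (Real.exp_pos (n * B1)) (Real.exp_pos (n * B2))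
      (Real.exp_pos (n * B)) (by simpa using c1) (by simpa using c2) (by simpa using c3)
      (by simpa using c4) (by simpa using c5))
  refine key.mono ?_
  rw [tilted_wire₁ h1 h2 hT, tilted_wire₂ h1 h2 hT, tilted_wire_pair h1 h2 hT]
  have e1 := exp_rpow_neg_mul_pow_le (n := n) (tilted_nonneg h1 n1 _) (hρ 2)
  have e2 := exp_rpow_neg_mul_pow_le (n := n) (tilted_nonneg h2 n2 _) (hρ 3)
  have e3 := exp_rpow_neg_mul_pow_le (n := n)
    (tilted_nonneg n3 (fun a z => wire_nonneg hT a.1 a.2 z) _) (hρ 4)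
  have e4 := le_sqrt_pow hρ0 hρ1 n
  have e5 := one_div_sqrt_pow_mul hρ0 n
  have e6 : 0 ≤ 1 / Real.sqrt ρ ^ n := by positivity
  have e7 := mul_le_mul_of_nonneg_left (add_le_add (add_le_add e1 e2) e3) e6
  linarith

/-- Block codes in which the codewords of user 1 are protected by the shared key only. -/
lemma exists_hasCode_revealed (hW : ∀ x1 x2 y, 0 ≤ W x1 x2 y)
    (hW1 : ∀ x1 x2, ∑ y, W x1 x2 y = 1)
    (h1 : ∀ u, 0 ≤ P1 u) (h1' : ∑ u, P1 u = 1) (h2 : ∀ v, 0 ≤ P2 v) (h2' : ∑ v, P2 v = 1)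
    (hX1 : ∀ u x, 0 ≤ PX1 u x) (hX1' : ∀ u, ∑ x, PX1 u x = 1)
    (hX2 : ∀ v x, 0 ≤ PX2 v x) (hX2' : ∀ v, ∑ x, PX2 v x = 1) {A1 A2 B : ℝ}
    (hA1 : A1 < info P1 (channel₁ P2 (letterLaw PX1 PX2 W)))
    (hA2 : A2 < info P2 (channel₂ P1 (letterLaw PX1 PX2 W)))
    (hB : info P2 (fun v (a : V1 × Z) => P1 a.1 * wire (letterLaw PX1 PX2 W) a.1 v a.2) < B) :
    ∃ ρ, 0 < ρ ∧ ρ < 1 ∧ ∀ n c r1 l2 k r2 : ℕ,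
      (0 < c ∧ 0 < l2 ∧ 0 < k) ∧ 0 < r1 ∧ 0 < r2 →
      (c * r1 : ℝ) - 1 ≤ 8 * Real.exp (n * A1) →
      (l2 * k * r2 : ℝ) - 1 ≤ 8 * Real.exp (n * A2) →
      Real.exp (n * B) ≤ l2 * r2 → Real.exp (n * B) ≤ k * r2 →
      HasCode W n 1 c l2 k (32 * ρ ^ n) := by
  have hT : ∀ u v a b z, 0 ≤ letterLaw PX1 PX2 W u v a b z := fun u v a b z =>
    mul_nonneg (mul_nonneg (hX1 _ _) (hX2 _ _)) (hW _ _ _)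
  have hT1 := sum_letterLaw (PX1 := PX1) (PX2 := PX2) hW1 hX1' hX2'
  have n1 : ∀ v (a : V1 × Z), 0 ≤ P1 a.1 * wire (letterLaw PX1 PX2 W) a.1 v a.2 := fun v a =>
    mul_nonneg (h1 _) (wire_nonneg hT _ _ _)
  have m1 : ∀ v, ∑ a : V1 × Z, P1 a.1 * wire (letterLaw PX1 PX2 W) a.1 v a.2 = 1 := fun v => by
    rw [Fintype.sum_prod_type]
    simp_rw [← Finset.mul_sum, sum_wire hT1, mul_one, h1']
  obtain ⟨s, hs, hs1, hsρ⟩ := exists_tilted_neg_lt_one h1 h1' (channel₁_nonneg h2 hT)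
    (sum_channel₁ h2' hT1) hA1
  obtain ⟨t, ht, ht1, htρ⟩ := exists_tilted_neg_lt_one h2 h2' (channel₂_nonneg h1 hT)
    (sum_channel₂ h1' hT1) hA2
  obtain ⟨b, hb, hb', hbρ⟩ := exists_tilted_lt_one h2 h2' n1 m1 hB
  obtain ⟨ρ, hρ0, hρ1, hρ⟩ := exists_lt_one_forall (a := ![_, _, _]) (by
    intro i
    fin_cases i
    exacts [hsρ, htρ, hbρ])
  refine ⟨Real.sqrt ρ, Real.sqrt_pos.2 hρ0, (Real.sqrt_lt' one_pos).2 (by simpa using hρ1),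
    fun n c r1 l2 k r2 hpos hI hJ c2 c3 => ?_⟩
  obtain ⟨⟨p2, p3, p4⟩, p5, p6⟩ := id hpos
  have : NeZero c := ⟨p2.ne'⟩
  have : NeZero l2 := ⟨p3.ne'⟩
  have : NeZero k := ⟨p4.ne'⟩
  have : NeZero r1 := ⟨p5.ne'⟩
  have : NeZero r2 := ⟨p6.ne'⟩
  have hTn := blockLaw_nonneg (n := n) hW hX1 hX2
  have hTn1 := sum_blockLaw (n := n) hW1 hX1' hX2'
  have key := hasCode_of_leakage hW hW1 h1 h1' h2 h2' hX1 hX1' hX2 hX2' hs hs1 ht ht1 (hρ 0) (hρ 1)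
    (l1 := 1) ⟨⟨one_pos, p2, p3, p4⟩, p5, p6⟩ (by simpa using hI) hJ
    (Q := fun f z => 𝔼 i, ∑ v, piLaw P2 v * wire (blockLaw PX1 PX2 W) (f i) v z)
    (fun f z => Finset.expect_nonneg fun i _ =>
      (Finset.sum_nonneg fun v _ => mul_nonneg (piLaw_nonneg h2 v) (wire_nonneg hTn _ v z)))
    (fun f => by
      rw [← Finset.expect_sum_comm]
      simp_rw [Finset.sum_comm (s := (Finset.univ : Finset (Fin n → Z))), ← Finset.mul_sum,
        sum_wire hTn1, mul_one, sum_piLaw h2']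
      exact Fintype.expect_const _)
    (codebookMean_leakage_le' (piLaw_nonneg h1) (sum_piLaw h1') (piLaw_nonneg h2) (sum_piLaw h2')
      (wire_nonneg hTn) (sum_wire hTn1) (l := Real.sqrt ρ ^ n) (pow_pos (Real.sqrt_pos.2 hρ0) n)
      hb hb' (Real.exp_pos (n * B)) (by simpa using c2) (by simpa using c3))
  refine key.mono ?_
  rw [tilted_wire_revealed h1 h2 hT]
  have e1 := exp_rpow_neg_mul_pow_le (n := n) (tilted_nonneg h2 n1 _) (hρ 2)
  have e4 := le_sqrt_pow hρ0 hρ1 n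
  have e5 := one_div_sqrt_pow_mul hρ0 n
  have e6 : 0 ≤ 1 / Real.sqrt ρ ^ n := by positivity
  have e7 := mul_le_mul_of_nonneg_left e1 e6
  have e8 : 0 ≤ Real.sqrt ρ ^ n := by positivity
  linarith

end Block

section Achievable

/-- The rate pairs which are achieved by adaptive codes with parameter `o(1 / N)`. -/
def achievable (W : X1 → X2 → Y1 × Y2 × Z → ℝ) : Set (ℝ × ℝ) :=
  {R | ∀ η > 0, ∃ N₀ : ℕ, ∀ N ≥ N₀, ∃ l1 l2 ε, HasCode W N l1 1 l2 1 ε ∧ N * ε ≤ η ∧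
    |Real.log l1 - N * R.1| ≤ N * η ∧ |Real.log l2 - N * R.2| ≤ N * η}

variable {W : X1 → X2 → Y1 × Y2 × Z → ℝ}

lemma swap_mem_achievable {R : ℝ × ℝ} (h : R ∈ achievable W) :
    R.swap ∈ achievable (swapChannel W) := by
  intro η hη
  obtain ⟨N₀, h⟩ := h η hη
  refine ⟨N₀, fun N hN => ?_⟩
  obtain ⟨l1, l2, ε, h, hε, h1, h2⟩ := h N hN
  exact ⟨l2, l1, ε, h.swap, hε, h2, h1⟩

lemma isClosed_achievable : IsClosed (achievable W) := by
  refine isClosed_of_closure_subset fun R hR η hη => ?_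
  obtain ⟨R', h, hd⟩ := Metric.mem_closure_iff.mp hR (η / 2) (half_pos hη)
  obtain ⟨N₀, h⟩ := h (η / 2) (half_pos hη)
  rw [Prod.dist_eq, max_lt_iff, Real.dist_eq, Real.dist_eq] at hd
  refine ⟨N₀, fun N hN => ?_⟩
  obtain ⟨l1, l2, ε, h, hε, h1, h2⟩ := h N hN
  have key : ∀ {l x y : ℝ}, |l - N * y| ≤ N * (η / 2) → |x - y| < η / 2 → |l - N * x| ≤ N * η := by
    intro l x y h h'
    have hN : (0 : ℝ) ≤ N := N.cast_nonneg
    rw [abs_le] at h ⊢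
    rw [abs_lt] at h'
    constructor <;> nlinarith
  exact ⟨l1, l2, ε, h, by linarith, key h1 hd.1, key h2 hd.2⟩

lemma abs_log_mul_sub_le {l l' N1 N2 a b x y η C : ℝ} (hl : 0 < l) (hl' : 0 < l') (h : |Real.log l - N1 * x| ≤ N1 * η)
    (h' : |Real.log l' - N2 * y| ≤ N2 * η) (h1 : |N1 - a| ≤ C) (h2 : |N2 - b| ≤ C) :
    |Real.log (l * l') - (a * x + b * y)| ≤ (N1 + N2) * η + C * (|x| + |y|) := by
  rw [Real.log_mul hl.ne' hl'.ne']
  have e : Real.log l + Real.log l' - (a * x + b * y) = (Real.log l - N1 * x) +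
      (Real.log l' - N2 * y) + ((N1 - a) * x + (N2 - b) * y) := by ring
  rw [e]
  refine (abs_add_le _ _).trans ?_
  have := abs_add_le (Real.log l - N1 * x) (Real.log l' - N2 * y)
  have h3 := abs_add_le ((N1 - a) * x) ((N2 - b) * y)
  rw [abs_mul, abs_mul] at h3
  have := mul_le_mul_of_nonneg_right h1 (abs_nonneg x)
  have := mul_le_mul_of_nonneg_right h2 (abs_nonneg y)
  linarith

lemma mul_le_of_mul_le {m n N ε η : ℝ} (hm : 0 ≤ m) (hη : 0 ≤ η) (hN : 0 ≤ N) (h : m * N ≤ 2 * n)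
    (hε : n * ε ≤ m * η / 4) : m * (N * ε) ≤ m * η / 2 := by
  rcases le_total ε 0 with h0 | h0
  · have : N * ε ≤ 0 := mul_nonpos_of_nonneg_of_nonpos hN h0
    have : m * (N * ε) ≤ 0 := mul_nonpos_of_nonneg_of_nonpos hm this
    exact this.trans (by positivity)
  · have := mul_le_mul_of_nonneg_right h h0
    linarith

lemma convex_achievable : Convex ℝ (achievable W) := by
  rw [convex_iff_forall_pos]
  intro R hR R' hR' s t hs ht hst η hη
  set m := min s t with hm
  have hm0 : 0 < m := lt_min hs ht
  have hm1 : m ≤ 1 := (min_le_left _ _).trans (by linarith)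
  set M := |R.1| + |R'.1| + |R.2| + |R'.2| with hM
  obtain ⟨N₁, h⟩ := hR (m * η / 4) (by positivity)
  obtain ⟨N₂, h'⟩ := hR' (m * η / 4) (by positivity)
  obtain ⟨N₀, hN₀⟩ := exists_nat_gt (max ((N₁ + N₂ + 2) / m) (2 * M / η))
  refine ⟨N₀, fun N hN => ?_⟩
  have hNN : (N₀ : ℝ) ≤ N := by exact_mod_cast hN
  rw [max_lt_iff, div_lt_iff₀ hm0, div_lt_iff₀ hη] at hN₀
  have hN0 : (0 : ℝ) ≤ N := N.cast_nonneg
  obtain ⟨n, hns, hns'⟩ : ∃ n : ℕ, (n : ℝ) ≤ s * N ∧ s * N < n + 1 :=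
    ⟨⌊s * N⌋₊, Nat.floor_le (by positivity), Nat.lt_floor_add_one _⟩
  have hms : m ≤ s := min_le_left _ _
  have hmt : m ≤ t := min_le_right _ _
  have hsN : m * N ≤ s * N := by gcongr
  have htN : m * N ≤ t * N := by gcongr
  have hmN : (N₁ + N₂ + 2 : ℝ) ≤ m * N := by
    linarith [mul_le_mul_of_nonneg_left hNN hm0.le]
  have hnN : n ≤ N := by
    have : (n : ℝ) ≤ N := hns.trans (mul_le_of_le_one_left hN0 (by linarith))
    exact_mod_cast this
  obtain ⟨n', rfl⟩ := Nat.exists_eq_add_of_le hnN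
  push_cast at *
  have hn1 : N₁ ≤ n := by
    have : (N₁ : ℝ) ≤ n := by linarith [(N₂.cast_nonneg : (0:ℝ) ≤ N₂)]
    exact_mod_cast this
  have hsn : |(n : ℝ) - s * (n + n')| ≤ 1 := by
    rw [abs_le]; constructor <;> linarith
  have htn : |(n' : ℝ) - t * (n + n')| ≤ 1 := by
    have e : (n' : ℝ) - t * (n + n') = -(n - s * (n + n')) := by linear_combination -(n + n' : ℝ) * hst
    rwa [e, abs_neg]
  have htn' := abs_le.mp htn
  have hn2 : N₂ ≤ n' := by
    have : (N₂ : ℝ) ≤ n' := by linarith [(N₁.cast_nonneg : (0:ℝ) ≤ N₁)]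
    exact_mod_cast this
  obtain ⟨l1, l2, ε, h, hε, h1, h2⟩ := h n hn1
  obtain ⟨l1', l2', ε', h', hε', h1', h2'⟩ := h' n' hn2
  have p1 : (0 : ℝ) < l1 := by exact_mod_cast h.1.1
  have p2 : (0 : ℝ) < l2 := by exact_mod_cast h.1.2.2.1
  have p1' : (0 : ℝ) < l1' := by exact_mod_cast h'.1.1
  have p2' : (0 : ℝ) < l2' := by exact_mod_cast h'.1.2.2.1
  have hMn : M ≤ (n + n') * (η / 2) := by
    linarith [mul_le_mul_of_nonneg_right hNN hη.le]
  have hfin : ∀ {S : ℝ}, S ≤ M → (n + n') * (m * η / 4) + 1 * S ≤ (n + n') * η := by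
    intro S hS
    have : (n + n') * (m * η / 4) ≤ (n + n') * (η / 4) := by
      gcongr
      linarith [mul_le_mul_of_nonneg_right hm1 hη.le]
    have : 0 ≤ (n + n' : ℝ) * η := by positivity
    linarith
  refine ⟨_, _, _, h.comp h', ?_, ?_, ?_⟩
  · have a1 := mul_le_of_mul_le hm0.le hη.le (N := n + n') (by positivity) (by linarith) hε
    have a2 := mul_le_of_mul_le hm0.le hη.le (N := n + n') (n := n') (by positivity) (by linarith) hε'
    have : m * ((n + n') * (ε + ε')) ≤ m * η := by linarith
    exact le_of_mul_le_mul_left this hm0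
  · have := abs_log_mul_sub_le p1 p1' (a := s * (n + n')) (b := t * (n + n')) (C := 1) h1 h1' hsn htn
    push_cast
    rw [mul_one, Prod.fst_add, Prod.smul_fst, Prod.smul_fst, smul_eq_mul, smul_eq_mul]
    calc _ = |Real.log (l1 * l1') - (s * (n + n') * R.1 + t * (n + n') * R'.1)| := by
          congr 1; ring
      _ ≤ _ := this
      _ ≤ _ := hfin (by linarith [abs_nonneg R.2, abs_nonneg R'.2])
  · have := abs_log_mul_sub_le p2 p2' (a := s * (n + n')) (b := t * (n + n')) (C := 1) h2 h2' hsn htn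
    push_cast
    rw [Prod.snd_add, Prod.smul_snd, Prod.smul_snd, smul_eq_mul, smul_eq_mul]
    calc _ = |Real.log (l2 * l2') - (s * (n + n') * R.2 + t * (n + n') * R'.2)| := by
          congr 1; ring
      _ ≤ _ := this
      _ ≤ _ := hfin (by linarith [abs_nonneg R.1, abs_nonneg R'.1])

end Achievable

section Blocks

variable {W : X1 → X2 → Y1 × Y2 × Z → ℝ}

lemma HasCode.iterate {n l m k : ℕ} {ε : ℝ} (h0 : HasCode W n l 1 m k ε) (h : HasCode W n l k m k ε)
    (B : ℕ) : HasCode W (n * (B + 1)) (l * (l * k) ^ B) 1 (m ^ (B + 1)) k ((B + 1) * ε) := by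
  induction B with
  | zero => simpa using h0
  | succ B ih =>
    convert ih.comp h using 1 <;> push_cast <;> ring

lemma ceil_exp_pos {n : ℕ} {x : ℝ} : 0 < ⌈Real.exp (n * x)⌉₊ := Nat.ceil_pos.2 (Real.exp_pos _)

lemma ceil_exp_le {n : ℕ} {x : ℝ} (hx : 0 ≤ x) : (⌈Real.exp (n * x)⌉₊ : ℝ) ≤ 2 * Real.exp (n * x) := by
  have := Nat.ceil_lt_add_one (Real.exp_pos (n * x)).le
  have : 1 ≤ Real.exp (n * x) := Real.one_le_exp (by positivity)
  linarith

lemma abs_log_ceil_exp_sub_le {n : ℕ} {x : ℝ} (hx : 0 ≤ x) :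
    |Real.log ⌈Real.exp (n * x)⌉₊ - n * x| ≤ 1 := by
  have h1 : Real.exp (n * x) ≤ ⌈Real.exp (n * x)⌉₊ := Nat.le_ceil _
  have h2 := ceil_exp_le (n := n) hx
  have h3 := Real.log_le_log (Real.exp_pos _) h1
  have h4 := Real.log_le_log ((Real.exp_pos _).trans_le h1) h2
  rw [Real.log_mul two_ne_zero (Real.exp_ne_zero _), Real.log_exp] at h4
  rw [Real.log_exp] at h3
  have := Real.log_two_lt_d9
  rw [abs_le]
  constructor <;> linarith

lemma mem_achievable_of_blocks [Nonempty X1] [Nonempty X2] (hW : ∀ x1 x2 y, 0 ≤ W x1 x2 y)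
    (hW1 : ∀ x1 x2, ∑ y, W x1 x2 y = 1) {σ κ τ ρ : ℝ} (hσ : 0 ≤ σ) (hκ : 0 ≤ κ) (hτ : 0 ≤ τ)
    (hρ0 : 0 < ρ) (hρ1 : ρ < 1)
    (h0 : ∀ n : ℕ, HasCode W n ⌈Real.exp (n * σ)⌉₊ 1 ⌈Real.exp (n * τ)⌉₊ ⌈Real.exp (n * κ)⌉₊ (32 * ρ ^ n))
    (h : ∀ n : ℕ, HasCode W n ⌈Real.exp (n * σ)⌉₊ ⌈Real.exp (n * κ)⌉₊ ⌈Real.exp (n * τ)⌉₊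
      ⌈Real.exp (n * κ)⌉₊ (32 * ρ ^ n)) : (σ + κ, τ) ∈ achievable W := by
  intro η hη
  obtain ⟨B, hB⟩ := exists_nat_gt (2 * κ / η)
  rw [div_lt_iff₀ hη] at hB
  have hlim : Filter.Tendsto (fun n : ℕ => 64 * (B + 1 : ℝ) ^ 2 * ((n : ℝ) ^ 1 * ρ ^ n)) Filter.atTop
      (nhds (64 * (B + 1 : ℝ) ^ 2 * 0)) :=
    (tendsto_pow_const_mul_const_pow_of_abs_lt_one 1 (by rwa [abs_of_pos hρ0])).const_mul _
  rw [mul_zero] at hlim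
  obtain ⟨n₀, hn₀⟩ := Filter.eventually_atTop.1 (hlim.eventually (gt_mem_nhds hη))
  set C := 2 * (B + 1) + (B + 1) * (σ + κ + τ) with hC
  have hC0 : 0 ≤ C := by positivity
  obtain ⟨N₀, hN₀⟩ := exists_nat_gt (2 * C / η)
  rw [div_lt_iff₀ hη] at hN₀
  refine ⟨max N₀ ((n₀ + 1) * (B + 1)), fun N hN => ?_⟩
  rw [ge_iff_le, max_le_iff] at hN
  have hCN : C ≤ N * (η / 2) := by
    have : (N₀ : ℝ) ≤ N := by exact_mod_cast hN.1
    linarith [mul_le_mul_of_nonneg_right this hη.le]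
  obtain ⟨n, r, hNr, hr⟩ : ∃ n r, N = n * (B + 1) + r ∧ r < B + 1 :=
    ⟨N / (B + 1), N % (B + 1), by rw [mul_comm]; exact (Nat.div_add_mod _ _).symm,
      Nat.mod_lt _ B.succ_pos⟩
  have hn : n₀ + 1 ≤ n := by
    by_contra hn
    have : n + 1 ≤ n₀ + 1 := by omega
    have := Nat.mul_le_mul_right (B + 1) this
    rw [add_mul, one_mul] at this
    omega
  have hcode := ((h0 n).iterate (h n) B).forget.comp (hasCode_one hW hW1 r)
  rw [← hNr] at hcode
  have hn1 : (1 : ℝ) ≤ n := by exact_mod_cast (by omega : 1 ≤ n)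
  have hr' : (r : ℝ) ≤ B + 1 := by exact_mod_cast hr.le
  have hr0 : (0 : ℝ) ≤ r := r.cast_nonneg
  have hB0 : (0 : ℝ) ≤ B := B.cast_nonneg
  have hNR : (N : ℝ) = n * (B + 1) + r := by exact_mod_cast hNr
  have hl : (0 : ℝ) < ⌈Real.exp (n * σ)⌉₊ := by exact_mod_cast ceil_exp_pos
  have hk : (0 : ℝ) < ⌈Real.exp (n * κ)⌉₊ := by exact_mod_cast ceil_exp_pos
  have hlσ := abs_le.1 (abs_log_ceil_exp_sub_le (n := n) hσ)
  have hlκ := abs_le.1 (abs_log_ceil_exp_sub_le (n := n) hκ)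
  have hlτ := abs_le.1 (abs_log_ceil_exp_sub_le (n := n) hτ)
  refine ⟨_, _, _, hcode, ?_, ?_, ?_⟩
  · refine le_trans ?_ (hn₀ n (by omega)).le
    have hN2 : (N : ℝ) ≤ n * (B + 1) * 2 := by
      rw [hNR]; nlinarith
    calc (N : ℝ) * ((B + 1) * (32 * ρ ^ n) + 0) ≤ n * (B + 1) * 2 * ((B + 1) * (32 * ρ ^ n) + 0) := by
          gcongr
      _ = _ := by ring
  · push_cast
    simp only [mul_one]
    rw [Real.log_mul hl.ne' (by positivity), Real.log_pow, Real.log_mul hl.ne' hk.ne', hNR]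
    rw [hNR] at hCN
    generalize Real.log (⌈Real.exp (n * σ)⌉₊ : ℝ) = x at *
    generalize Real.log (⌈Real.exp (n * κ)⌉₊ : ℝ) = y at *
    have e1 : n * κ ≤ (n * (B + 1) + r) * (η / 2) := by
      have := mul_le_mul_of_nonneg_left hB.le (zero_le_one.trans hn1)
      have : 0 ≤ n * η := by positivity
      have : 0 ≤ r * η := by positivity
      linarith
    have e2 : r * (σ + κ) ≤ (B + 1) * (σ + κ) := by gcongr
    have e3 : 0 ≤ r * (σ + κ) := by positivity
    have e4 : 0 ≤ n * κ := by positivity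
    have e5 : 0 ≤ (B + 1) * τ := by positivity
    have := mul_le_mul_of_nonneg_left hlσ.1 hB0
    have := mul_le_mul_of_nonneg_left hlσ.2 hB0
    have := mul_le_mul_of_nonneg_left hlκ.1 hB0
    have := mul_le_mul_of_nonneg_left hlκ.2 hB0
    rw [abs_le]
    constructor <;> linarith
  · push_cast
    rw [mul_one, Real.log_pow, hNR]
    push_cast
    rw [hNR] at hCN
    generalize Real.log (⌈Real.exp (n * τ)⌉₊ : ℝ) = x at *
    have e2 : r * τ ≤ (B + 1) * τ := by gcongr
    have e3 : 0 ≤ r * τ := by positivity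
    have e5 : 0 ≤ (B + 1) * (σ + κ) := by positivity
    have := mul_le_mul_of_nonneg_left hlτ.1 hB0
    have := mul_le_mul_of_nonneg_left hlτ.2 hB0
    rw [abs_le]
    constructor <;> linarith

end Blocks

section Info

lemma info_nonneg {A D : Type*} [Fintype A] [Fintype D] {P : A → ℝ} {U : A → D → ℝ}
    (hP : ∀ a, 0 ≤ P a) (hP1 : ∑ a, P a = 1) (hU : ∀ a d, 0 ≤ U a d) (hU1 : ∀ a, ∑ d, U a d = 1) :
    0 ≤ info P U := by
  set q : D → ℝ := fun d => ∑ a, P a * U a d with hq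
  have hq0 : ∀ d, 0 ≤ q d := fun d => Finset.sum_nonneg fun a _ => mul_nonneg (hP a) (hU a d)
  have hq1 : ∑ d, q d = 1 := by
    simp only [hq]
    rw [Finset.sum_comm]
    simp_rw [← Finset.mul_sum, hU1, mul_one, hP1]
  have key : ∀ a d, P a * (U a d - q d) ≤ P a * (U a d * Real.log (U a d / q d)) := by
    intro a d
    rcases (hP a).eq_or_lt with h | h
    · simp [← h]
    refine mul_le_mul_of_nonneg_left ?_ h.le
    rcases (hU a d).eq_or_lt with h' | h'
    · simpa [← h'] using hq0 d
    have hqd : 0 < q d := Finset.sum_pos' (fun a _ => mul_nonneg (hP a) (hU a d))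
      ⟨a, Finset.mem_univ _, mul_pos h h'⟩
    have := Real.one_sub_inv_le_log_of_pos (div_pos h' hqd)
    calc U a d - q d = U a d * (1 - (U a d / q d)⁻¹) := by field_simp
      _ ≤ _ := mul_le_mul_of_nonneg_left this h'.le
  calc (0 : ℝ) = ∑ a, P a * ∑ d, (U a d - q d) := by simp [Finset.sum_sub_distrib, hU1, hq1]
    _ ≤ info P U := by
        refine Finset.sum_le_sum fun a _ => ?_
        rw [Finset.mul_sum, Finset.mul_sum]
        exact Finset.sum_le_sum fun d _ => key a d

/-- The chain rule for the mutual information. -/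
lemma info_pair {P1 : V1 → ℝ} {P2 : V2 → ℝ} {w : V1 → V2 → Z → ℝ} (h1 : ∀ u, 0 ≤ P1 u)
    (h2 : ∀ v, 0 ≤ P2 v) (hw : ∀ u v z, 0 ≤ w u v z) :
    info (fun a : V1 × V2 => P1 a.1 * P2 a.2) (fun a z => w a.1 a.2 z) =
      info P1 (fun u z => ∑ v, P2 v * w u v z) +
      info P2 (fun v (a : V1 × Z) => P1 a.1 * w a.1 v a.2) := by
  set r : V1 → Z → ℝ := fun u z => ∑ v, P2 v * w u v z with hr
  set q : Z → ℝ := fun z => ∑ u, P1 u * r u z with hq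
  have hr0 : ∀ u z, 0 ≤ r u z := fun u z => Finset.sum_nonneg fun v _ => mul_nonneg (h2 v) (hw ..)
  have e1 : info (fun a : V1 × V2 => P1 a.1 * P2 a.2) (fun a z => w a.1 a.2 z) =
      ∑ u, ∑ v, ∑ z, P1 u * (P2 v * w u v z) * Real.log (w u v z / q z) := by
    simp only [info, Fintype.sum_prod_type, Finset.mul_sum, hq, hr]
    refine Finset.sum_congr rfl fun u _ => Finset.sum_congr rfl fun v _ =>
      Finset.sum_congr rfl fun z _ => ?_
    simp only [mul_assoc]
  have e2 : info P1 r = ∑ u, ∑ v, ∑ z, P1 u * (P2 v * w u v z) * Real.log (r u z / q z) := by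
    unfold info
    refine Finset.sum_congr rfl fun u _ => ?_
    rw [Finset.sum_comm, Finset.mul_sum]
    refine Finset.sum_congr rfl fun z _ => ?_
    rw [← Finset.sum_mul, ← Finset.mul_sum, mul_assoc]
  have e3 : info P2 (fun v (a : V1 × Z) => P1 a.1 * w a.1 v a.2) =
      ∑ u, ∑ v, ∑ z, P1 u * (P2 v * w u v z) * Real.log (P1 u * w u v z / (P1 u * r u z)) := by
    unfold info
    rw [Finset.sum_comm]
    refine Finset.sum_congr rfl fun v _ => ?_
    rw [Fintype.sum_prod_type, Finset.mul_sum]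
    refine Finset.sum_congr rfl fun u _ => ?_
    rw [Finset.mul_sum]
    refine Finset.sum_congr rfl fun z _ => ?_
    simp only [hr, Finset.mul_sum, mul_left_comm (P2 _)]
    ring
  rw [e1, e2, e3]
  simp_rw [← Finset.sum_add_distrib, ← mul_add]
  refine Finset.sum_congr rfl fun u _ => Finset.sum_congr rfl fun v _ =>
    Finset.sum_congr rfl fun z _ => ?_
  rcases (h1 u).eq_or_lt with h | hu
  · simp [← h]
  rcases (h2 v).eq_or_lt with h | hv
  · simp [← h]
  rcases (hw u v z).eq_or_lt with h | hz
  · simp [← h]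
  have hr' : 0 < r u z := Finset.sum_pos' (fun v _ => mul_nonneg (h2 v) (hw ..))
    ⟨v, Finset.mem_univ _, mul_pos hv hz⟩
  have hq' : 0 < q z := Finset.sum_pos' (fun u _ => mul_nonneg (h1 u) (hr0 ..))
    ⟨u, Finset.mem_univ _, mul_pos hu hr'⟩
  rw [mul_div_mul_left _ _ hu.ne', ← Real.log_mul (by positivity) (by positivity)]
  congr 2
  field_simp

end Info

section Region

variable {W : X1 → X2 → Y1 × Y2 × Z → ℝ} {P1 : V1 → ℝ} {P2 : V2 → ℝ} {PX1 : V1 → X1 → ℝ}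
  {PX2 : V2 → X2 → ℝ}

lemma ceil_exp_mul_sub_one_le {A x y z : ℝ} {n : ℕ} (hx : 0 ≤ x) (hy : 0 ≤ y) (hz : 0 ≤ z)
    (h : x + y + z ≤ A) : (⌈Real.exp (n * x)⌉₊ * ⌈Real.exp (n * y)⌉₊ * ⌈Real.exp (n * z)⌉₊ : ℝ) - 1 ≤
      8 * Real.exp (n * A) := by
  calc (⌈Real.exp (n * x)⌉₊ * ⌈Real.exp (n * y)⌉₊ * ⌈Real.exp (n * z)⌉₊ : ℝ) - 1 ≤
      (2 * Real.exp (n * x)) * (2 * Real.exp (n * y)) * (2 * Real.exp (n * z)) - 1 := by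
        gcongr <;> exact ceil_exp_le ‹_›
    _ ≤ 8 * (Real.exp (n * x) * Real.exp (n * y) * Real.exp (n * z)) := by linarith
    _ = 8 * Real.exp (n * (x + y + z)) := by rw [← Real.exp_add, ← Real.exp_add]; ring_nf
    _ ≤ _ := by gcongr

lemma exp_le_ceil_mul_ceil {n : ℕ} {B x y : ℝ} (h : B ≤ x + y) :
    Real.exp (n * B) ≤ (⌈Real.exp (n * x)⌉₊ * ⌈Real.exp (n * y)⌉₊ : ℝ) := by
  calc Real.exp (n * B) ≤ Real.exp (n * (x + y)) := by gcongr
    _ = Real.exp (n * x) * Real.exp (n * y) := by rw [← Real.exp_add]; ring_nf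
    _ ≤ _ := by gcongr <;> exact Nat.le_ceil _

lemma mem_achievable_of_lt [Nonempty X1] [Nonempty X2] (hW : ∀ x1 x2 y, 0 ≤ W x1 x2 y)
    (hW1 : ∀ x1 x2, ∑ y, W x1 x2 y = 1)
    (h1 : ∀ u, 0 ≤ P1 u) (h1' : ∑ u, P1 u = 1) (h2 : ∀ v, 0 ≤ P2 v) (h2' : ∑ v, P2 v = 1)
    (hX1 : ∀ u x, 0 ≤ PX1 u x) (hX1' : ∀ u, ∑ x, PX1 u x = 1)
    (hX2 : ∀ v x, 0 ≤ PX2 v x) (hX2' : ∀ v, ∑ x, PX2 v x = 1) {I1 I2 J1 J2 J : ℝ}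
    (hI1 : I1 = info P1 (channel₁ P2 (letterLaw PX1 PX2 W)))
    (hI2 : I2 = info P2 (channel₂ P1 (letterLaw PX1 PX2 W)))
    (hJ1 : J1 = info P1 (fun u z => ∑ v, P2 v * wire (letterLaw PX1 PX2 W) u v z))
    (hJ2 : J2 = info P2 (fun v z => ∑ u, P1 u * wire (letterLaw PX1 PX2 W) u v z))
    (hJ : J = info (fun a : V1 × V2 => P1 a.1 * P2 a.2)
      (fun a z => wire (letterLaw PX1 PX2 W) a.1 a.2 z))
    {σ κ τ : ℝ} (hσ : 0 ≤ σ) (hκ : 0 ≤ κ) (hτ : 0 ≤ τ) (k1 : σ + κ < I1) (k2 : τ + κ < I2)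
    (k3 : J1 + σ < I1) (k4 : J2 + τ < I2) (k5 : J2 + κ < I2) (k6 : J + (σ + κ) < I1 + I2)
    (k7 : J + τ < I1 + I2) : (σ + κ, τ) ∈ achievable W := by
  obtain ⟨δ, hδ, hδ'⟩ : ∃ δ > 0, δ < I1 - (σ + κ) ∧ δ < I2 - (τ + κ) ∧ 2 * δ < I1 - (J1 + σ) ∧
      2 * δ < I2 - (J2 + τ) ∧ 2 * δ < I2 - (J2 + κ) ∧ 3 * δ < I1 + I2 - (J + (σ + κ)) ∧
      3 * δ < I1 + I2 - (J + τ) := by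
    have hm : ∀ x > 0, ∀ c : ℝ, ∀ᶠ δ in nhdsWithin (0 : ℝ) (Set.Ioi 0), c * δ < x := fun x hx c =>
      nhdsWithin_le_nhds ((continuous_const.mul continuous_id).tendsto' 0 0 (by simp)
        |>.eventually (gt_mem_nhds hx))
    have := ((((((hm _ (sub_pos.2 k1) 1).and (hm _ (sub_pos.2 k2) 1)).and
      (hm _ (sub_pos.2 k3) 2)).and (hm _ (sub_pos.2 k4) 2)).and (hm _ (sub_pos.2 k5) 2)).and
      (hm _ (sub_pos.2 k6) 3)).and (hm _ (sub_pos.2 k7) 3) |>.and self_mem_nhdsWithin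
    obtain ⟨δ, ⟨⟨⟨⟨⟨⟨a, b⟩, c⟩, d⟩, e⟩, f⟩, g⟩, h⟩ := this.exists
    rw [one_mul] at a b
    exact ⟨δ, h, a, b, c, d, e, f, g⟩
  obtain ⟨d1, d2, d3, d4, d5, d6, d7⟩ := hδ'
  obtain ⟨ρ, hρ0, hρ1, H⟩ := exists_hasCode (A1 := I1 - δ) (A2 := I2 - δ) (B1 := J1 + δ)
    (B2 := J2 + δ) (B := J + δ) hW hW1 h1 h1' h2 h2' hX1 hX1' hX2 hX2' (by linarith) (by linarith)
    (by linarith) (by linarith) (by linarith)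
  have r1 : 0 ≤ I1 - δ - σ - κ := by linarith
  have r2 : 0 ≤ I2 - δ - τ - κ := by linarith
  have p : ∀ {n : ℕ} {x : ℝ}, 0 < ⌈Real.exp (n * x)⌉₊ := ceil_exp_pos
  have m4 : ∀ {n : ℕ} {B x y z w : ℝ}, B ≤ x + y + (z + w) → Real.exp (n * B) ≤
      (⌈Real.exp (n * x)⌉₊ * ⌈Real.exp (n * y)⌉₊ * (⌈Real.exp (n * z)⌉₊ * ⌈Real.exp (n * w)⌉₊) : ℝ) := by
    intro n B x y z w h
    calc Real.exp (n * B) ≤ Real.exp (n * (x + y)) * Real.exp (n * (z + w)) := by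
          rw [← Real.exp_add, ← mul_add]; gcongr
      _ ≤ _ := by gcongr <;> exact exp_le_ceil_mul_ceil le_rfl
  have m5 : ∀ {n : ℕ} {B x y z w v : ℝ}, B ≤ x + (y + z) + (w + v) → Real.exp (n * B) ≤
      (⌈Real.exp (n * x)⌉₊ * (⌈Real.exp (n * y)⌉₊ * ⌈Real.exp (n * z)⌉₊) *
        (⌈Real.exp (n * w)⌉₊ * ⌈Real.exp (n * v)⌉₊) : ℝ) := by
    intro n B x y z w v h
    calc Real.exp (n * B) ≤ Real.exp (n * x) * Real.exp (n * (y + z)) * Real.exp (n * (w + v)) := by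
          rw [← Real.exp_add, ← Real.exp_add, ← mul_add, ← mul_add]; gcongr
      _ ≤ _ := by gcongr <;> first | exact Nat.le_ceil _ | exact exp_le_ceil_mul_ceil le_rfl
  refine mem_achievable_of_blocks hW hW1 hσ hκ hτ hρ0 hρ1 (fun n => ?_) (fun n => ?_)
  · refine H n _ 1 (⌈Real.exp (n * κ)⌉₊ * ⌈Real.exp (n * (I1 - δ - σ - κ))⌉₊) _ _
      ⌈Real.exp (n * (I2 - δ - τ - κ))⌉₊ ⟨⟨p, one_pos, p, p⟩, Nat.mul_pos p p, p⟩ ?_ ?_ ?_ ?_ ?_ ?_ ?_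
    · have := ceil_exp_mul_sub_one_le (n := n) hσ hκ r1 (A := I1 - δ) (by linarith)
      simpa only [Nat.cast_one, Nat.cast_mul, mul_one, mul_assoc] using this
    · exact ceil_exp_mul_sub_one_le hτ hκ r2 (by linarith)
    · rw [Nat.cast_one, one_mul, Nat.cast_mul]
      exact exp_le_ceil_mul_ceil (by linarith)
    · exact exp_le_ceil_mul_ceil (by linarith)
    · exact exp_le_ceil_mul_ceil (by linarith)
    · rw [Nat.cast_one, one_mul, Nat.cast_mul]
      exact m4 (by linarith)
    · rw [Nat.cast_one, one_mul, Nat.cast_mul]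
      exact m5 (by linarith)
  · refine H n _ _ ⌈Real.exp (n * (I1 - δ - σ - κ))⌉₊ _ _
      ⌈Real.exp (n * (I2 - δ - τ - κ))⌉₊ ⟨⟨p, p, p, p⟩, p, p⟩ ?_ ?_ ?_ ?_ ?_ ?_ ?_
    · exact ceil_exp_mul_sub_one_le hσ hκ r1 (by linarith)
    · exact ceil_exp_mul_sub_one_le hτ hκ r2 (by linarith)
    · exact exp_le_ceil_mul_ceil (by linarith)
    · exact exp_le_ceil_mul_ceil (by linarith)
    · exact exp_le_ceil_mul_ceil (by linarith)
    · exact m4 (by linarith)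
    · exact m5 (by linarith)

lemma mem_achievable_of_lt_revealed [Nonempty X1] [Nonempty X2] (hW : ∀ x1 x2 y, 0 ≤ W x1 x2 y)
    (hW1 : ∀ x1 x2, ∑ y, W x1 x2 y = 1)
    (h1 : ∀ u, 0 ≤ P1 u) (h1' : ∑ u, P1 u = 1) (h2 : ∀ v, 0 ≤ P2 v) (h2' : ∑ v, P2 v = 1)
    (hX1 : ∀ u x, 0 ≤ PX1 u x) (hX1' : ∀ u, ∑ x, PX1 u x = 1)
    (hX2 : ∀ v x, 0 ≤ PX2 v x) (hX2' : ∀ v, ∑ x, PX2 v x = 1) {I1 I2 J' : ℝ}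
    (hI1 : I1 = info P1 (channel₁ P2 (letterLaw PX1 PX2 W)))
    (hI2 : I2 = info P2 (channel₂ P1 (letterLaw PX1 PX2 W)))
    (hJ' : J' = info P2 (fun v (a : V1 × Z) => P1 a.1 * wire (letterLaw PX1 PX2 W) a.1 v a.2))
    {κ τ : ℝ} (hκ : 0 ≤ κ) (hτ : 0 ≤ τ) (k1 : κ = 0 ∨ κ < I1) (k2 : τ + κ < I2)
    (k4 : J' + τ < I2) (k5 : J' + κ < I2) : (κ, τ) ∈ achievable W := by
  obtain ⟨δ, hδ, hδ'⟩ : ∃ δ > 0, (κ = 0 ∨ δ < I1 - κ) ∧ δ < I2 - (τ + κ) ∧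
      2 * δ < I2 - (J' + τ) ∧ 2 * δ < I2 - (J' + κ) := by
    have hm : ∀ x > 0, ∀ c : ℝ, ∀ᶠ δ in nhdsWithin (0 : ℝ) (Set.Ioi 0), c * δ < x := fun x hx c =>
      nhdsWithin_le_nhds ((continuous_const.mul continuous_id).tendsto' 0 0 (by simp)
        |>.eventually (gt_mem_nhds hx))
    have h0 : ∀ᶠ δ in nhdsWithin (0 : ℝ) (Set.Ioi 0), κ = 0 ∨ 1 * δ < I1 - κ := by
      rcases k1 with h | h
      · exact Filter.Eventually.of_forall fun _ => Or.inl h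
      · exact (hm _ (sub_pos.2 h) 1).mono fun _ => Or.inr
    have := (((h0.and (hm _ (sub_pos.2 k2) 1)).and
      (hm _ (sub_pos.2 k4) 2)).and (hm _ (sub_pos.2 k5) 2)) |>.and self_mem_nhdsWithin
    obtain ⟨δ, ⟨⟨⟨a, b⟩, c⟩, d⟩, h⟩ := this.exists
    rw [one_mul] at a b
    exact ⟨δ, h, a, b, c, d⟩
  obtain ⟨d1, d2, d3, d4⟩ := hδ'
  obtain ⟨ρ, hρ0, hρ1, H⟩ := exists_hasCode_revealed (A1 := I1 - δ) (A2 := I2 - δ) (B := J' + δ)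
    hW hW1 h1 h1' h2 h2' hX1 hX1' hX2 hX2' (by linarith) (by linarith) (by linarith)
  have r2 : 0 ≤ I2 - δ - τ - κ := by linarith
  have p : ∀ {n : ℕ} {x : ℝ}, 0 < ⌈Real.exp (n * x)⌉₊ := ceil_exp_pos
  have hc : ∀ n : ℕ, (⌈Real.exp (n * κ)⌉₊ : ℝ) - 1 ≤ 8 * Real.exp (n * (I1 - δ)) := by
    intro n
    rcases d1 with rfl | d1
    · simp [(Real.exp_pos _).le]
    · have e1 := ceil_exp_le (n := n) hκ
      have e2 : Real.exp (n * κ) ≤ Real.exp (n * (I1 - δ)) := by gcongr; linarith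
      linarith [Real.exp_pos (n * (I1 - δ))]
  have h1n : ∀ n : ℕ, ⌈Real.exp (n * 0)⌉₊ = 1 := by simp
  rw [← zero_add κ]
  refine mem_achievable_of_blocks hW hW1 le_rfl hκ hτ hρ0 hρ1 (fun n => ?_) (fun n => ?_)
  · rw [h1n]
    refine H n 1 ⌈Real.exp (n * κ)⌉₊ _ _ ⌈Real.exp (n * (I2 - δ - τ - κ))⌉₊
      ⟨⟨one_pos, p, p⟩, p, p⟩ (by simpa using hc n) ?_ ?_ ?_
    · exact ceil_exp_mul_sub_one_le hτ hκ r2 (by linarith)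
    · exact exp_le_ceil_mul_ceil (by linarith)
    · exact exp_le_ceil_mul_ceil (by linarith)
  · rw [h1n]
    refine H n ⌈Real.exp (n * κ)⌉₊ 1 _ _ ⌈Real.exp (n * (I2 - δ - τ - κ))⌉₊
      ⟨⟨p, p, p⟩, one_pos, p⟩ (by simpa using hc n) ?_ ?_ ?_
    · exact ceil_exp_mul_sub_one_le hτ hκ r2 (by linarith)
    · exact exp_le_ceil_mul_ceil (by linarith)
    · exact exp_le_ceil_mul_ceil (by linarith)

end Region

section Region

variable {W : X1 → X2 → Y1 × Y2 × Z → ℝ} {P1 : V1 → ℝ} {P2 : V2 → ℝ} {PX1 : V1 → X1 → ℝ}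
  {PX2 : V2 → X2 → ℝ}

lemma mem_achievable_of_smul {R : ℝ × ℝ} (h : ∀ t : ℝ, 0 < t → t < 1 → t • R ∈ achievable W) :
    R ∈ achievable W := by
  have : Filter.Tendsto (fun t : ℝ => t • R) (nhdsWithin 1 (Set.Iio 1)) (nhds R) :=
    ((continuous_id.smul continuous_const).tendsto' 1 R (by simp)).mono_left nhdsWithin_le_nhds
  refine isClosed_achievable.mem_of_tendsto this ?_
  filter_upwards [Ioo_mem_nhdsLT (zero_lt_one' ℝ)] with t ht using h t ht.1 ht.2

lemma mul_lt_of_le_of_pos {t x y : ℝ} (h0 : 0 < t) (h1 : t < 1) (hy : 0 < y) (h : x ≤ y) :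
    t * x < y := by
  have := mul_le_mul_of_nonneg_left h h0.le
  have := mul_lt_mul_of_pos_right h1 hy
  linarith

lemma mem_achievable_of_region_aux [Nonempty X1] [Nonempty X2] (hW : ∀ x1 x2 y, 0 ≤ W x1 x2 y)
    (hW1 : ∀ x1 x2, ∑ y, W x1 x2 y = 1)
    (h1 : ∀ u, 0 ≤ P1 u) (h1' : ∑ u, P1 u = 1) (h2 : ∀ v, 0 ≤ P2 v) (h2' : ∑ v, P2 v = 1)
    (hX1 : ∀ u x, 0 ≤ PX1 u x) (hX1' : ∀ u, ∑ x, PX1 u x = 1)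
    (hX2 : ∀ v x, 0 ≤ PX2 v x) (hX2' : ∀ v, ∑ x, PX2 v x = 1) {I1 I2 J1 J2 J : ℝ}
    (hI1 : I1 = info P1 (channel₁ P2 (letterLaw PX1 PX2 W)))
    (hI2 : I2 = info P2 (channel₂ P1 (letterLaw PX1 PX2 W)))
    (hJ1 : J1 = info P1 (fun u z => ∑ v, P2 v * wire (letterLaw PX1 PX2 W) u v z))
    (hJ2 : J2 = info P2 (fun v z => ∑ u, P1 u * wire (letterLaw PX1 PX2 W) u v z))
    (hJ : J = info (fun a : V1 × V2 => P1 a.1 * P2 a.2)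
      (fun a z => wire (letterLaw PX1 PX2 W) a.1 a.2 z))
    {R1 R2 : ℝ} (hR1 : 0 ≤ R1) (hR2 : 0 ≤ R2) (k1 : R1 ≤ I1) (k2 : R2 ≤ I2)
    (k3 : max R1 R2 ≤ I1 + I2 - J)
    (k4 : R1 + R2 ≤ min (I1 - J1) (I1 + I2 - J) + min (I2 - J2) (I1 + I2 - J))
    (k5 : R2 ≤ min (I2 - J2) (I1 + I2 - J))
    (k6 : min (I1 - J1) (I1 + I2 - J) ≤ 0 ∨
      0 < min (I1 - J1) (I1 + I2 - J) ∧ 0 < min (I2 - J2) (I1 + I2 - J)) :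
    (R1, R2) ∈ achievable W := by
  have hT : ∀ u v a b z, 0 ≤ letterLaw PX1 PX2 W u v a b z := fun u v a b z =>
    mul_nonneg (mul_nonneg (hX1 _ _) (hX2 _ _)) (hW _ _ _)
  have hT1 := sum_letterLaw (PX1 := PX1) (PX2 := PX2) hW1 hX1' hX2'
  have hw := wire_nonneg hT
  have hw1 := sum_wire hT1
  have hJ1' : 0 ≤ J1 := by
    rw [hJ1]
    refine info_nonneg h1 h1' (fun u z => Finset.sum_nonneg fun v _ => mul_nonneg (h2 v) (hw ..))
      fun u => ?_
    rw [Finset.sum_comm]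
    simp_rw [← Finset.mul_sum, hw1, mul_one, h2']
  have hJ2' : 0 ≤ J2 := by
    rw [hJ2]
    refine info_nonneg h2 h2' (fun u z => Finset.sum_nonneg fun v _ => mul_nonneg (h1 v) (hw ..))
      fun u => ?_
    rw [Finset.sum_comm]
    simp_rw [← Finset.mul_sum, hw1, mul_one, h1']
  obtain ⟨J', hJ'⟩ : ∃ J', J' = info P2 (fun v (a : V1 × Z) =>
    P1 a.1 * wire (letterLaw PX1 PX2 W) a.1 v a.2) := ⟨_, rfl⟩
  have hJJ : J = J1 + J' := by rw [hJ, info_pair h1 h2 hw, hJ1, hJ']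
  have hJ0 : 0 ≤ J' := by
    rw [hJ']
    refine info_nonneg h2 h2' (fun v a => mul_nonneg (h1 _) (hw ..)) fun v => ?_
    rw [Fintype.sum_prod_type]
    simp_rw [← Finset.mul_sum, hw1, mul_one, h1']
  rw [max_le_iff] at k3
  rcases (hR1.trans k3.1).eq_or_lt with hD | hD
  · have e1 : R1 = 0 := by linarith
    have e2 : R2 = 0 := by linarith
    intro η hη
    refine ⟨0, fun N _ => ⟨1, 1, 0, hasCode_one hW hW1 N, by simpa using hη.le, ?_, ?_⟩⟩ <;>
      simp [e1, e2] <;> positivity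
  have kb := min_le_left (I2 - J2) (I1 + I2 - J)
  rcases k6 with h | ⟨ha, hb⟩
  · have h3 : I1 - J1 ≤ 0 := by
      rcases min_le_iff.1 h with h | h
      · exact h
      · exact absurd h (not_le.2 hD)
    refine mem_achievable_of_smul fun t t0 t1 => ?_
    have hI2' : 0 < I2 - J' := by linarith
    have m1 := mul_lt_of_le_of_pos t0 t1 (x := R2 + R1) (y := I2) (by linarith) (by linarith)
    have m2 := mul_lt_of_le_of_pos t0 t1 hI2' (x := R2) (by linarith)
    have m3 := mul_lt_of_le_of_pos t0 t1 hI2' (x := R1) (by linarith)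
    refine mem_achievable_of_lt_revealed hW hW1 h1 h1' h2 h2' hX1 hX1' hX2 hX2' hI1 hI2 hJ'
      (mul_nonneg t0.le hR1) (mul_nonneg t0.le hR2) ?_ ?_ ?_ ?_
    · rcases hR1.eq_or_lt with h | h
      · left; simp [← h]
      · right; exact mul_lt_of_le_of_pos t0 t1 (h.trans_le k1) k1
    all_goals simp only [smul_eq_mul]
    all_goals linarith
  · obtain ⟨ha1, ha2⟩ := lt_min_iff.1 ha
    obtain ⟨hb1, hb2⟩ := lt_min_iff.1 hb
    have ka := min_le_left (I1 - J1) (I1 + I2 - J)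
    obtain ⟨σ, κ, hσ, hκ, hR, hσa, hκb, hκ2⟩ : ∃ σ κ, 0 ≤ σ ∧ 0 ≤ κ ∧ R1 = σ + κ ∧ σ ≤ I1 - J1 ∧
        κ ≤ I2 - J2 ∧ R2 + κ ≤ I2 := by
      rcases le_total R1 (min (I1 - J1) (I1 + I2 - J)) with h | h
      · exact ⟨R1, 0, hR1, le_rfl, by simp, by linarith, by linarith, by linarith⟩
      · exact ⟨min (I1 - J1) (I1 + I2 - J), R1 - min (I1 - J1) (I1 + I2 - J), ha.le, by linarith,
          by ring, ka, by linarith, by linarith⟩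
    refine mem_achievable_of_smul fun t t0 t1 => ?_
    have m1 := mul_lt_of_le_of_pos t0 t1 (x := σ + κ) (y := I1) (by linarith) (by linarith)
    have m2 := mul_lt_of_le_of_pos t0 t1 (x := R2 + κ) (y := I2) (by linarith) (by linarith)
    have m3 := mul_lt_of_le_of_pos t0 t1 ha1 (x := σ) (by linarith)
    have m4 := mul_lt_of_le_of_pos t0 t1 hb1 (x := R2) (by linarith)
    have m5 := mul_lt_of_le_of_pos t0 t1 hb1 (x := κ) (by linarith)
    have m6 := mul_lt_of_le_of_pos t0 t1 hb2 (x := σ + κ) (by linarith)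
    have m7 := mul_lt_of_le_of_pos t0 t1 hb2 (x := R2) (by linarith)
    rw [Prod.smul_mk, smul_eq_mul, smul_eq_mul, hR, mul_add]
    refine mem_achievable_of_lt hW hW1 h1 h1' h2 h2' hX1 hX1' hX2 hX2' hI1 hI2 hJ1 hJ2 hJ
      (mul_nonneg t0.le hσ) (mul_nonneg t0.le hκ) (mul_nonneg t0.le hR2) ?_ ?_ ?_ ?_ ?_ ?_ ?_
    all_goals linarith

lemma info_equiv {A A' D : Type*} [Fintype A] [Fintype A'] [Fintype D] (e : A' ≃ A) (P : A → ℝ)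
    (U : A → D → ℝ) : info (fun a => P (e a)) (fun a => U (e a)) = info P U := by
  unfold info
  rw [← Equiv.sum_comp e]
  refine Finset.sum_congr rfl fun a _ => ?_
  congr 1
  refine Finset.sum_congr rfl fun d _ => ?_
  rw [← Equiv.sum_comp e]

omit [Fintype V1] [Fintype V2] [Fintype X1] [Fintype X2] [Fintype Y1] [Fintype Y2] [Fintype Z] in
lemma letterLaw_swapChannel (u : V1) (v : V2) (a : X1 × Y1) (b : X2 × Y2) (z : Z) :
    letterLaw PX2 PX1 (swapChannel W) v u b a z = letterLaw PX1 PX2 W u v a b z := by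
  simp [letterLaw, swapChannel, mul_comm (PX2 _ _)]

omit [Fintype V1] [Fintype V2] [Fintype Z] in
lemma wire_swapChannel (u : V1) (v : V2) (z : Z) :
    wire (letterLaw PX2 PX1 (swapChannel W)) v u z = wire (letterLaw PX1 PX2 W) u v z := by
  simp only [wire, letterLaw_swapChannel]
  exact Finset.sum_comm

lemma mem_achievable_of_region [Nonempty X1] [Nonempty X2] (hW : ∀ x1 x2 y, 0 ≤ W x1 x2 y)
    (hW1 : ∀ x1 x2, ∑ y, W x1 x2 y = 1)
    (h1 : ∀ u, 0 ≤ P1 u) (h1' : ∑ u, P1 u = 1) (h2 : ∀ v, 0 ≤ P2 v) (h2' : ∑ v, P2 v = 1)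
    (hX1 : ∀ u x, 0 ≤ PX1 u x) (hX1' : ∀ u, ∑ x, PX1 u x = 1)
    (hX2 : ∀ v x, 0 ≤ PX2 v x) (hX2' : ∀ v, ∑ x, PX2 v x = 1) {I1 I2 J1 J2 J : ℝ}
    (hI1 : I1 = info P1 (channel₁ P2 (letterLaw PX1 PX2 W)))
    (hI2 : I2 = info P2 (channel₂ P1 (letterLaw PX1 PX2 W)))
    (hJ1 : J1 = info P1 (fun u z => ∑ v, P2 v * wire (letterLaw PX1 PX2 W) u v z))
    (hJ2 : J2 = info P2 (fun v z => ∑ u, P1 u * wire (letterLaw PX1 PX2 W) u v z))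
    (hJ : J = info (fun a : V1 × V2 => P1 a.1 * P2 a.2)
      (fun a z => wire (letterLaw PX1 PX2 W) a.1 a.2 z))
    {R1 R2 : ℝ} (hR1 : 0 ≤ R1) (hR2 : 0 ≤ R2) (k1 : R1 ≤ I1) (k2 : R2 ≤ I2)
    (k3 : max R1 R2 ≤ I1 + I2 - J)
    (k4 : R1 + R2 ≤ min (I1 - J1) (I1 + I2 - J) + min (I2 - J2) (I1 + I2 - J)) :
    (R1, R2) ∈ achievable W := by
  have key : ∀ (_ : R2 ≤ min (I2 - J2) (I1 + I2 - J)) (_ : min (I1 - J1) (I1 + I2 - J) ≤ 0 ∨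
      0 < min (I1 - J1) (I1 + I2 - J) ∧ 0 < min (I2 - J2) (I1 + I2 - J)),
      (R1, R2) ∈ achievable W :=
    mem_achievable_of_region_aux hW hW1 h1 h1' h2 h2' hX1 hX1' hX2 hX2' hI1 hI2 hJ1 hJ2 hJ hR1 hR2
      k1 k2 k3 k4
  have key' : ∀ (_ : R1 ≤ min (I1 - J1) (I2 + I1 - J)) (_ : min (I2 - J2) (I2 + I1 - J) ≤ 0 ∨
      0 < min (I2 - J2) (I2 + I1 - J) ∧ 0 < min (I1 - J1) (I2 + I1 - J)),
      (R2, R1) ∈ achievable (swapChannel W) := by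
    refine mem_achievable_of_region_aux (W := swapChannel W) (P1 := P2) (P2 := P1) (PX1 := PX2) (PX2 := PX1)
      (fun _ _ _ => hW ..) (fun x2 x1 => ?_) h2 h2' h1 h1' hX2 hX2' hX1 hX1' (hI2.trans ?_)
      (hI1.trans ?_) (hJ2.trans ?_) (hJ1.trans ?_) (hJ.trans ?_) hR2 hR1 k2 k1 ?_ ?_
    · rw [← hW1 x1 x2]
      simp only [swapChannel, Fintype.sum_prod_type]
      exact Finset.sum_comm
    · congr 1; funext v a; simp only [channel₁, channel₂, letterLaw_swapChannel]
    · congr 1; funext v a; simp only [channel₁, channel₂, letterLaw_swapChannel]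
    · simp only [wire_swapChannel]
    · simp only [wire_swapChannel]
    · rw [← info_equiv (Equiv.prodComm V2 V1)]
      simp only [wire_swapChannel, Equiv.prodComm_apply, Prod.fst_swap, Prod.snd_swap, mul_comm]
    · rwa [max_comm, add_comm I2]
    · rwa [add_comm I2, add_comm R2, add_comm (min _ _)]
  rw [add_comm I2] at key'
  have swap : (R2, R1) ∈ achievable (swapChannel W) → (R1, R2) ∈ achievable W :=
    fun h => swap_mem_achievable h
  rcases le_or_gt (min (I1 - J1) (I1 + I2 - J)) 0 with ha | ha
  · exact key (by linarith) (Or.inl ha)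
  rcases le_or_gt (min (I2 - J2) (I1 + I2 - J)) 0 with hb | hb
  · exact swap (key' (by linarith) (Or.inl hb))
  rcases le_or_gt R2 (min (I2 - J2) (I1 + I2 - J)) with h | h
  · exact key h (Or.inr ⟨ha, hb⟩)
  · exact swap (key' (by linarith) (Or.inr ⟨hb, ha⟩))

end Region

section SingleLetter

lemma miDist_eq_info {A D : Type*} [Fintype A] [Fintype D] {P : A → ℝ} {U : A → D → ℝ}
    (hP : ∀ a, 0 ≤ P a) (hU1 : ∀ a, ∑ d, U a d = 1) :
    miDist (fun p : A × D => P p.1 * U p.1 p.2) = info P U := by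
  simp only [miDist, info, ← Finset.mul_sum, hU1, mul_one]
  refine Finset.sum_congr rfl fun a _ => ?_
  rw [Finset.mul_sum]
  refine Finset.sum_congr rfl fun d _ => ?_
  rcases (hP a).eq_or_lt with h | h
  · simp [← h]
  · rw [mul_div_mul_left _ _ h.ne', mul_assoc]

lemma miDist_swap {A D : Type*} [Fintype A] [Fintype D] (P : A × D → ℝ) :
    miDist (fun p : D × A => P (p.2, p.1)) = miDist P := by
  unfold miDist
  rw [Finset.sum_comm]
  simp only [mul_comm (∑ b', P (b', _))]

lemma cmiDist_eq_info {A B C : Type*} [Fintype A] [Fintype B] [Fintype C] {P : B → ℝ}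
    {U : B → C × A → ℝ} {m : C → ℝ} (hP : ∀ b, 0 ≤ P b) (hP1 : ∑ b, P b = 1)
    (hU : ∀ b d, 0 ≤ U b d) (hm : ∀ b c, ∑ a, U b (c, a) = m c) :
    cmiDist (fun p : A × B × C => P p.2.1 * U p.2.1 (p.2.2, p.1)) = info P U := by
  have e : ∀ c, ∑ a, ∑ b, P b * U b (c, a) = m c := fun c => by
    rw [Finset.sum_comm]
    simp_rw [← Finset.mul_sum, hm, ← Finset.sum_mul, hP1, one_mul]
  simp only [cmiDist, e, ← Finset.mul_sum, hm, info, Fintype.sum_prod_type]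
  rw [Finset.sum_comm]
  refine Finset.sum_congr rfl fun b _ => ?_
  rw [Finset.sum_comm, Finset.mul_sum]
  refine Finset.sum_congr rfl fun c _ => ?_
  rw [Finset.mul_sum]
  refine Finset.sum_congr rfl fun a _ => ?_
  rcases (hP b).eq_or_lt with h | h
  · simp [← h]
  rcases (hU b (c, a)).eq_or_lt with h' | h'
  · simp [← h']
  have hmc : 0 < m c := by
    rw [← hm b c]
    exact Finset.sum_pos' (fun a _ => hU ..) ⟨a, Finset.mem_univ _, h'⟩
  rw [mul_assoc]
  congr 3
  field_simp

variable {W : X1 → X2 → Y1 × Y2 × Z → ℝ} {P1 : V1 → ℝ} {P2 : V2 → ℝ} {PX1 : V1 → X1 → ℝ}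
  {PX2 : V2 → X2 → ℝ}

omit [Fintype V1] [Fintype X2] [Fintype Y2] in
lemma pY2V1X2_eq : pY2V1X2 P1 PX1 P2 PX2 W =
    fun p => P1 p.2.1 * channel₁ P2 (letterLaw PX1 PX2 W) p.2.1 (p.2.2, p.1) := by
  funext p
  simp only [pY2V1X2, slJoint, channel₁, letterLaw, Finset.mul_sum, Fintype.sum_prod_type]
  refine Finset.sum_congr rfl fun _ _ => Finset.sum_congr rfl fun _ _ =>
    Finset.sum_congr rfl fun _ _ => Finset.sum_congr rfl fun _ _ => by ring

omit [Fintype V2] [Fintype X1] [Fintype Y1] in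
lemma pY1V2X1_eq : pY1V2X1 P1 PX1 P2 PX2 W =
    fun p => P2 p.2.1 * channel₂ P1 (letterLaw PX1 PX2 W) p.2.1 (p.2.2, p.1) := by
  funext p
  simp only [pY1V2X1, slJoint, channel₂, letterLaw, Finset.mul_sum, Fintype.sum_prod_type]
  refine Finset.sum_congr rfl fun _ _ => Finset.sum_congr rfl fun _ _ =>
    Finset.sum_congr rfl fun _ _ => Finset.sum_congr rfl fun _ _ => by ring

omit [Fintype V1] [Fintype V2] [Fintype Z] in
lemma sum_slJoint (u : V1) (v : V2) (z : Z) :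
    ∑ x1, ∑ x2, ∑ y1, ∑ y2, slJoint P1 PX1 P2 PX2 W (u, v, x1, x2, y1, y2, z) =
      P1 u * P2 v * wire (letterLaw PX1 PX2 W) u v z := by
  simp only [slJoint, wire, letterLaw, Finset.mul_sum, Fintype.sum_prod_type]
  refine Finset.sum_congr rfl fun _ _ => ?_
  rw [Finset.sum_comm]
  refine Finset.sum_congr rfl fun _ _ => Finset.sum_congr rfl fun _ _ =>
    Finset.sum_congr rfl fun _ _ => by ring

omit [Fintype V1] [Fintype V2] [Fintype Z] in
lemma pV12Z_eq : pV12Z P1 PX1 P2 PX2 W =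
    fun p => P1 p.1.1 * P2 p.1.2 * wire (letterLaw PX1 PX2 W) p.1.1 p.1.2 p.2 :=
  funext fun _ => sum_slJoint ..

omit [Fintype V1] [Fintype Z] in
lemma pZV1_eq : pZV1 P1 PX1 P2 PX2 W =
    fun p => P1 p.2 * ∑ v, P2 v * wire (letterLaw PX1 PX2 W) p.2 v p.1 := by
  funext p
  simp only [pZV1, sum_slJoint, Finset.mul_sum, mul_assoc]

omit [Fintype V2] [Fintype Z] in
lemma pZV2_eq : pZV2 P1 PX1 P2 PX2 W =
    fun p => P2 p.2 * ∑ u, P1 u * wire (letterLaw PX1 PX2 W) u p.2 p.1 := by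
  funext p
  simp only [pZV2, sum_slJoint, Finset.mul_sum, mul_assoc, mul_left_comm (P1 _)]

lemma cmiDist_pY2V1X2 (hW : ∀ x1 x2 y, 0 ≤ W x1 x2 y) (hW1 : ∀ x1 x2, ∑ y, W x1 x2 y = 1)
    (h1 : ∀ u, 0 ≤ P1 u) (h1' : ∑ u, P1 u = 1) (h2 : ∀ v, 0 ≤ P2 v)
    (hX1 : ∀ u x, 0 ≤ PX1 u x) (hX1' : ∀ u, ∑ x, PX1 u x = 1) (hX2 : ∀ v x, 0 ≤ PX2 v x) :
    cmiDist (pY2V1X2 P1 PX1 P2 PX2 W) = info P1 (channel₁ P2 (letterLaw PX1 PX2 W)) := by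
  have hT : ∀ u v a b z, 0 ≤ letterLaw PX1 PX2 W u v a b z := fun u v a b z =>
    mul_nonneg (mul_nonneg (hX1 _ _) (hX2 _ _)) (hW _ _ _)
  rw [pY2V1X2_eq]
  refine cmiDist_eq_info (m := fun x2 => ∑ v, P2 v * PX2 v x2) h1 h1' (channel₁_nonneg h2 hT)
    fun u x2 => ?_
  have e : ∀ x1, ∑ y2, ∑ y1, ∑ z, W x1 x2 (y1, y2, z) = 1 := fun x1 => by
    rw [Finset.sum_comm, ← hW1 x1 x2]
    simp only [Fintype.sum_prod_type]
  unfold channel₁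
  rw [Finset.sum_comm]
  refine Finset.sum_congr rfl fun v _ => ?_
  rw [← Finset.mul_sum]
  simp only [letterLaw, Fintype.sum_prod_type]
  rw [Finset.sum_comm]
  simp_rw [← Finset.mul_sum, e, mul_one, ← Finset.sum_mul, hX1', one_mul]

lemma cmiDist_pY1V2X1 (hW : ∀ x1 x2 y, 0 ≤ W x1 x2 y) (hW1 : ∀ x1 x2, ∑ y, W x1 x2 y = 1)
    (h1 : ∀ u, 0 ≤ P1 u) (h2 : ∀ v, 0 ≤ P2 v) (h2' : ∑ v, P2 v = 1)
    (hX1 : ∀ u x, 0 ≤ PX1 u x) (hX2 : ∀ v x, 0 ≤ PX2 v x) (hX2' : ∀ v, ∑ x, PX2 v x = 1) :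
    cmiDist (pY1V2X1 P1 PX1 P2 PX2 W) = info P2 (channel₂ P1 (letterLaw PX1 PX2 W)) := by
  have hT : ∀ u v a b z, 0 ≤ letterLaw PX1 PX2 W u v a b z := fun u v a b z =>
    mul_nonneg (mul_nonneg (hX1 _ _) (hX2 _ _)) (hW _ _ _)
  rw [pY1V2X1_eq]
  refine cmiDist_eq_info (m := fun x1 => ∑ u, P1 u * PX1 u x1) h2 h2' (channel₂_nonneg h1 hT)
    fun v x1 => ?_
  have e : ∀ x2, ∑ y1, ∑ y2, ∑ z, W x1 x2 (y1, y2, z) = 1 := fun x2 => by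
    rw [← hW1 x1 x2]
    simp only [Fintype.sum_prod_type]
  unfold channel₂
  rw [Finset.sum_comm]
  refine Finset.sum_congr rfl fun u _ => ?_
  rw [← Finset.mul_sum]
  simp only [letterLaw, Fintype.sum_prod_type]
  rw [Finset.sum_comm]
  simp_rw [← Finset.mul_sum, e, mul_one, ← Finset.mul_sum, hX2', mul_one]

end SingleLetter

section RegionSubset

/-- The region of the input distribution `d`. -/
def region (W : X1 → X2 → Y1 × Y2 × Z → ℝ) (d : InputDist X1 X2) : Set (ℝ × ℝ) :=
  {p | 0 ≤ p.1 ∧ 0 ≤ p.2 ∧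
    p.1 ≤ cmiDist (pY2V1X2 d.PV1 d.PX1 d.PV2 d.PX2 W) ∧
    p.2 ≤ cmiDist (pY1V2X1 d.PV1 d.PX1 d.PV2 d.PX2 W) ∧
    max p.1 p.2 ≤ cmiDist (pY2V1X2 d.PV1 d.PX1 d.PV2 d.PX2 W) +
      cmiDist (pY1V2X1 d.PV1 d.PX1 d.PV2 d.PX2 W) - miDist (pV12Z d.PV1 d.PX1 d.PV2 d.PX2 W) ∧
    p.1 + p.2 ≤
      min (cmiDist (pY2V1X2 d.PV1 d.PX1 d.PV2 d.PX2 W) -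
            miDist (pZV1 d.PV1 d.PX1 d.PV2 d.PX2 W))
          (cmiDist (pY2V1X2 d.PV1 d.PX1 d.PV2 d.PX2 W) +
            cmiDist (pY1V2X1 d.PV1 d.PX1 d.PV2 d.PX2 W) -
            miDist (pV12Z d.PV1 d.PX1 d.PV2 d.PX2 W)) +
      min (cmiDist (pY1V2X1 d.PV1 d.PX1 d.PV2 d.PX2 W) -
            miDist (pZV2 d.PV1 d.PX1 d.PV2 d.PX2 W))
          (cmiDist (pY2V1X2 d.PV1 d.PX1 d.PV2 d.PX2 W) +
            cmiDist (pY1V2X1 d.PV1 d.PX1 d.PV2 d.PX2 W) -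
            miDist (pV12Z d.PV1 d.PX1 d.PV2 d.PX2 W))}

lemma nonempty_of_sum_eq_one {A : Type*} [Fintype A] {P : A → ℝ} (h : ∑ a, P a = 1) :
    Nonempty A := by
  by_contra hA
  rw [not_nonempty_iff] at hA
  simp at h

lemma InputDist.nonempty_fst (d : InputDist X1 X2) : Nonempty X1 :=
  nonempty_of_sum_eq_one (d.PX1_sum (nonempty_of_sum_eq_one d.PV1_sum).some)

lemma InputDist.nonempty_snd (d : InputDist X1 X2) : Nonempty X2 :=
  nonempty_of_sum_eq_one (d.PX2_sum (nonempty_of_sum_eq_one d.PV2_sum).some)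

variable {W : X1 → X2 → Y1 × Y2 × Z → ℝ}

lemma region_subset_achievable (hW : ∀ x1 x2 y, 0 ≤ W x1 x2 y)
    (hW1 : ∀ x1 x2, ∑ y, W x1 x2 y = 1) (d : InputDist X1 X2) : region W d ⊆ achievable W := by
  rintro ⟨R1, R2⟩ ⟨h1, h2, h3, h4, h5, h6⟩
  have := d.nonempty_fst
  have := d.nonempty_snd
  have hw1 : ∀ u v, ∑ z, wire (letterLaw d.PX1 d.PX2 W) u v z = 1 :=
    sum_wire (sum_letterLaw hW1 d.PX1_sum d.PX2_sum)
  refine mem_achievable_of_region hW hW1 d.PV1_nonneg d.PV1_sum d.PV2_nonneg d.PV2_sum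
    d.PX1_nonneg d.PX1_sum d.PX2_nonneg d.PX2_sum
    (cmiDist_pY2V1X2 hW hW1 d.PV1_nonneg d.PV1_sum d.PV2_nonneg d.PX1_nonneg d.PX1_sum
      d.PX2_nonneg)
    (cmiDist_pY1V2X1 hW hW1 d.PV1_nonneg d.PV2_nonneg d.PV2_sum d.PX1_nonneg d.PX2_nonneg
      d.PX2_sum) ?_ ?_ ?_ h1 h2 h3 h4 h5 h6
  · rw [pZV1_eq, ← miDist_eq_info d.PV1_nonneg, ← miDist_swap]
    intro u
    rw [Finset.sum_comm]
    simp_rw [← Finset.mul_sum, hw1, mul_one, d.PV2_sum]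
  · rw [pZV2_eq, ← miDist_eq_info d.PV2_nonneg, ← miDist_swap]
    intro v
    rw [Finset.sum_comm]
    simp_rw [← Finset.mul_sum, hw1, mul_one, d.PV1_sum]
  · rw [pV12Z_eq, ← miDist_eq_info (fun a => mul_nonneg (d.PV1_nonneg _) (d.PV2_nonneg _))
      fun a => hw1 _ _]

end RegionSubset

section Leakage

variable {A D : Type*} [Fintype A] [Fintype D] [Nonempty A]

lemma mul_log_div_le {x m L : ℝ} (hx : 0 ≤ x) (hL : 1 ≤ L) (hm : x ≤ L * m) :
    x * Real.log (x / m) ≤ (1 + Real.log L) * |x - m| := by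
  have hL0 := Real.log_nonneg hL
  rcases hx.eq_or_lt with rfl | hx
  · simp only [zero_mul]
    positivity
  have hm0 : 0 < m := by
    by_contra h
    have := mul_nonneg (sub_nonneg.2 hL) (neg_nonneg.2 (not_lt.1 h))
    linarith
  rcases le_total x m with h | h
  · have := Real.log_nonpos (by positivity) ((div_le_one hm0).2 h)
    exact (mul_nonpos_of_nonneg_of_nonpos hx.le this).trans (by positivity)
  · rw [abs_of_nonneg (sub_nonneg.2 h)]
    have a1 : Real.log (x / m) ≤ Real.log L :=
      Real.log_le_log (by positivity) ((div_le_iff₀ hm0).2 hm)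
    have a2 : m * Real.log (x / m) ≤ x - m := by
      have := mul_le_mul_of_nonneg_left (Real.log_le_sub_one_of_pos (div_pos hx hm0)) hm0.le
      rwa [mul_sub, mul_div_cancel₀ _ hm0.ne', mul_one] at this
    have a3 := mul_le_mul_of_nonneg_left a1 (sub_nonneg.2 h)
    linarith

/-- If the outputs of a channel under most inputs are close to a common law, then a uniform input
leaks little information. -/
lemma info_uniform_le {U : A → D → ℝ} {Q : D → ℝ} {ε : ℝ} (hU : ∀ a d, 0 ≤ U a d)
    (h : 𝔼 a, ∑ d, |U a d - Q d| ≤ ε) :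
    info (fun _ : A => 1 / (Fintype.card A : ℝ)) U ≤
      (1 + Real.log (Fintype.card A)) * (2 * ε) := by
  have hA : (1 : ℝ) ≤ Fintype.card A := by exact_mod_cast Fintype.card_pos
  have hA0 := zero_lt_one.trans_le hA
  have key : ∀ d, ∑ a, 1 / (Fintype.card A : ℝ) * U a d = 𝔼 a, U a d := fun d => by
    rw [Fintype.expect_eq_sum_div_card, ← Finset.mul_sum, one_div_mul_eq_div]
  have hle : ∀ a d, U a d ≤ Fintype.card A * 𝔼 a, U a d := fun a d => by
    rw [Fintype.expect_eq_sum_div_card, mul_div_cancel₀ _ hA0.ne']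
    exact Finset.single_le_sum (f := fun a => U a d) (fun a _ => hU a d) (Finset.mem_univ a)
  have hQ : ∑ d, |Q d - 𝔼 a, U a d| ≤ ε := by
    refine le_trans ?_ h
    rw [Finset.expect_sum_comm]
    refine Finset.sum_le_sum fun d _ => ?_
    have := Finset.abs_expect_le Finset.univ fun a => U a d - Q d
    rwa [Finset.expect_sub_distrib, Fintype.expect_const, abs_sub_comm] at this
  calc info (fun _ : A => 1 / (Fintype.card A : ℝ)) U
      = 𝔼 a, ∑ d, U a d * Real.log (U a d / 𝔼 a, U a d) := by
        simp only [info, key]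
        rw [← Finset.mul_sum, one_div_mul_eq_div, Fintype.expect_eq_sum_div_card]
    _ ≤ 𝔼 a, ∑ d, (1 + Real.log (Fintype.card A)) *
          (|U a d - Q d| + |Q d - 𝔼 a, U a d|) := by
        refine Finset.expect_le_expect fun a _ => Finset.sum_le_sum fun d _ =>
          (mul_log_div_le (hU a d) hA (hle a d)).trans ?_
        have := Real.log_nonneg hA
        exact mul_le_mul_of_nonneg_left (abs_sub_le ..) (by positivity)
    _ = (1 + Real.log (Fintype.card A)) *
          (𝔼 a, ∑ d, |U a d - Q d| + ∑ d, |Q d - 𝔼 a, U a d|) := by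
        simp_rw [← Finset.mul_sum, ← Finset.mul_expect, Finset.sum_add_distrib,
          Finset.expect_add_distrib, Fintype.expect_const]
    _ ≤ _ := by
        have := Real.log_nonneg hA
        exact mul_le_mul_of_nonneg_left (by linarith) (by positivity)

end Leakage

section Encoders

lemma IsGood.card_eq_one {S1 S2 H1 H2 : Type*} [Fintype S1] [Fintype S2] [Fintype H1]
    [Fintype H2] {p : S1 → Fin 1 → S2 → H1 → H2 → Z → ℝ} {ε : ℝ} (h : IsGood (Fin 1) p ε) :
    ∃ (d1 : H1 → S2) (d2 : H2 → S1) (Q : Z → ℝ),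
      (𝔼 s1, 𝔼 s2, ∑ h1, ∑ h2, ∑ z, p s1 0 s2 h1 h2 z *
        (open scoped Classical in if d1 h1 = s2 ∧ d2 h2 = s1 then 0 else 1) ≤ ε) ∧
      (𝔼 s1, ∑ z, |(𝔼 s2, ∑ h1, ∑ h2, p s1 0 s2 h1 h2 z) - Q z| ≤ ε) ∧
      (𝔼 s2, ∑ z, |(𝔼 s1, ∑ h1, ∑ h2, p s1 0 s2 h1 h2 z) - Q z| ≤ ε) := by
  obtain ⟨h0, h1, g1, g2, d1, d2, Q, hQ, hQ1, herr, hl1, hl2⟩ := h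
  refine ⟨d1, fun h => (d2 h).1, Q, ?_, ?_, ?_⟩
  · refine le_of_eq_of_le ?_ herr
    have hg : ∀ x y, g1 x = g2 y := fun _ _ => Subsingleton.elim _ _
    have hd : ∀ y i, d2 y = (i, 0) ↔ (d2 y).1 = i := fun y i =>
      ⟨fun h => by rw [h], fun h => Prod.ext h (Subsingleton.elim _ _)⟩
    simp only [expect_default, Fin.default_eq_zero]
    refine Finset.expect_congr rfl fun s1 _ => Finset.expect_congr rfl fun s2 _ =>
      Finset.sum_congr rfl fun x _ => Finset.sum_congr rfl fun y _ =>
      Finset.sum_congr rfl fun z _ => congrArg _ ?_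
    have : (g1 x = g2 y ∧ d1 x = s2 ∧ d2 y = (s1, 0)) ↔ (d1 x = s2 ∧ (d2 y).1 = s1) := by
      rw [hd, and_iff_right (hg x y)]
    split_ifs <;> tauto
  · refine le_of_eq_of_le ?_ hl1
    simp only [expect_default, Fin.default_eq_zero, Fintype.sum_unique, Fintype.card_unique,
      Nat.cast_one, div_one, Subsingleton.elim (g1 _) 0, if_true, mul_one]
  · refine le_of_eq_of_le ?_ hl2
    simp only [expect_default, Fin.default_eq_zero]

variable {W : X1 → X2 → Y1 × Y2 × Z → ℝ} {N l1 l2 : ℕ} {ε : ℝ}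
  {φ1 : Fin N → Fin l1 → (Fin N → X1) → (Fin N → Y1) → X1 → ℝ}
  {φ2 : Fin N → Fin l2 → (Fin N → X2) → (Fin N → Y2) → X2 → ℝ}

/-- The law of the observations for encoders without shared keys. -/
def encoderLaw {X1 X2 Y1 Y2 Z : Type*} {N l1 l2 : ℕ} (W : X1 → X2 → Y1 × Y2 × Z → ℝ)
    (φ1 : Fin N → Fin l1 → (Fin N → X1) → (Fin N → Y1) → X1 → ℝ)
    (φ2 : Fin N → Fin l2 → (Fin N → X2) → (Fin N → Y2) → X2 → ℝ) :
    Fin l1 → Fin 1 → Fin l2 → (Fin N → X1) × (Fin N → Y1) → (Fin N → X2) × (Fin N → Y2) →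
      (Fin N → Z) → ℝ :=
  codeLaw W (fun s _ x y => ∏ k, φ1 k s x y (x k)) fun s x y => ∏ k, φ2 k s x y (x k)

omit [Fintype X1] [Fintype X2] [Fintype Y1] [Fintype Y2] [Fintype Z] in
lemma PfullA_eq (m1 : Fin l1) (m2 : Fin l2) (x1 : Fin N → X1) (x2 : Fin N → X2) (y1 : Fin N → Y1)
    (y2 : Fin N → Y2) (z : Fin N → Z) :
    PfullA N l1 l2 W φ1 φ2 ((m1, m2), x1, x2, y1, y2, z) =
      1 / (l1 * l2 : ℝ) * encoderLaw W φ1 φ2 m1 0 m2 (x1, y1) (x2, y2) z := by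
  simp only [PfullA, encoderLaw, codeLaw]
  ring

lemma PeA_eq (ψ1 : Fin l1 → (Fin N → X1) → (Fin N → Y1) → Fin l2)
    (ψ2 : Fin l2 → (Fin N → X2) → (Fin N → Y2) → Fin l1) :
    PeA N l1 l2 W φ1 φ2 ψ1 ψ2 =
      𝔼 m1, 𝔼 m2, ∑ h1 : (Fin N → X1) × (Fin N → Y1), ∑ h2 : (Fin N → X2) × (Fin N → Y2), ∑ z,
        encoderLaw W φ1 φ2 m1 0 m2 h1 h2 z *
          (open scoped Classical in
            if ψ1 m1 h1.1 h1.2 = m2 ∧ ψ2 m2 h2.1 h2.2 = m1 then 0 else 1) := by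
  simp only [PeA, PfullA_eq, Fintype.expect_eq_sum_div_card, Fintype.card_fin, Finset.sum_div,
    Fintype.sum_prod_type]
  refine Finset.sum_congr rfl fun m1 _ => Finset.sum_congr rfl fun m2 _ =>
    Finset.sum_congr rfl fun x1 _ => ?_
  rw [Finset.sum_comm]
  refine Finset.sum_congr rfl fun y1 _ => Finset.sum_congr rfl fun x2 _ =>
    Finset.sum_congr rfl fun y2 _ => Finset.sum_congr rfl fun z _ => ?_
  by_cases h1 : ψ1 m1 x1 y1 = m2 <;> by_cases h2 : ψ2 m2 x2 y2 = m1 <;> simp [h1, h2] <;> ring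

lemma leakM1A_eq : leakM1A N l1 l2 W φ1 φ2 =
    miDist (fun p : Fin l1 × (Fin N → Z) => 1 / (Fintype.card (Fin l1) : ℝ) *
      𝔼 m2, ∑ h1, ∑ h2, encoderLaw W φ1 φ2 p.1 0 m2 h1 h2 p.2) := by
  unfold leakM1A
  congr 1
  funext p
  simp only [PfullA_eq, Fintype.expect_eq_sum_div_card, Fintype.card_fin, Finset.sum_div,
    Fintype.sum_prod_type, Finset.mul_sum]
  refine Finset.sum_congr rfl fun m2 _ => Finset.sum_congr rfl fun x1 _ => ?_
  rw [Finset.sum_comm]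
  refine Finset.sum_congr rfl fun y1 _ => Finset.sum_congr rfl fun x2 _ =>
    Finset.sum_congr rfl fun y2 _ => ?_
  ring

lemma leakM2A_eq : leakM2A N l1 l2 W φ1 φ2 =
    miDist (fun p : Fin l2 × (Fin N → Z) => 1 / (Fintype.card (Fin l2) : ℝ) *
      𝔼 m1, ∑ h1, ∑ h2, encoderLaw W φ1 φ2 m1 0 p.1 h1 h2 p.2) := by
  unfold leakM2A
  congr 1
  funext p
  simp only [PfullA_eq, Fintype.expect_eq_sum_div_card, Fintype.card_fin, Finset.sum_div,
    Fintype.sum_prod_type, Finset.mul_sum]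
  refine Finset.sum_congr rfl fun m2 _ => Finset.sum_congr rfl fun x1 _ => ?_
  rw [Finset.sum_comm]
  refine Finset.sum_congr rfl fun y1 _ => Finset.sum_congr rfl fun x2 _ =>
    Finset.sum_congr rfl fun y2 _ => ?_
  ring

/-- Closeness of the channel outputs bounds the mutual information of a uniform message. -/
lemma miDist_uniform {A D : Type*} [Fintype A] [Fintype D] [Nonempty A] {U : A → D → ℝ}
    {Q : D → ℝ} (hU : ∀ a d, 0 ≤ U a d) (hU1 : ∀ a, ∑ d, U a d = 1)
    (h : 𝔼 a, ∑ d, |U a d - Q d| ≤ ε) :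
    0 ≤ miDist (fun p : A × D => 1 / (Fintype.card A : ℝ) * U p.1 p.2) ∧
    miDist (fun p : A × D => 1 / (Fintype.card A : ℝ) * U p.1 p.2) ≤
      (1 + Real.log (Fintype.card A)) * (2 * ε) := by
  have e := miDist_eq_info (P := fun _ : A => 1 / (Fintype.card A : ℝ)) (U := U)
    (fun _ => by positivity) hU1
  rw [e]
  exact ⟨info_nonneg (fun _ => by positivity) (by simp) hU hU1, info_uniform_le hU h⟩

lemma HasCode.exists_encoders (h : HasCode W N l1 1 l2 1 ε) :
    ∃ (φ1 : Fin N → Fin l1 → (Fin N → X1) → (Fin N → Y1) → X1 → ℝ)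
      (φ2 : Fin N → Fin l2 → (Fin N → X2) → (Fin N → Y2) → X2 → ℝ)
      (ψ1 : Fin l1 → (Fin N → X1) → (Fin N → Y1) → Fin l2)
      (ψ2 : Fin l2 → (Fin N → X2) → (Fin N → Y2) → Fin l1),
      Causal N l1 φ1 ∧ Causal N l2 φ2 ∧
      (∀ k m xs ys, (∀ a, 0 ≤ φ1 k m xs ys a) ∧ ∑ a, φ1 k m xs ys a = 1) ∧
      (∀ k m xs ys, (∀ a, 0 ≤ φ2 k m xs ys a) ∧ ∑ a, φ2 k m xs ys a = 1) ∧
      (0 ≤ PeA N l1 l2 W φ1 φ2 ψ1 ψ2 ∧ PeA N l1 l2 W φ1 φ2 ψ1 ψ2 ≤ ε) ∧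
      (0 ≤ leakM1A N l1 l2 W φ1 φ2 ∧
        leakM1A N l1 l2 W φ1 φ2 ≤ (1 + Real.log l1) * (2 * ε)) ∧
      (0 ≤ leakM2A N l1 l2 W φ1 φ2 ∧
        leakM2A N l1 l2 W φ1 φ2 ≤ (1 + Real.log l2) * (2 * ε)) := by
  obtain ⟨⟨hl1, -, hl2, -⟩, q1, q2, hq1, hq2, hg⟩ := h
  have hq1' := fun s => hq1 s 0
  choose φ1 c1 n1 e1 using hq1'
  choose φ2 c2 n2 e2 using hq2
  have hlaw : codeLaw W q1 q2 = encoderLaw W (fun k s => φ1 s k) (fun k s => φ2 s k) := by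
    unfold encoderLaw
    congr
    · funext s c x y
      rw [Subsingleton.elim c 0, e1]
    · funext s x y
      rw [e2]
  rw [hlaw] at hg
  have h0 := hg.1
  have h1 := hg.2.1
  obtain ⟨d1, d2, Q, herr, hleak1, hleak2⟩ := hg.card_eq_one
  have : NeZero l1 := ⟨hl1.ne'⟩
  have : NeZero l2 := ⟨hl2.ne'⟩
  refine ⟨fun k s => φ1 s k, fun k s => φ2 s k, fun _ x y => d1 (x, y), fun _ x y => d2 (x, y),
    fun k m => c1 m k, fun k m => c2 m k, fun k m => n1 m k, fun k m => n2 m k, ?_, ?_, ?_⟩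
  · rw [PeA_eq]
    refine ⟨Finset.expect_nonneg fun m1 _ => Finset.expect_nonneg fun m2 _ =>
      Finset.sum_nonneg fun _ _ => Finset.sum_nonneg fun _ _ => Finset.sum_nonneg fun _ _ =>
      mul_nonneg (h0 ..) (by split_ifs <;> simp), le_of_eq_of_le ?_ herr⟩
    exact Finset.expect_congr rfl fun s1 _ => Finset.expect_congr rfl fun s2 _ =>
      Finset.sum_congr rfl fun x _ => Finset.sum_congr rfl fun y _ =>
      Finset.sum_congr rfl fun z _ => congrArg _ (by congr)
  · rw [leakM1A_eq]
    refine (miDist_uniform (fun m z => Finset.expect_nonneg fun _ _ => Finset.sum_nonneg fun _ _ =>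
      Finset.sum_nonneg fun _ _ => h0 ..) (fun m => ?_) hleak1).imp id (fun h => by simpa using h)
    rw [← Finset.expect_sum_comm]
    refine (Finset.expect_congr rfl fun m2 _ => ?_).trans (Fintype.expect_const (1 : ℝ))
    rw [← h1 m 0 m2, Finset.sum_comm]
    exact Finset.sum_congr rfl fun _ _ => Finset.sum_comm
  · rw [leakM2A_eq]
    refine (miDist_uniform (fun m z => Finset.expect_nonneg fun _ _ => Finset.sum_nonneg fun _ _ =>
      Finset.sum_nonneg fun _ _ => h0 ..) (fun m => ?_) hleak2).imp id (fun h => by simpa using h)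
    rw [← Finset.expect_sum_comm]
    refine (Finset.expect_congr rfl fun m1 _ => ?_).trans (Fintype.expect_const (1 : ℝ))
    rw [← h1 m1 0 m, Finset.sum_comm]
    exact Finset.sum_congr rfl fun _ _ => Finset.sum_comm

end Encoders

section Sequences

/-- A diagonal argument. -/
lemma exists_tendsto_zero {p : ℕ → ℝ → Prop} (h : ∀ η > 0, ∃ N₀ : ℕ, ∀ N ≥ N₀, p N η) :
    ∃ η : ℕ → ℝ, Filter.Tendsto η Filter.atTop (nhds 0) ∧ ∀ᶠ N in Filter.atTop, p N (η N) := by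
  choose N₀ hN₀ using fun k : ℕ => h (1 / (k + 1)) Nat.one_div_pos_of_nat
  set κ : ℕ → ℕ := fun N => Nat.findGreatest (fun k => N₀ k ≤ N) N
  have hκ : Filter.Tendsto κ Filter.atTop Filter.atTop :=
    Filter.tendsto_atTop.2 fun j => by
      filter_upwards [Filter.eventually_ge_atTop (max (N₀ j) j)] with N hN
      exact Nat.le_findGreatest (le_of_max_le_right hN) (le_of_max_le_left hN)
  refine ⟨fun N => 1 / (κ N + 1), tendsto_one_div_add_atTop_nhds_zero_nat.comp hκ, ?_⟩
  filter_upwards [Filter.eventually_ge_atTop (N₀ 0)] with N hN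
  exact hN₀ (κ N) N (Nat.findGreatest_spec (P := fun k => N₀ k ≤ N) N.zero_le hN)

lemma tendsto_of_abs_sub_mul_le {a η : ℕ → ℝ} {R : ℝ}
    (hη : Filter.Tendsto η Filter.atTop (nhds 0))
    (h : ∀ᶠ N : ℕ in Filter.atTop, |a N - N * R| ≤ N * η N) :
    Filter.Tendsto (fun N : ℕ => a N / N) Filter.atTop (nhds R) := by
  rw [tendsto_iff_dist_tendsto_zero]
  refine squeeze_zero' (Filter.Eventually.of_forall fun _ => dist_nonneg) ?_ hη
  filter_upwards [h, Filter.eventually_gt_atTop 0] with N hN hpos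
  have hp : (0 : ℝ) < N := by exact_mod_cast hpos
  rw [Real.dist_eq, show a N / N - R = (a N - N * R) / N by field_simp, abs_div, abs_of_pos hp,
    div_le_iff₀ hp, mul_comm (η N)]
  exact hN

lemma tendsto_leakage {a b ε η : ℕ → ℝ} {R : ℝ} (hη : Filter.Tendsto η Filter.atTop (nhds 0))
    (hε : ∀ N, 0 ≤ ε N) (ha : ∀ N, 0 ≤ a N) (h0 : ∀ N, 0 ≤ b N) (hb : ∀ N, b N ≤ (1 + a N) * (2 * ε N))
    (h : ∀ᶠ N : ℕ in Filter.atTop, |a N - N * R| ≤ N * η N)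
    (h' : ∀ᶠ N : ℕ in Filter.atTop, N * ε N ≤ η N) :
    Filter.Tendsto b Filter.atTop (nhds 0) := by
  have lim : Filter.Tendsto (fun N => 2 * (η N * (1 + (R + η N)))) Filter.atTop (nhds 0) := by
    simpa using (hη.mul ((hη.const_add R).const_add 1)).const_mul 2
  refine squeeze_zero' (Filter.Eventually.of_forall h0) ?_ lim
  filter_upwards [h, h', Filter.eventually_ge_atTop 1] with N h1 h2 h3
  have hN : (1 : ℝ) ≤ N := by exact_mod_cast h3
  have a1 : a N ≤ N * (R + η N) := by linarith [le_of_abs_le h1]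
  have a2 : 0 ≤ R + η N := nonneg_of_mul_nonneg_right ((ha N).trans a1) (by linarith)
  have a3 := mul_le_mul_of_nonneg_right a1 (hε N)
  have a4 := mul_le_mul_of_nonneg_right h2 a2
  have a5 := mul_le_mul_of_nonneg_right hN (hε N)
  have a6 := hb N
  linarith

end Sequences

section Codes

variable {W : X1 → X2 → Y1 × Y2 × Z → ℝ}

lemma exists_codes_of_mem_achievable [Nonempty X1] [Nonempty X2] (hW : ∀ x1 x2 y, 0 ≤ W x1 x2 y)
    (hW1 : ∀ x1 x2, ∑ y, W x1 x2 y = 1) {r : ℝ × ℝ} (hr : r ∈ achievable W) :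
    ∃ (L1 L2 : ℕ → ℕ)
      (φ1 : ∀ n, Fin n → Fin (L1 n) → (Fin n → X1) → (Fin n → Y1) → X1 → ℝ)
      (φ2 : ∀ n, Fin n → Fin (L2 n) → (Fin n → X2) → (Fin n → Y2) → X2 → ℝ)
      (ψ1 : ∀ n, Fin (L1 n) → (Fin n → X1) → (Fin n → Y1) → Fin (L2 n))
      (ψ2 : ∀ n, Fin (L2 n) → (Fin n → X2) → (Fin n → Y2) → Fin (L1 n)),
      (∀ n, Causal n (L1 n) (φ1 n)) ∧
      (∀ n, Causal n (L2 n) (φ2 n)) ∧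
      (∀ n k m xs ys, (∀ a, 0 ≤ φ1 n k m xs ys a) ∧ ∑ a, φ1 n k m xs ys a = 1) ∧
      (∀ n k m xs ys, (∀ a, 0 ≤ φ2 n k m xs ys a) ∧ ∑ a, φ2 n k m xs ys a = 1) ∧
      Filter.Tendsto (fun n => Real.log (L1 n) / (n : ℝ)) Filter.atTop (nhds r.1) ∧
      Filter.Tendsto (fun n => Real.log (L2 n) / (n : ℝ)) Filter.atTop (nhds r.2) ∧
      Filter.Tendsto (fun n => PeA n (L1 n) (L2 n) W (φ1 n) (φ2 n) (ψ1 n) (ψ2 n))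
        Filter.atTop (nhds 0) ∧
      Filter.Tendsto (fun n => leakM1A n (L1 n) (L2 n) W (φ1 n) (φ2 n))
        Filter.atTop (nhds 0) ∧
      Filter.Tendsto (fun n => leakM2A n (L1 n) (L2 n) W (φ1 n) (φ2 n))
        Filter.atTop (nhds 0) := by
  obtain ⟨η, hη, hev⟩ := exists_tendsto_zero hr
  have key : ∀ N, ∃ l1 l2 ε, HasCode W N l1 1 l2 1 ε ∧
      ((∃ l1 l2 ε, HasCode W N l1 1 l2 1 ε ∧ N * ε ≤ η N ∧
        |Real.log l1 - N * r.1| ≤ N * η N ∧ |Real.log l2 - N * r.2| ≤ N * η N) →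
        N * ε ≤ η N ∧ |Real.log l1 - N * r.1| ≤ N * η N ∧
        |Real.log l2 - N * r.2| ≤ N * η N) := fun N => by
    by_cases h : ∃ l1 l2 ε, HasCode W N l1 1 l2 1 ε ∧ N * ε ≤ η N ∧
        |Real.log l1 - N * r.1| ≤ N * η N ∧ |Real.log l2 - N * r.2| ≤ N * η N
    · obtain ⟨l1, l2, ε, hc, hb⟩ := h
      exact ⟨l1, l2, ε, hc, fun _ => hb⟩
    · exact ⟨1, 1, 0, hasCode_one hW hW1 N, fun h' => (h h').elim⟩
  choose L1 L2 ε hcode hgood using key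
  choose φ1 φ2 ψ1 ψ2 hc1 hc2 hk1 hk2 hPe hM1 hM2 using fun N => (hcode N).exists_encoders
  have hε : ∀ N, 0 ≤ ε N := fun N => (hPe N).1.trans (hPe N).2
  have ev := hev.mono fun N => hgood N
  have ev' := ev.mono fun _ h => h.1
  have ev1 := ev.mono fun _ h => h.2.1
  have ev2 := ev.mono fun _ h => h.2.2
  refine ⟨L1, L2, φ1, φ2, ψ1, ψ2, hc1, hc2, hk1, hk2, tendsto_of_abs_sub_mul_le hη ev1,
    tendsto_of_abs_sub_mul_le hη ev2, ?_,
    tendsto_leakage hη hε (fun N => Real.log_natCast_nonneg _) (fun N => (hM1 N).1)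
      (fun N => (hM1 N).2) ev1 ev',
    tendsto_leakage hη hε (fun N => Real.log_natCast_nonneg _) (fun N => (hM2 N).1)
      (fun N => (hM2 N).2) ev2 ev'⟩
  refine squeeze_zero' (Filter.Eventually.of_forall fun N => (hPe N).1) ?_ hη
  filter_upwards [ev', Filter.eventually_ge_atTop 1] with N h1 h2
  have hN : (1 : ℝ) ≤ N := by exact_mod_cast h2
  have := mul_le_mul_of_nonneg_right hN (hε N)
  linarith [(hPe N).2]

end Codes

/-- Every rate pair in the region `ℛ_{I,A}` (closure of the convex hull of the single-
letter regions over all input distributions in `𝒬`) is achievable under the strong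
individual secrecy constraint by adaptive codes. -/
theorem achievable_individual_adaptive
    {X1 X2 Y1 Y2 Z : Type*}
    [Fintype X1] [Fintype X2] [Fintype Y1] [Fintype Y2] [Fintype Z]
    (W : X1 → X2 → Y1 × Y2 × Z → ℝ)
    (hW0 : ∀ x1 x2 p, 0 ≤ W x1 x2 p) (hW1 : ∀ x1 x2, ∑ p, W x1 x2 p = 1)
    (r : ℝ × ℝ)
    (hr : r ∈ closure (convexHull ℝ
      {p : ℝ × ℝ | ∃ d : InputDist X1 X2, 0 ≤ p.1 ∧ 0 ≤ p.2 ∧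
        p.1 ≤ cmiDist (pY2V1X2 d.PV1 d.PX1 d.PV2 d.PX2 W) ∧
        p.2 ≤ cmiDist (pY1V2X1 d.PV1 d.PX1 d.PV2 d.PX2 W) ∧
        max p.1 p.2 ≤ cmiDist (pY2V1X2 d.PV1 d.PX1 d.PV2 d.PX2 W) +
          cmiDist (pY1V2X1 d.PV1 d.PX1 d.PV2 d.PX2 W) -
          miDist (pV12Z d.PV1 d.PX1 d.PV2 d.PX2 W) ∧
        p.1 + p.2 ≤
          min (cmiDist (pY2V1X2 d.PV1 d.PX1 d.PV2 d.PX2 W) -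
                miDist (pZV1 d.PV1 d.PX1 d.PV2 d.PX2 W))
              (cmiDist (pY2V1X2 d.PV1 d.PX1 d.PV2 d.PX2 W) +
                cmiDist (pY1V2X1 d.PV1 d.PX1 d.PV2 d.PX2 W) -
                miDist (pV12Z d.PV1 d.PX1 d.PV2 d.PX2 W)) +
          min (cmiDist (pY1V2X1 d.PV1 d.PX1 d.PV2 d.PX2 W) -
                miDist (pZV2 d.PV1 d.PX1 d.PV2 d.PX2 W))
              (cmiDist (pY2V1X2 d.PV1 d.PX1 d.PV2 d.PX2 W) +
                cmiDist (pY1V2X1 d.PV1 d.PX1 d.PV2 d.PX2 W) -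
                miDist (pV12Z d.PV1 d.PX1 d.PV2 d.PX2 W))})) :
    ∃ (L1 L2 : ℕ → ℕ)
      (φ1 : ∀ n, Fin n → Fin (L1 n) → (Fin n → X1) → (Fin n → Y1) → X1 → ℝ)
      (φ2 : ∀ n, Fin n → Fin (L2 n) → (Fin n → X2) → (Fin n → Y2) → X2 → ℝ)
      (ψ1 : ∀ n, Fin (L1 n) → (Fin n → X1) → (Fin n → Y1) → Fin (L2 n))
      (ψ2 : ∀ n, Fin (L2 n) → (Fin n → X2) → (Fin n → Y2) → Fin (L1 n)),
      (∀ n, Causal n (L1 n) (φ1 n)) ∧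
      (∀ n, Causal n (L2 n) (φ2 n)) ∧
      (∀ n k m xs ys, (∀ a, 0 ≤ φ1 n k m xs ys a) ∧ ∑ a, φ1 n k m xs ys a = 1) ∧
      (∀ n k m xs ys, (∀ a, 0 ≤ φ2 n k m xs ys a) ∧ ∑ a, φ2 n k m xs ys a = 1) ∧
      Filter.Tendsto (fun n => Real.log (L1 n) / (n : ℝ)) Filter.atTop (nhds r.1) ∧
      Filter.Tendsto (fun n => Real.log (L2 n) / (n : ℝ)) Filter.atTop (nhds r.2) ∧
      Filter.Tendsto (fun n => PeA n (L1 n) (L2 n) W (φ1 n) (φ2 n) (ψ1 n) (ψ2 n))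
        Filter.atTop (nhds 0) ∧
      Filter.Tendsto (fun n => leakM1A n (L1 n) (L2 n) W (φ1 n) (φ2 n))
        Filter.atTop (nhds 0) ∧
      Filter.Tendsto (fun n => leakM2A n (L1 n) (L2 n) W (φ1 n) (φ2 n))
        Filter.atTop (nhds 0) := by
  obtain ⟨d⟩ : Nonempty (InputDist X1 X2) := by
    obtain ⟨_, ⟨d, -⟩⟩ := convexHull_nonempty_iff.1 (closure_nonempty_iff.1 ⟨r, hr⟩)
    exact ⟨d⟩
  have := d.nonempty_fst
  have := d.nonempty_snd
  refine exists_codes_of_mem_achievable hW0 hW1 (closure_minimal (convexHull_min ?_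
    convex_achievable) isClosed_achievable hr)
  rintro p ⟨d, hp⟩
  exact region_subset_achievable hW0 hW1 d hp

end
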